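/- Let H be a Hopf algebra of dimension 125 = 5³ that is nonsemisimple, nonpointed and non-copointed and is of type (5,5). Then H and its dual H* cannot both contain a nontrivial skew-primitive element. -/

import Mathlib

open TensorProduct

namespace HopfClass

variable (k : Type*) [Field k]

section Wrt

variable {M : Type*} [AddCommGroup M] [Module k M]

/-- A subspace `C` is a subcoalgebra with respect to a comultiplication-like map `Δ`
if `Δ` maps `C` into the image of `C ⊗ C` in `M ⊗ M`. -/
def IsSubcoalgWrt (Δ : M →ₗ[k] M ⊗[k] M) (C : Submodule k M) : Prop :=
  ∀ x ∈ C, Δ x ∈ LinearMap.range (TensorProduct.map C.subtype C.subtype)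

/-- A simple subcoalgebra: a nonzero subcoalgebra with no nonzero proper subcoalgebras. -/
def IsSimpleSubcoalgWrt (Δ : M →ₗ[k] M ⊗[k] M) (C : Submodule k M) : Prop :=
  IsSubcoalgWrt k Δ C ∧ C ≠ ⊥ ∧
    ∀ D : Submodule k M, IsSubcoalgWrt k Δ D → D < C → D = ⊥

/-- Pointedness: every simple subcoalgebra is one-dimensional. -/
def IsPointedWrt (Δ : M →ₗ[k] M ⊗[k] M) : Prop :=
  ∀ C : Submodule k M, IsSimpleSubcoalgWrt k Δ C → Module.finrank k C = 1

/-- Grouplike element with respect to `Δ`. -/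
def IsGrouplikeWrt (Δ : M →ₗ[k] M ⊗[k] M) (g : M) : Prop :=
  g ≠ 0 ∧ Δ g = g ⊗ₜ[k] g

/-- `y` is a `(h, g)`-skew-primitive with respect to `Δ`, i.e. `Δ y = g ⊗ y + y ⊗ h`. -/
def IsSkewPrimitiveWrt (Δ : M →ₗ[k] M ⊗[k] M) (g h y : M) : Prop :=
  Δ y = g ⊗ₜ[k] y + y ⊗ₜ[k] h

/-- There are no nontrivial skew-primitive elements: every skew-primitive between grouplikes
is a scalar multiple of the difference of the grouplikes. -/
def HasNoNontrivialSkewPrimitivesWrt (Δ : M →ₗ[k] M ⊗[k] M) : Prop :=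
  ∀ g h y : M, IsGrouplikeWrt k Δ g → IsGrouplikeWrt k Δ h →
    IsSkewPrimitiveWrt k Δ g h y → ∃ c : k, y = c • (g - h)

end Wrt

section Coalg

variable (H : Type*) [AddCommGroup H] [Module k H] [Coalgebra k H]

/-- The comultiplication of a coalgebra, as a linear map. -/
noncomputable abbrev comulL : H →ₗ[k] H ⊗[k] H := CoalgebraStruct.comul

/-- The coradical of a coalgebra: the sum of all its simple subcoalgebras. -/
noncomputable def coradical : Submodule k H :=
  sSup {C : Submodule k H | IsSimpleSubcoalgWrt k (comulL k H) C}

/-- A coalgebra is cosemisimple if it equals its coradical. -/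
def IsCosemisimple : Prop := coradical k H = ⊤

/-- A coalgebra is pointed if all its simple subcoalgebras are one-dimensional. -/
def IsPointed : Prop := IsPointedWrt k (comulL k H)

/-- The set of grouplike elements. -/
def grouplikes : Set H := {g : H | IsGrouplikeWrt k (comulL k H) g}

/-- `e` is a multiplicative matrix of size `n` spanning the subspace `C`, i.e. a
linearly independent family with `Δ(e i j) = ∑ l, e i l ⊗ e l j` and `ε(e i j) = δ_ij`
whose span is `C`; this says precisely that `C` is a simple matrix subcoalgebra
isomorphic to `M*(n,k)`, the dual of the `n × n` matrix algebra. -/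
def IsMultMatrix (n : ℕ) (C : Submodule k H) (e : Fin n → Fin n → H) : Prop :=
  LinearIndependent k (fun p : Fin n × Fin n => e p.1 p.2) ∧
  C = Submodule.span k (Set.range fun p : Fin n × Fin n => e p.1 p.2) ∧
  (∀ i j, CoalgebraStruct.comul (R := k) (e i j) = ∑ l : Fin n, e i l ⊗ₜ[k] e l j) ∧
  (∀ i j, Coalgebra.counit (R := k) (e i j) = if i = j then (1 : k) else 0)

/-- `C` is a (simple matrix) subcoalgebra isomorphic to the matrix coalgebra `M*(n,k)`. -/
def IsMatrixSubcoalg (n : ℕ) (C : Submodule k H) : Prop :=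
  ∃ e : Fin n → Fin n → H, IsMultMatrix k H n C e

end Coalg

section Dual

variable (H : Type*) [Ring H] [Algebra k H] [FiniteDimensional k H]

/-- The comultiplication on the dual of a finite-dimensional algebra:
the dual map of the multiplication, composed with the canonical identification
`(H ⊗ H)* ≃ H* ⊗ H*`. -/
noncomputable def dualComul :
    Module.Dual k H →ₗ[k] Module.Dual k H ⊗[k] Module.Dual k H :=
  (TensorProduct.dualDistribEquiv k H H).symm.toLinearMap ∘ₗ
    (LinearMap.mul' k H).dualMap

/-- A finite-dimensional Hopf algebra is copointed if its dual is pointed. -/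
def IsCopointed : Prop := IsPointedWrt k (dualComul k H)

/-- The grouplike elements of the dual Hopf algebra. -/
def dualGrouplikes : Set (Module.Dual k H) :=
  {f : Module.Dual k H | IsGrouplikeWrt k (dualComul k H) f}

end Dual

section Taft

variable (p : ℕ) (q : k)

/-- `B` is (isomorphic to) the Taft Hopf algebra `T_q` of dimension `p²`: `q` is a primitive
`p`-th root of unity, `B` has dimension `p²` and is generated as an algebra by a grouplike `g`
and a `(1,g)`-skew-primitive `x` with `g^p = 1`, `x^p = 0` and `g x = q x g`. -/
def IsTaftAlgebra (B : Type*) [Ring B] [Bialgebra k B] : Prop :=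
  IsPrimitiveRoot q p ∧ Module.finrank k B = p ^ 2 ∧
  ∃ g x : B,
    IsGrouplikeWrt k (comulL k B) g ∧
    CoalgebraStruct.comul (R := k) x = x ⊗ₜ[k] (1 : B) + g ⊗ₜ[k] x ∧
    g ^ p = 1 ∧ x ^ p = 0 ∧ g * x = q • (x * g) ∧
    Algebra.adjoin k {g, x} = (⊤ : Subalgebra k B)

variable {H : Type*} [Ring H] [Bialgebra k H]

/-- The subalgebra `T` of `H` is a sub-Hopf algebra isomorphic to the Taft algebra `T_q` of
dimension `p²`, generated by a grouplike `g` and a `(1,g)`-skew-primitive `x` satisfying the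
Taft relations. -/
def IsTaftSubalgebra (T : Subalgebra k H) : Prop :=
  IsPrimitiveRoot q p ∧ Module.finrank k T = p ^ 2 ∧
  ∃ g x : H,
    IsGrouplikeWrt k (comulL k H) g ∧
    CoalgebraStruct.comul (R := k) x = x ⊗ₜ[k] (1 : H) + g ⊗ₜ[k] x ∧
    g ^ p = 1 ∧ x ^ p = 0 ∧ g * x = q • (x * g) ∧
    Algebra.adjoin k {g, x} = T

/-- The right coinvariants `H^{co π}` of a linear map `π : H → B` on a bialgebra `H`:
elements `h` with `(id ⊗ π)(Δ h) = h ⊗ 1`. -/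
def rightCoinvariants {B : Type*} [Ring B] [Bialgebra k B] (π : H →ₗ[k] B) : Set H :=
  {h : H | (TensorProduct.map LinearMap.id π) (CoalgebraStruct.comul (R := k) h)
      = h ⊗ₜ[k] (1 : B)}

end Taft

end HopfClass

namespace HopfDim

section QBinomial

variable {k : Type*} [Field k]

/-- The Gaussian binomial coefficients evaluated at `ζ`. -/
def qbin (ζ : k) : ℕ → ℕ → k
  | 0, 0 => 1
  | 0, _ + 1 => 0
  | _ + 1, 0 => 1
  | m + 1, i + 1 => qbin ζ m i + ζ ^ (i + 1) * qbin ζ m (i + 1)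

lemma qbin_zero_right (ζ : k) (m : ℕ) : qbin ζ m 0 = 1 := by
  cases m <;> rfl

lemma qbin_eq_zero (ζ : k) {m i : ℕ} (h : m < i) : qbin ζ m i = 0 := by
  induction m generalizing i with
  | zero => obtain ⟨j, rfl⟩ := Nat.exists_eq_add_of_lt h; simp [qbin]
  | succ m ih =>
    obtain ⟨j, rfl⟩ : ∃ j, i = j + 1 := ⟨i - 1, by omega⟩
    simp [qbin, ih (show m < j by omega), ih (show m < j + 1 by omega)]

lemma qbin_self (ζ : k) (m : ℕ) : qbin ζ m m = 1 := by
  induction m with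
  | zero => rfl
  | succ m ih => simp [qbin, ih, qbin_eq_zero]

lemma qbin_one_right (ζ : k) (m : ℕ) : qbin ζ m 1 = ∑ i ∈ Finset.range m, ζ ^ i := by
  induction m with
  | zero => simp [qbin]
  | succ m ih => rw [qbin, qbin_zero_right, ih, Finset.sum_range_succ', Finset.mul_sum]
                 simp [pow_succ', add_comm]

lemma qbin_one_right_ne_zero_of_one [CharZero k] {m : ℕ} (hm : m ≠ 0) : qbin (1 : k) m 1 ≠ 0 := by
  simp [qbin_one_right, hm]

lemma qbin_one_right_ne_zero {ζ : k} {p : ℕ} (hζ : IsPrimitiveRoot ζ p) {m : ℕ} (hm : m ≠ 0)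
    (hmp : m < p) : qbin ζ m 1 ≠ 0 := by
  rw [qbin_one_right]
  intro h
  have := mul_neg_geom_sum ζ m
  rw [h, mul_zero] at this
  exact hζ.pow_ne_one_of_pos_of_lt hm hmp (by linear_combination this)

lemma qbin_five {ζ : k} (hζ : IsPrimitiveRoot ζ 5) {i : ℕ} (h0 : 0 < i) (h5 : i < 5) :
    qbin ζ 5 i = 0 := by
  have h := hζ.geom_sum_eq_zero (by norm_num)
  simp only [Finset.sum_range_succ, Finset.sum_range_zero] at h
  interval_cases i
  · simp only [qbin]; linear_combination h
  · simp only [qbin]; linear_combination (1 + ζ ^ 2) * h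
  · simp only [qbin]; linear_combination (1 + ζ ^ 2) * h
  · simp only [qbin]; linear_combination h

lemma add_pow_of_qcomm {R : Type*} [Ring R] [Algebra k R] {ζ : k} {A B : R}
    (h : B * A = ζ • (A * B)) (m : ℕ) :
    (A + B) ^ m = ∑ i ∈ Finset.range (m + 1), qbin ζ m i • (A ^ i * B ^ (m - i)) := by
  have hBA : ∀ i, B * A ^ i = ζ ^ i • (A ^ i * B) := by
    intro i
    induction i with
    | zero => simp
    | succ i ih =>
      rw [pow_succ, ← mul_assoc, ih, smul_mul_assoc, mul_assoc, h, mul_smul_comm, smul_smul,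
        ← pow_succ, mul_assoc]
  induction m with
  | zero => simp [qbin]
  | succ m ih =>
    rw [pow_succ', ih, add_mul, Finset.mul_sum, Finset.mul_sum, Finset.sum_range_succ' _ (m + 1)]
    have h1 : ∀ i ∈ Finset.range (m + 1), A * qbin ζ m i • (A ^ i * B ^ (m - i)) =
        qbin ζ m i • (A ^ (i + 1) * B ^ (m - i)) := by
      intro i _
      rw [mul_smul_comm, ← mul_assoc, pow_succ']
    have h2 : ∀ i ∈ Finset.range (m + 1), B * qbin ζ m i • (A ^ i * B ^ (m - i)) =
        (ζ ^ i * qbin ζ m i) • (A ^ i * B ^ (m + 1 - i)) := by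
      intro i hi
      have : m + 1 - i = (m - i) + 1 := by
        have := Finset.mem_range.mp hi; omega
      rw [mul_smul_comm, ← mul_assoc, hBA, smul_mul_assoc, smul_smul, this, pow_succ', mul_assoc,
        mul_comm]
    rw [Finset.sum_congr rfl h1, Finset.sum_congr rfl h2]
    have h3 : ∑ i ∈ Finset.range (m + 1), (ζ ^ i * qbin ζ m i) • (A ^ i * B ^ (m + 1 - i)) =
        ∑ i ∈ Finset.range (m + 2), (ζ ^ i * qbin ζ m i) • (A ^ i * B ^ (m + 1 - i)) := by
      rw [Finset.sum_range_succ _ (m + 1), qbin_eq_zero ζ (Nat.lt_succ_self m)]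
      simp
    rw [h3, Finset.sum_range_succ' _ (m + 1), ← add_assoc, ← Finset.sum_add_distrib]
    congr 1
    · refine Finset.sum_congr rfl fun i _ => ?_
      rw [Nat.add_sub_add_right, ← add_smul, qbin]
    · simp [qbin_zero_right]

end QBinomial

section Slice

variable {k : Type*} [Field k] {M N : Type*} [AddCommGroup M] [Module k M]
  [AddCommGroup N] [Module k N]

/-- Evaluation of a functional on the left tensor factor. -/
noncomputable def lslice (f : Module.Dual k M) : M ⊗[k] N →ₗ[k] N :=
  (TensorProduct.lid k N).toLinearMap ∘ₗ f.rTensor N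

/-- Evaluation of a functional on the right tensor factor. -/
noncomputable def rslice (f : Module.Dual k N) : M ⊗[k] N →ₗ[k] M :=
  (TensorProduct.rid k M).toLinearMap ∘ₗ f.lTensor M

@[simp] lemma lslice_tmul (f : Module.Dual k M) (a : M) (b : N) :
    lslice f (a ⊗ₜ[k] b) = f a • b := by simp [lslice]

@[simp] lemma rslice_tmul (f : Module.Dual k N) (a : M) (b : N) :
    rslice f (a ⊗ₜ[k] b) = f b • a := by simp [rslice]

lemma apply_lslice (f : Module.Dual k M) (g : Module.Dual k N) (t : M ⊗[k] N) :
    g (lslice f t) = f (rslice g t) := by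
  induction t with
  | zero => simp
  | tmul a b => simp [mul_comm]
  | add a b ha hb => simp [ha, hb]

lemma eq_zero_of_dual {a : M} (h : ∀ f : Module.Dual k M, f a = 0) : a = 0 :=
  (Module.forall_dual_apply_eq_zero_iff k a).mp h

lemma eq_of_dual {a b : M} (h : ∀ f : Module.Dual k M, f a = f b) : a = b :=
  by
  rw [← sub_eq_zero]
  exact eq_zero_of_dual (k := k) fun f => by rw [map_sub, h, sub_self]

lemma eq_of_rslice {t t' : M ⊗[k] N} (h : ∀ f : Module.Dual k N, rslice f t = rslice f t') :
    t = t' := by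
  classical
  let b := Module.Basis.ofVectorSpace k N
  apply (TensorProduct.equivFinsuppOfBasisRight (M := M) b).injective
  ext i
  have key : ∀ s : M ⊗[k] N, TensorProduct.equivFinsuppOfBasisRight b s i = rslice (b.coord i) s := by
    intro s
    induction s with
    | zero => simp
    | tmul x y => simp
    | add x y hx hy => simp [hx, hy]
  rw [key, key, h]

lemma eq_of_lslice {t t' : M ⊗[k] N} (h : ∀ f : Module.Dual k M, lslice f t = lslice f t') :
    t = t' :=
  eq_of_rslice fun g => eq_of_dual fun f => by rw [← apply_lslice, h, apply_lslice]

lemma exists_dual_of_linearIndependent {ι : Type*} {v : ι → M} (hv : LinearIndependent k v)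
    (c : ι → k) : ∃ f : Module.Dual k M, ∀ i, f (v i) = c i := by
  let b := Module.Basis.span hv
  obtain ⟨g, hg⟩ := LinearMap.exists_extend (p := Submodule.span k (Set.range v)) (b.constr k c)
  refine ⟨g, fun i => ?_⟩
  have h1 : g (v i) = (g ∘ₗ (Submodule.span k (Set.range v)).subtype) (b i) := by
    simp [b, Module.Basis.span_apply]
  rw [h1, hg]
  simp

lemma exists_dual_ne_zero_of_notMem {p : Submodule k M} {x : M} (hx : x ∉ p) :
    ∃ f : Module.Dual k M, f x ≠ 0 ∧ ∀ y ∈ p, f y = 0 := by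
  obtain ⟨f, hf, hp⟩ := Submodule.exists_le_ker_of_notMem hx
  exact ⟨f, hf, fun y hy => hp hy⟩

/-- A family indexed by an initial segment which is dependent admits a first member lying in the
span of its independent predecessors. -/
lemma exists_first_dependent (X : ℕ → M) {n : ℕ}
    (h : ¬ LinearIndependent k fun i : Fin n => X i) :
    ∃ m < n, (LinearIndependent k fun i : Fin m => X i) ∧
      X m ∈ Submodule.span k (Set.range fun i : Fin m => X i) := by
  classical
  have hex : ∃ n, ¬ LinearIndependent k fun i : Fin n => X i := ⟨n, h⟩
  have h0 : Nat.find hex ≠ 0 := by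
    intro h0
    have := Nat.find_spec hex
    rw [h0] at this
    exact this (linearIndependent_empty_type)
  obtain ⟨m, hm⟩ := Nat.exists_eq_succ_of_ne_zero h0
  have hspec := Nat.find_spec hex
  have hlt : ¬ ¬ LinearIndependent k fun i : Fin m => X i := Nat.find_min hex (by omega)
  rw [hm] at hspec
  have hle : Nat.find hex ≤ n := Nat.find_min' hex h
  refine ⟨m, by omega, not_not.mp hlt, ?_⟩
  by_contra hmem
  apply hspec
  have := (not_not.mp hlt).finSnoc hmem
  convert this using 1
  ext i
  refine Fin.lastCases ?_ (fun i => ?_) i <;> simp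

lemma exists_smul_eq_of_dependent (Δ : M →ₗ[k] M ⊗[k] M) (X : ℕ → M) (Z : ℕ → ℕ → M) (ζ : k)
    (hΔ : ∀ m, Δ (X m) = ∑ i ∈ Finset.range (m + 1), (qbin ζ m i • Z i (m - i)) ⊗ₜ[k] X (m - i))
    (hX : X 0 ≠ 0) {n : ℕ} (h : ¬ LinearIndependent k fun i : Fin n => X i) :
    ∃ m, m ≠ 0 ∧ m < n ∧ ∃ t : k, qbin ζ m 1 • Z 1 (m - 1) = t • (Z 0 (m - 1) - Z 0 m) := by
  obtain ⟨m, hmn, hli, hmem⟩ := exists_first_dependent X h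
  have hm0 : m ≠ 0 := by
    rintro rfl
    simp at hmem
    exact hX hmem
  refine ⟨m, hm0, hmn, ?_⟩
  obtain ⟨t, ht⟩ := (Submodule.mem_span_range_iff_exists_fun k).mp hmem
  obtain ⟨f, hf⟩ := exists_dual_of_linearIndependent hli fun i => if (i : ℕ) = m - 1 then 1 else 0
  have hf' : ∀ j < m, f (X j) = if j = m - 1 then 1 else 0 := fun j hj => hf ⟨j, hj⟩
  refine ⟨t ⟨m - 1, by omega⟩, ?_⟩
  have h1 : rslice f (Δ (X m)) = f (X m) • Z 0 m + qbin ζ m 1 • Z 1 (m - 1) := by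
    rw [hΔ, map_sum, Finset.sum_range_succ', Finset.sum_eq_single_of_mem 0 (by simp; omega)]
    · rw [rslice_tmul, rslice_tmul, hf' _ (by omega)]
      simp [qbin_zero_right, add_comm]
    · intro i hi hi0
      have : i < m := by simpa using hi
      rw [rslice_tmul, hf' _ (by omega), if_neg (by omega), zero_smul]
  have h2 : ∀ j < m, rslice f (Δ (X j)) = (if j = m - 1 then (1 : k) else 0) • Z 0 (m - 1) := by
    intro j hj
    rw [hΔ, map_sum, Finset.sum_range_succ', Finset.sum_eq_zero, rslice_tmul, Nat.sub_zero, hf' _ hj]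
    · split_ifs with hj'
      · simp [qbin_zero_right, hj']
      · simp
    · intro i hi
      have : i < j := by simpa using hi
      rw [rslice_tmul, hf' _ (by omega), if_neg (by omega), zero_smul]
  have h3 : f (X m) = t ⟨m - 1, by omega⟩ := by
    rw [← ht, map_sum, Finset.sum_eq_single ⟨m - 1, by omega⟩]
    · simp [hf' (m - 1) (by omega)]
    · intro b _ hb
      have : (b : ℕ) ≠ m - 1 := fun h => hb (Fin.ext h)
      simp [hf' b b.2, this]
    · simp
  have h4 : rslice f (Δ (X m)) = t ⟨m - 1, by omega⟩ • Z 0 (m - 1) := by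
    rw [← ht, map_sum, map_sum, Finset.sum_eq_single ⟨m - 1, by omega⟩]
    · simp [h2 (m - 1) (by omega)]
    · intro b _ hb
      have : (b : ℕ) ≠ m - 1 := fun h => hb (Fin.ext h)
      simp [h2 b b.2, this]
    · simp
  rw [h1, h3] at h4
  rw [smul_sub, ← h4]
  abel

end Slice

section Eigen

variable {k : Type*} [Field k] {M : Type*} [AddCommGroup M] [Module k M]

/-- Five times the projection onto the `ω`-eigenspace of an operator of order five. -/
def eigProj (Φ : Module.End k M) (ω : k) : Module.End k M :=
  ∑ i ∈ Finset.range 5, (ω ^ 4) ^ i • Φ ^ i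

lemma mul_eigProj {Φ : Module.End k M} (hΦ : Φ ^ 5 = 1) {ω : k} (hω : ω ^ 5 = 1) :
    Φ * eigProj Φ ω = ω • eigProj Φ ω := by
  have e0 : ω * (ω ^ 4) = 1 := by linear_combination hω
  have e1 : ω * (ω ^ 4) ^ 2 = ω ^ 4 := by linear_combination (ω ^ 4) * hω
  have e2 : ω * (ω ^ 4) ^ 3 = (ω ^ 4) ^ 2 := by linear_combination (ω ^ 4) ^ 2 * hω
  have e3 : ω * ω = (ω ^ 4) ^ 3 := by linear_combination (-(ω ^ 2) * (ω ^ 5 + 1)) * hω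
  have e4 : (ω ^ 4) ^ 4 = ω := by linear_combination (ω * (ω ^ 10 + ω ^ 5 + 1)) * hω
  have e5 : Φ * Φ ^ 4 = 1 := by rw [← pow_succ', hΦ]
  simp only [eigProj, Finset.sum_range_succ, Finset.sum_range_zero, mul_add, smul_add, smul_smul,
    mul_smul_comm, e0, e1, e2, e3, e4, e5, pow_zero, pow_one, mul_one, one_smul, zero_add,
    mul_one, ← pow_succ']
  rw [← pow_two]
  abel

lemma eigProj_mem {Φ : Module.End k M} {P : Submodule k M} (hP : ∀ x ∈ P, Φ x ∈ P) (ω : k) {x : M}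
    (hx : x ∈ P) : eigProj Φ ω x ∈ P := by
  have : ∀ i, (Φ ^ i) x ∈ P := by
    intro i
    induction i with
    | zero => simpa
    | succ i ih => rw [pow_succ']; exact hP _ ih
  simp only [eigProj, LinearMap.sum_apply, LinearMap.smul_apply]
  exact P.sum_mem fun i _ => P.smul_mem _ (this i)

lemma sum_eigProj {Φ : Module.End k M} {ζ : k} (hζ : IsPrimitiveRoot ζ 5) :
    ∑ j ∈ Finset.range 5, eigProj Φ (ζ ^ j) = (5 : k) • (1 : Module.End k M) := by
  have h := hζ.geom_sum_eq_zero (by norm_num)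
  simp only [eigProj]
  rw [Finset.sum_comm]
  simp only [← Finset.sum_smul]
  have key : ∀ i ∈ Finset.range 5, ∑ j ∈ Finset.range 5, ((ζ ^ j) ^ 4) ^ i =
      if i = 0 then (5 : k) else 0 := by
    intro i hi
    have h1 : ∀ j, ((ζ ^ j) ^ 4) ^ i = (ζ ^ (4 * i)) ^ j := by
      intro j; rw [← pow_mul, ← pow_mul, ← pow_mul]; congr 1; ring
    simp only [h1]
    split_ifs with hi0
    · simp [hi0]
    · have hi5 : i < 5 := Finset.mem_range.mp hi
      have h5 : IsPrimitiveRoot (ζ ^ (4 * i)) 5 := by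
        apply hζ.pow_of_coprime
        have : i ∈ ({1, 2, 3, 4} : Finset ℕ) := by simp; omega
        fin_cases this <;> decide
      exact h5.geom_sum_eq_zero (by norm_num)
  rw [Finset.sum_congr rfl fun i hi => by rw [key i hi]]
  rw [Finset.sum_eq_single_of_mem 0 (by simp)]
  · simp
  · intro b _ hb; simp [hb]

lemma exists_eigenvector [CharZero k] {Φ : Module.End k M} (hΦ : Φ ^ 5 = 1) {ζ : k}
    (hζ : IsPrimitiveRoot ζ 5) {P Q : Submodule k M} (hP : ∀ x ∈ P, Φ x ∈ P) {x : M} (hx : x ∈ P)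
    (hxQ : x ∉ Q) : ∃ j < 5, ∃ y ∈ P, y ∉ Q ∧ Φ y = ζ ^ j • y := by
  by_contra hcon
  push Not at hcon
  have hω : ∀ j, (ζ ^ j) ^ 5 = 1 := fun j => by rw [← pow_mul, mul_comm, pow_mul, hζ.pow_eq_one,
    one_pow]
  have h1 : ∀ j ∈ Finset.range 5, eigProj Φ (ζ ^ j) x ∈ Q := by
    intro j hj
    by_contra hQ
    refine hcon j (Finset.mem_range.mp hj) _ (eigProj_mem hP _ hx) hQ ?_
    exact LinearMap.congr_fun (mul_eigProj hΦ (hω j)) x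
  have h2 := congrArg (fun T => T x) (sum_eigProj (Φ := Φ) hζ)
  simp only [LinearMap.sum_apply, LinearMap.smul_apply, Module.End.one_apply] at h2
  have h3 : (5 : k) • x ∈ Q := by rw [← h2]; exact Q.sum_mem h1
  exact hxQ ((Q.smul_mem_iff (by norm_num)).mp h3)

end Eigen

section Coalg

variable {k H : Type*} [Field k] [AddCommGroup H] [Module k H] [Coalgebra k H]

open Coalgebra

variable (k H) in
/-- The left hit action of functionals, `h ↦ f(h₁) h₂`. -/
noncomputable def ell (f : Module.Dual k H) : Module.End k H := lslice f ∘ₗ comul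

/-- The right hit action of functionals, `h ↦ h₁ f(h₂)`. -/
noncomputable def rho (f : Module.Dual k H) : Module.End k H := rslice f ∘ₗ comul

lemma ell_apply (f : Module.Dual k H) (h : H) : ell k H f h = lslice f (comul h) := rfl

lemma rho_apply (f : Module.Dual k H) (h : H) : rho f h = rslice f (comul h) := rfl

lemma rslice_counit_comul (h : H) : rslice (counit : Module.Dual k H) (comul h) = h := by
  simp [rslice]

lemma lslice_counit_comul (h : H) : lslice (counit : Module.Dual k H) (comul h) = h := by
  simp [lslice]

@[simp] lemma counit_ell (f : Module.Dual k H) (h : H) : counit (R := k) (ell k H f h) = f h := by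
  rw [ell_apply, apply_lslice, rslice_counit_comul]

@[simp] lemma counit_rho (f : Module.Dual k H) (h : H) : counit (R := k) (rho f h) = f h := by
  rw [rho_apply, ← apply_lslice, lslice_counit_comul]

lemma ell_rho (f g : Module.Dual k H) (h : H) : ell k H f (rho g h) = rho g (ell k H f h) := by
  have h1 : ∀ t : H ⊗[k] H, lslice f (comul (R := k) (rslice g t)) =
      rslice g (lslice f (TensorProduct.assoc k H H H (comul.rTensor H t))) := by
    intro t
    induction t with
    | zero => simp
    | add a b ha hb => simp only [map_add, ha, hb]
    | tmul a b =>
      simp only [rslice_tmul, map_smul, LinearMap.rTensor_tmul]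
      generalize comul (R := k) a = s
      induction s with
      | zero => simp
      | add a b ha hb => simp only [map_add, ha, hb, smul_add, TensorProduct.add_tmul]
      | tmul c d => simp [smul_smul, mul_comm]
  have h2 : ∀ t : H ⊗[k] H, lslice f (comul.lTensor H t) = comul (R := k) (lslice f t) := by
    intro t
    induction t with
    | zero => simp
    | add a b ha hb => simp only [map_add, ha, hb]
    | tmul a b => simp
  rw [ell_apply, rho_apply, h1, Coalgebra.coassoc_apply, h2, rho_apply, ell_apply]

variable (k H) in
/-- The operators commuting with all left hit actions. -/
noncomputable def RI : Subalgebra k (Module.End k H) :=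
  Subalgebra.centralizer k (Set.range (ell k H))

lemma mem_RI {D : Module.End k H} :
    D ∈ RI k H ↔ ∀ f h, ell k H f (D h) = D (ell k H f h) := by
  simp only [RI, Subalgebra.mem_centralizer_iff, Set.forall_mem_range]
  exact ⟨fun h f x => LinearMap.congr_fun (h f) x, fun h f => LinearMap.ext (h f)⟩

lemma rho_mem_RI (g : Module.Dual k H) : rho g ∈ RI k H := mem_RI.mpr fun f h => ell_rho f g h

lemma apply_eq_counit {D : Module.End k H} (hD : D ∈ RI k H) (f : Module.Dual k H) (h : H) :
    f (D h) = counit (R := k) (D (ell k H f h)) := by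
  rw [← mem_RI.mp hD, counit_ell]

lemma RI_ext {D D' : Module.End k H} (hD : D ∈ RI k H) (hD' : D' ∈ RI k H)
    (h : ∀ x, counit (R := k) (D x) = counit (R := k) (D' x)) : D = D' := by
  ext x
  refine eq_of_dual (k := k) fun f => ?_
  rw [apply_eq_counit hD, apply_eq_counit hD', h]

lemma comul_RI {D : Module.End k H} (hD : D ∈ RI k H) (h : H) :
    comul (R := k) (D h) = D.lTensor H (comul h) := by
  refine eq_of_lslice fun f => ?_
  rw [← ell_apply, mem_RI.mp hD, ell_apply]
  generalize comul (R := k) h = t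
  induction t with
  | zero => simp
  | add a b ha hb => simp only [map_add, ha, hb]
  | tmul a b => simp

/-- A left coideal, as a subspace stable under all left hit actions. -/
def IsLC (V : Submodule k H) : Prop := ∀ f, ∀ v ∈ V, ell k H f v ∈ V

lemma IsLC.map {V : Submodule k H} (hV : IsLC V) {D : Module.End k H} (hD : D ∈ RI k H) :
    IsLC (V.map D) := by
  rintro f _ ⟨v, hv, rfl⟩
  exact ⟨ell k H f v, hV f v hv, (mem_RI.mp hD f v).symm⟩

lemma IsLC.comap {V : Submodule k H} (hV : IsLC V) {D : Module.End k H} (hD : D ∈ RI k H) :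
    IsLC (V.comap D) := by
  intro f v hv
  rw [Submodule.mem_comap, ← mem_RI.mp hD]
  exact hV f _ hv

lemma isLC_bot : IsLC (⊥ : Submodule k H) := by
  intro f v hv
  simp [(Submodule.mem_bot k).mp hv]

lemma isLC_top : IsLC (⊤ : Submodule k H) := fun _ _ _ => Submodule.mem_top

lemma isLC_ker {D : Module.End k H} (hD : D ∈ RI k H) : IsLC (LinearMap.ker D) :=
  isLC_bot.comap hD

lemma IsLC.inf {V W : Submodule k H} (hV : IsLC V) (hW : IsLC W) : IsLC (V ⊓ W) :=
  fun f v hv => ⟨hV f v hv.1, hW f v hv.2⟩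

lemma IsLC.sup {V W : Submodule k H} (hV : IsLC V) (hW : IsLC W) : IsLC (V ⊔ W) := by
  intro f v hv
  obtain ⟨a, ha, b, hb, rfl⟩ := Submodule.mem_sup.mp hv
  rw [map_add]
  exact Submodule.add_mem_sup (hV f a ha) (hW f b hb)

lemma IsLC.exists_counit_ne_zero {V : Submodule k H} (hV : IsLC V) (h0 : V ≠ ⊥) :
    ∃ v ∈ V, counit (R := k) v ≠ 0 := by
  obtain ⟨v, hv, hv0⟩ := V.ne_bot_iff.mp h0
  obtain ⟨f, hf⟩ : ∃ f : Module.Dual k H, f v ≠ 0 := by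
    by_contra hcon
    push Not at hcon
    exact hv0 (eq_zero_of_dual hcon)
  exact ⟨ell k H f v, hV f v hv, by rwa [counit_ell]⟩

lemma ell_grouplike {χ : H} (hχ : IsGroupLikeElem k χ) (f : Module.Dual k H) :
    ell k H f χ = f χ • χ := by
  rw [ell_apply, hχ.comul_eq_tmul_self, lslice_tmul]

lemma isLC_span_grouplike {χ : H} (hχ : IsGroupLikeElem k χ) :
    IsLC (Submodule.span k {χ}) := by
  intro f v hv
  obtain ⟨c, rfl⟩ := Submodule.mem_span_singleton.mp hv
  rw [map_smul, ell_grouplike hχ, smul_smul]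
  exact Submodule.smul_mem _ _ (Submodule.mem_span_singleton_self χ)

/-- A matrix `E` with `Δ(E i j) = ∑ l, E i l ⊗ E l j` and `ε(E i j) = δ i j`. -/
structure IsComatrix {ι : Type*} [Fintype ι] [DecidableEq ι] (E : Matrix ι ι H) : Prop where
  comul_eq : ∀ i j, comul (R := k) (E i j) = ∑ l, E i l ⊗ₜ[k] E l j
  counit_eq : ∀ i j, counit (R := k) (E i j) = if i = j then 1 else 0

lemma exists_comatrix {n : ℕ} {v : Fin n → H} (hv : LinearIndependent k v)
    (hV : IsLC (Submodule.span k (Set.range v))) :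
    ∃ E : Matrix (Fin n) (Fin n) H, IsComatrix (k := k) E ∧
      (∀ i, comul (R := k) (v i) = ∑ j, E i j ⊗ₜ[k] v j) ∧
      ∀ i, v i = ∑ j, counit (R := k) (v j) • E i j := by
  choose c hc using fun j => exists_dual_of_linearIndependent hv (fun i => if i = j then (1 : k) else 0)
  have hexp : ∀ x ∈ Submodule.span k (Set.range v), x = ∑ j, c j x • v j := by
    intro x hx
    obtain ⟨t, rfl⟩ := (Submodule.mem_span_range_iff_exists_fun k).mp hx
    simp [map_sum, hc]
  have hE : ∀ i f, ell k H f (v i) = ∑ j, f (rho (c j) (v i)) • v j := by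
    intro i f
    rw [hexp _ (hV f _ (Submodule.subset_span ⟨i, rfl⟩))]
    refine Finset.sum_congr rfl fun j _ => ?_
    rw [ell_apply, apply_lslice, rho_apply]
  have hcomul : ∀ i, comul (R := k) (v i) = ∑ j, rho (c j) (v i) ⊗ₜ[k] v j := by
    intro i
    refine eq_of_lslice fun f => ?_
    rw [← ell_apply, hE, map_sum]
    simp
  refine ⟨fun i j => rho (c j) (v i), ⟨fun i j => ?_, fun i j => ?_⟩, hcomul, fun i => ?_⟩
  · rw [comul_RI (rho_mem_RI _), hcomul]
    simp [map_sum]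
  · rw [counit_rho, hc]
  · have := rslice_counit_comul (k := k) (v i)
    rw [hcomul] at this
    simpa [map_sum] using this.symm

lemma exists_comatrix_of_finrank [FiniteDimensional k H] {V : Submodule k H} (hV : IsLC V) :
    ∃ v : Fin (Module.finrank k V) → H, LinearIndependent k v ∧ Submodule.span k (Set.range v) = V ∧
    ∃ E : Matrix (Fin (Module.finrank k V)) (Fin (Module.finrank k V)) H, IsComatrix (k := k) E ∧
      (∀ i, comul (R := k) (v i) = ∑ j, E i j ⊗ₜ[k] v j) ∧
      ∀ i, v i = ∑ j, counit (R := k) (v j) • E i j := by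
  let b := Module.finBasis k V
  have hli : LinearIndependent k (fun i => (b i : H)) :=
    b.linearIndependent.map' V.subtype (Submodule.ker_subtype V)
  have hspan : Submodule.span k (Set.range fun i => (b i : H)) = V := by
    have := congrArg (Submodule.map V.subtype) b.span_eq
    rw [Submodule.map_span, ← Set.range_comp, Submodule.map_top, Submodule.range_subtype] at this
    exact this
  refine ⟨fun i => b i, hli, hspan, exists_comatrix hli (by rwa [hspan])⟩

lemma IsLC.exists_grouplike_of_finrank_one [FiniteDimensional k H] {V : Submodule k H}
    (hV : IsLC V) (h1 : Module.finrank k V = 1) :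
    ∃ χ : H, IsGroupLikeElem k χ ∧ V = Submodule.span k {χ} := by
  obtain ⟨v, hv0, hv⟩ := finrank_eq_one_iff'.mp h1
  have hspan : Submodule.span k (Set.range fun _ : Fin 1 => (v : H)) = V := by
    apply le_antisymm
    · rw [Submodule.span_le]; rintro _ ⟨_, rfl⟩; exact v.2
    · intro x hx
      obtain ⟨c, hc⟩ := hv ⟨x, hx⟩
      have : x = c • (v : H) := by rw [← Submodule.coe_smul, hc]
      rw [this]
      exact Submodule.smul_mem _ _ (Submodule.subset_span ⟨0, rfl⟩)
  have hv0' : (v : H) ≠ 0 := fun h => hv0 (Subtype.ext h)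
  have hli : LinearIndependent k (fun _ : Fin 1 => (v : H)) :=
    LinearIndependent.of_subsingleton (v := fun _ : Fin 1 => (v : H)) 0 hv0'
  obtain ⟨E, hE, -, hvE⟩ := exists_comatrix hli (by rwa [hspan])
  have hvE' : (v : H) = counit (R := k) (v : H) • E 0 0 := by simpa using hvE 0
  have hc : counit (R := k) (v : H) ≠ 0 := by
    intro h; rw [h, zero_smul] at hvE'; exact hv0' hvE'
  refine ⟨E 0 0, ⟨by simpa using hE.counit_eq 0 0, by simpa using hE.comul_eq 0 0⟩, ?_⟩
  rw [← hspan, Set.range_const, hvE', Submodule.span_singleton_smul_eq hc.isUnit]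

/-- A minimal nonzero left coideal. -/
structure IsSimpleLC (V : Submodule k H) : Prop where
  isLC : IsLC V
  ne_bot : V ≠ ⊥
  eq_of_le : ∀ W : Submodule k H, IsLC W → W ≤ V → W ≠ ⊥ → W = V

lemma IsLC.exists_simple [FiniteDimensional k H] {V : Submodule k H} (hV : IsLC V) (h0 : V ≠ ⊥) :
    ∃ W ≤ V, IsSimpleLC W := by
  obtain ⟨W, ⟨hWV, hW, hW0⟩, hmin⟩ := WellFounded.has_min
    (wellFounded_lt (α := Submodule k H)) {W | W ≤ V ∧ IsLC W ∧ W ≠ ⊥} ⟨V, le_rfl, hV, h0⟩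
  refine ⟨W, hWV, hW, hW0, fun U hU hUW hU0 => ?_⟩
  by_contra hne
  exact hmin U ⟨hUW.trans hWV, hU, hU0⟩ (lt_of_le_of_ne hUW hne)

lemma IsSimpleLC.grouplike_notMem {V : Submodule k H} (hV : IsSimpleLC V)
    (h2 : 2 ≤ Module.finrank k V) {χ : H} (hχ : IsGroupLikeElem k χ) : χ ∉ V := by
  intro hmem
  have h := hV.eq_of_le _ (isLC_span_grouplike hχ)
    ((Submodule.span_singleton_le_iff_mem _ _).mpr hmem) (by simpa using hχ.ne_zero)
  rw [← h, finrank_span_singleton hχ.ne_zero] at h2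
  omega

lemma IsSimpleLC.map {V : Submodule k H} (hV : IsSimpleLC V) {D : Module.End k H}
    (hD : D ∈ RI k H) (hne : V.map D ≠ ⊥) :
    IsSimpleLC (V.map D) ∧ Module.finrank k (V.map D) = Module.finrank k V := by
  have hker : V ⊓ LinearMap.ker D = ⊥ := by
    by_contra h
    have := hV.eq_of_le _ (hV.isLC.inf (isLC_ker hD)) inf_le_left h
    apply hne
    rw [eq_bot_iff, Submodule.map_le_iff_le_comap]
    exact inf_eq_left.mp this
  refine ⟨⟨hV.isLC.map hD, hne, fun W hW hWV hW0 => ?_⟩, ?_⟩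
  · have h1 := hV.eq_of_le (V ⊓ W.comap D) (hV.isLC.inf (hW.comap hD)) inf_le_left ?_
    · refine le_antisymm hWV ?_
      rw [Submodule.map_le_iff_le_comap]
      exact inf_eq_left.mp h1
    · obtain ⟨w, hw, hw0⟩ := W.ne_bot_iff.mp hW0
      obtain ⟨v, hv, rfl⟩ := hWV hw
      rw [Submodule.ne_bot_iff]
      exact ⟨v, ⟨hv, hw⟩, fun h => hw0 (by rw [h, map_zero])⟩
  · refine LinearEquiv.finrank_eq (LinearEquiv.symm (LinearEquiv.ofInjective (D.domRestrict V) ?_ ≪≫ₗ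
      LinearEquiv.ofEq _ _ ?_))
    · rw [← LinearMap.ker_eq_bot, LinearMap.ker_eq_bot']
      rintro ⟨v, hv⟩ h
      have : v ∈ V ⊓ LinearMap.ker D := ⟨hv, h⟩
      rw [hker] at this
      exact Subtype.ext this
    · rw [LinearMap.range_domRestrict]

end Coalg

section Eigen

variable {k : Type*} [Field k] {M : Type*} [AddCommGroup M] [Module k M]

lemma eigProj_apply_eigenvector {Φ : Module.End k M} {ζ : k} (hζ : IsPrimitiveRoot ζ 5) {m j : ℕ}
    {x : M} (hx : Φ x = ζ ^ j • x) :
    eigProj Φ (ζ ^ m) x = if m % 5 = j % 5 then (5 : k) • x else 0 := by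
  have h1 : ∀ i, (Φ ^ i) x = (ζ ^ j) ^ i • x := by
    intro i
    induction i with
    | zero => simp
    | succ i ih => rw [pow_succ', Module.End.mul_apply, ih, map_smul, hx, smul_smul, pow_succ]
  have h2 : eigProj Φ (ζ ^ m) x = (∑ i ∈ Finset.range 5, (ζ ^ (4 * m + j)) ^ i) • x := by
    simp only [eigProj, LinearMap.sum_apply, LinearMap.smul_apply, h1, smul_smul, Finset.sum_smul]
    refine Finset.sum_congr rfl fun i _ => ?_
    congr 1
    rw [← mul_pow, ← pow_mul, ← pow_add, mul_comm m 4]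
  rw [h2]
  split_ifs with h
  · have : ζ ^ (4 * m + j) = 1 := (hζ.pow_eq_one_iff_dvd _).mpr (by omega)
    simp [this]
  · have hcop : Nat.Coprime (4 * m + j) 5 :=
      ((Nat.Prime.coprime_iff_not_dvd (by norm_num)).mpr (by omega)).symm
    rw [(hζ.pow_of_coprime _ hcop).geom_sum_eq_zero (by norm_num), zero_smul]

end Eigen

section SkewPrimitive

open Coalgebra

variable {k H : Type*} [Field k] [Ring H] [HopfAlgebra k H]

lemma pow_mul_qcomm {x β : H} {ζ : k} (h : β * x = ζ • (x * β)) (j : ℕ) :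
    β * x ^ j = ζ ^ j • (x ^ j * β) := by
  induction j with
  | zero => simp
  | succ j ih =>
    rw [pow_succ, ← mul_assoc, ih, smul_mul_assoc, mul_assoc, h, mul_smul_comm, smul_smul,
      ← pow_succ, mul_assoc]

lemma comul_pow_skewPrimitive {x β : H} {ζ : k} (hx : comul (R := k) x = x ⊗ₜ[k] 1 + β ⊗ₜ[k] x)
    (h : β * x = ζ • (x * β)) (m : ℕ) :
    comul (R := k) (x ^ m) =
      ∑ i ∈ Finset.range (m + 1), (qbin ζ m i • (x ^ i * β ^ (m - i))) ⊗ₜ[k] (x ^ (m - i)) := by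
  rw [Bialgebra.comul_pow, hx, add_pow_of_qcomm (ζ := ζ)]
  · refine Finset.sum_congr rfl fun i _ => ?_
    simp only [Algebra.TensorProduct.tmul_pow, Algebra.TensorProduct.tmul_mul_tmul, smul_tmul',
      one_pow, one_mul]
  · simp [Algebra.TensorProduct.tmul_mul_tmul, h, smul_tmul']

lemma eq_smul_of_dependent_pow {x β : H} {ζ : k} (hβ : IsUnit β)
    (hx : comul (R := k) x = x ⊗ₜ[k] 1 + β ⊗ₜ[k] x) (h : β * x = ζ • (x * β)) {n : ℕ}
    (hq : ∀ m, m ≠ 0 → m < n → qbin ζ m 1 ≠ 0)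
    (hn : ¬ LinearIndependent k fun i : Fin n => x ^ (i : ℕ)) : ∃ c : k, x = c • (1 - β) := by
  have h1 : (1 : H) ≠ 0 := fun h1 => hn (by
    have : n = 0 ∨ n ≠ 0 := by tauto
    rcases this with rfl | h0
    · exact linearIndependent_empty_type
    · exfalso
      have hc := congrArg (counit (R := k)) h1
      simp at hc)
  obtain ⟨m, hm0, hmn, t, ht⟩ := exists_smul_eq_of_dependent comul (fun m => x ^ m)
    (fun i j => x ^ i * β ^ j) ζ (comul_pow_skewPrimitive hx h) (by simpa using h1) hn
  refine ⟨(qbin ζ m 1)⁻¹ * t, ?_⟩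
  obtain ⟨m, rfl⟩ := Nat.exists_eq_succ_of_ne_zero hm0
  apply (hβ.pow m).mul_right_cancel
  rw [mul_smul, smul_mul_assoc, eq_inv_smul_iff₀ (hq _ hm0 hmn)]
  simpa [sub_mul, pow_succ'] using ht

lemma linearIndependent_pow_of_qcomm {x β : H} {ζ : k} (hζ : IsPrimitiveRoot ζ 5) (hβ : IsUnit β)
    (hx : comul (R := k) x = x ⊗ₜ[k] 1 + β ⊗ₜ[k] x) (h : β * x = ζ • (x * β)) (hx0 : x ≠ 0) :
    LinearIndependent k fun i : Fin 5 => x ^ (i : ℕ) := by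
  by_contra hn
  obtain ⟨c, hc⟩ := eq_smul_of_dependent_pow hβ hx h
    (fun m hm hm5 => qbin_one_right_ne_zero hζ hm hm5) hn
  have hcomm : β * x = x * β := by rw [hc]; simp [mul_sub, sub_mul]
  have h2 : (1 - ζ) • (x * β) = 0 := by rw [sub_smul, one_smul, ← h, hcomm, sub_self]
  rcases smul_eq_zero.mp h2 with h3 | h3
  · exact hζ.ne_one (by norm_num) (sub_eq_zero.mp h3).symm
  · exact hx0 (hβ.mul_left_eq_zero.mp h3)

variable [FiniteDimensional k H]

lemma not_linearIndependent_pow (x : H) :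
    ¬ LinearIndependent k fun i : Fin (Module.finrank k H + 1) => x ^ (i : ℕ) := by
  intro h
  have := h.fintype_card_le_finrank
  simp at this

lemma eq_smul_of_commute [CharZero k] {x β : H} (hβ : IsUnit β)
    (hx : comul (R := k) x = x ⊗ₜ[k] 1 + β ⊗ₜ[k] x) (h : β * x = x * β) :
    ∃ c : k, x = c • (1 - β) :=
  eq_smul_of_dependent_pow (ζ := (1 : k)) hβ hx (by simpa using h)
    (fun _ hm _ => qbin_one_right_ne_zero_of_one hm) (not_linearIndependent_pow x)

lemma exists_qcomm [CharZero k] {ζ₀ : k} (hζ₀ : IsPrimitiveRoot ζ₀ 5) {χ : H} (hχ5 : χ ^ 5 = 1)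
    {P : Submodule k H} (hPΔ : ∀ y ∈ P, comul (R := k) y = y ⊗ₜ[k] 1 + χ ⊗ₜ[k] y)
    (hP : ∀ y ∈ P, χ * y * χ ^ 4 ∈ P) {y₀ : H} (hy₀ : y₀ ∈ P)
    (hy₀' : y₀ ∉ Submodule.span k {1 - χ}) :
    ∃ y ∈ P, ∃ ζ : k, IsPrimitiveRoot ζ 5 ∧ χ * y = ζ • (y * χ) ∧
      y ∉ Submodule.span k {1 - χ} ∧ y ≠ 0 ∧ χ ≠ 1 := by
  let Φ : Module.End k H := LinearMap.mulLeft k χ * LinearMap.mulRight k (χ ^ 4)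
  have hΦa : ∀ y, Φ y = χ * y * χ ^ 4 := fun y => by simp [Φ, mul_assoc]
  have hχ4 : χ ^ 4 * χ = 1 := by rw [← pow_succ, hχ5]
  have hχu : IsUnit χ := IsUnit.of_pow_eq_one hχ5 (by norm_num)
  have hpow : ∀ i y, (Φ ^ i) y = χ ^ i * y * (χ ^ 4) ^ i := by
    intro i y
    induction i with
    | zero => simp
    | succ i ih =>
      rw [pow_succ', Module.End.mul_apply, ih, hΦa, pow_succ' χ i, pow_succ (χ ^ 4) i]
      simp only [mul_assoc]
  have hΦ5 : Φ ^ 5 = 1 := by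
    ext y
    rw [hpow, hχ5, ← pow_mul, mul_comm 4 5, pow_mul, hχ5]
    simp
  obtain ⟨j, hj, y, hyP, hyQ, hy⟩ := exists_eigenvector hΦ5 hζ₀ (fun y hy => by
    rw [hΦa]; exact hP y hy) hy₀ hy₀'
  have hcomm : χ * y = ζ₀ ^ j • (y * χ) := by
    have := congrArg (· * χ) hy
    simp only [hΦa] at this
    rwa [mul_assoc, hχ4, mul_one, smul_mul_assoc] at this
  have hy0 : y ≠ 0 := by rintro rfl; exact hyQ (zero_mem _)
  have hj0 : j ≠ 0 := by
    rintro rfl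
    obtain ⟨c, hc⟩ := eq_smul_of_commute hχu (hPΔ y hyP) (by simpa using hcomm)
    exact hyQ (Submodule.mem_span_singleton.mpr ⟨c, hc.symm⟩)
  have hζ : IsPrimitiveRoot (ζ₀ ^ j) 5 := by
    apply hζ₀.pow_of_coprime
    exact ((Nat.Prime.coprime_iff_not_dvd (by norm_num)).mpr (by omega)).symm
  refine ⟨y, hyP, ζ₀ ^ j, hζ, hcomm, hyQ, hy0, ?_⟩
  rintro rfl
  have h2 : (1 - ζ₀ ^ j) • y = 0 := by
    rw [sub_smul, one_smul]; nth_rewrite 1 [← one_mul y]; rw [hcomm, mul_one, sub_self]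
  rcases smul_eq_zero.mp h2 with h3 | h3
  · exact hζ.ne_one (by norm_num) (sub_eq_zero.mp h3).symm
  · exact hy0 h3

end SkewPrimitive

section Taft

open Coalgebra

variable {k H : Type*} [Field k] [Ring H] [HopfAlgebra k H]

/-- A `q`-commuting pair: a grouplike `β ≠ 1` of order five and a nonzero `(1, β)`-skew-primitive `x`
with `β x = ζ x β` for a primitive fifth root of unity `ζ`. -/
structure IsTaftPair (ζ : k) (x β : H) : Prop where
  prim : IsPrimitiveRoot ζ 5
  gl : IsGroupLikeElem k β
  pow_five : β ^ 5 = 1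
  ne_one : β ≠ 1
  comul_eq : comul (R := k) x = x ⊗ₜ[k] 1 + β ⊗ₜ[k] x
  comm : β * x = ζ • (x * β)
  ne_zero : x ≠ 0

namespace IsTaftPair

variable {ζ : k} {x β : H}

lemma isUnit (h : IsTaftPair ζ x β) : IsUnit β := IsUnit.of_pow_eq_one h.pow_five (by norm_num)

lemma comul_monomial (h : IsTaftPair ζ x β) (m e : ℕ) :
    comul (R := k) (x ^ m * β ^ e) =
      ∑ i ∈ Finset.range (m + 1), (qbin ζ m i • (x ^ i * β ^ (m - i + e))) ⊗ₜ[k]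
        (x ^ (m - i) * β ^ e) := by
  rw [Bialgebra.comul_mul, comul_pow_skewPrimitive h.comul_eq h.comm, (h.gl.pow).comul_eq_tmul_self,
    Finset.sum_mul]
  refine Finset.sum_congr rfl fun i _ => ?_
  rw [Algebra.TensorProduct.tmul_mul_tmul, smul_mul_assoc, mul_assoc, ← pow_add]

lemma linearIndependent_gl (h : IsTaftPair ζ x β) :
    LinearIndependent k fun i : Fin 5 => β ^ (i : ℕ) := by
  have ho : orderOf β = 5 := orderOf_eq_prime (hp := ⟨by norm_num⟩) h.pow_five h.ne_one
  refine (linearIndep_groupLikeVal (R := k) (A := H)).comp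
    (fun i : Fin 5 => ⟨β ^ (i : ℕ), h.gl.pow⟩) ?_
  intro i j hij
  have : β ^ (i : ℕ) = β ^ (j : ℕ) := congrArg GroupLike.val hij
  exact Fin.ext (pow_injOn_Iio_orderOf (by simp [ho]) (by simp [ho]) this)

lemma linearIndependent_pow (h : IsTaftPair ζ x β) :
    LinearIndependent k fun i : Fin 5 => x ^ (i : ℕ) :=
  linearIndependent_pow_of_qcomm h.prim h.isUnit h.comul_eq h.comm h.ne_zero

variable [CharZero k]

lemma pow_notMem (h : IsTaftPair ζ x β) {m : ℕ} (hm : m < 5) :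
    x ^ m ∉ Submodule.span k {y : H | ∃ j < m, ∃ e, y = x ^ j * β ^ e} := by
  intro hmem
  let Φ : Module.End k H := LinearMap.mulLeft k β * LinearMap.mulRight k (β ^ 4)
  have hβ4 : ∀ e, β * (β ^ e * β ^ 4) = β ^ e := fun e => by
    rw [← pow_add, ← pow_succ', add_assoc, pow_add, h.pow_five, mul_one]
  have hΦ : ∀ j e, Φ (x ^ j * β ^ e) = ζ ^ j • (x ^ j * β ^ e) := by
    intro j e
    simp only [Φ, Module.End.mul_apply, LinearMap.mulLeft_apply, LinearMap.mulRight_apply]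
    rw [mul_assoc, ← mul_assoc β, pow_mul_qcomm h.comm, smul_mul_assoc, mul_assoc, hβ4]
  have h1 : eigProj Φ (ζ ^ m) (x ^ m) = (5 : k) • x ^ m := by
    have := eigProj_apply_eigenvector (m := m) h.prim (hΦ m 0)
    simpa using this
  have h2 : Submodule.span k {y : H | ∃ j < m, ∃ e, y = x ^ j * β ^ e} ≤
      LinearMap.ker (eigProj Φ (ζ ^ m)) := by
    rw [Submodule.span_le]
    rintro _ ⟨j, hj, e, rfl⟩
    have := eigProj_apply_eigenvector (m := m) h.prim (hΦ j e)
    rw [if_neg (by omega)] at this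
    exact this
  have h3 := LinearMap.mem_ker.mp (h2 hmem)
  rw [h1, smul_eq_zero] at h3
  rcases h3 with h3 | h3
  · norm_num at h3
  · exact h.linearIndependent_pow.ne_zero ⟨m, hm⟩ h3

lemma monomial_independent (h : IsTaftPair ζ x β) (t : ℕ → ℕ → k) {m : ℕ} (hm : m ≤ 5)
    (ht : ∑ j ∈ Finset.range m, ∑ i ∈ Finset.range 5, t j i • (x ^ j * β ^ i) = 0) :
    ∀ j < m, ∀ i < 5, t j i = 0 := by
  induction m with
  | zero => simp
  | succ m ih =>
    set S := Submodule.span k {y : H | ∃ j < m, ∃ e, y = x ^ j * β ^ e} with hS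
    have hSmem : ∀ j < m, ∀ e, x ^ j * β ^ e ∈ S := fun j hj e => Submodule.subset_span ⟨j, hj, e, rfl⟩
    have key : ∀ i < 5, t m i = 0 := by
      intro i hi
      by_contra hti
      have hnot : x ^ m * β ^ i ∉ S := by
        intro hmem
        apply h.pow_notMem (m := m) (by omega)
        have h4 : S.map (LinearMap.mulRight k (β ^ (4 * i))) ≤ S := by
          rw [Submodule.map_le_iff_le_comap, hS, Submodule.span_le]
          rintro _ ⟨j, hj, e, rfl⟩
          refine Submodule.subset_span ⟨j, hj, e + 4 * i, ?_⟩
          rw [LinearMap.mulRight_apply, mul_assoc, pow_add]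
        have h5 := h4 ⟨_, hmem, rfl⟩
        rw [LinearMap.mulRight_apply, mul_assoc, ← pow_add, show i + 4 * i = 5 * i by ring, pow_mul,
          h.pow_five, one_pow, mul_one] at h5
        exact h5
      obtain ⟨f, hf, hf0⟩ := exists_dual_ne_zero_of_notMem hnot
      have hell : ∀ j ≤ m, ∀ e, ell k H f (x ^ j * β ^ e) =
          (if j = m then f (x ^ m * β ^ e) else 0) • β ^ e := by
        intro j hj e
        rw [ell_apply, h.comul_monomial, map_sum, Finset.sum_range_succ, Finset.sum_eq_zero]
        · rw [lslice_tmul, qbin_self]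
          split_ifs with hjm
          · simp [hjm]
          · simp [hf0 _ (hSmem j (by omega) e)]
        · intro l hl
          have : l < j := Finset.mem_range.mp hl
          rw [lslice_tmul, map_smul, hf0 _ (hSmem l (by omega) _), smul_zero, zero_smul]
      have h6 := congrArg (ell k H f) ht
      rw [map_zero, Finset.sum_range_succ, map_add, map_sum, Finset.sum_eq_zero, zero_add, map_sum] at h6
      · have h7 := Fintype.linearIndependent_iff.mp h.linearIndependent_gl
          (fun i => t m i * f (x ^ m * β ^ (i : ℕ))) (by
            rw [Fin.sum_univ_eq_sum_range (fun i => (t m i * f (x ^ m * β ^ i)) • β ^ i) 5, ← h6]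
            refine Finset.sum_congr rfl fun e _ => ?_
            rw [map_smul, hell m le_rfl, if_pos rfl, smul_smul]) ⟨i, hi⟩
        exact (mul_ne_zero hti hf) h7
      · intro j hj
        have hjm : j < m := Finset.mem_range.mp hj
        rw [map_sum]
        refine Finset.sum_eq_zero fun e _ => ?_
        rw [map_smul, hell j hjm.le, if_neg hjm.ne, zero_smul, smul_zero]
    intro j hj i hi
    rcases Nat.lt_succ_iff_lt_or_eq.mp hj with hjm | rfl
    · refine ih (by omega) ?_ j hjm i hi
      rw [Finset.sum_range_succ] at ht
      rwa [Finset.sum_eq_zero (s := Finset.range 5) (fun i hi => by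
        rw [key i (Finset.mem_range.mp hi), zero_smul]), add_zero] at ht
    · exact key i hi

lemma linearIndependent_monomial (h : IsTaftPair ζ x β) :
    LinearIndependent k fun p : Fin 5 × Fin 5 => x ^ (p.1 : ℕ) * β ^ (p.2 : ℕ) := by
  rw [Fintype.linearIndependent_iff]
  rintro g hg ⟨j, i⟩
  have := h.monomial_independent (fun a b => if hab : a < 5 ∧ b < 5 then g (⟨a, hab.1⟩, ⟨b, hab.2⟩)
    else 0) le_rfl (by
      rw [← hg, Fintype.sum_prod_type, ← Fin.sum_univ_eq_sum_range]
      refine Finset.sum_congr rfl fun a _ => ?_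
      rw [← Fin.sum_univ_eq_sum_range]
      refine Finset.sum_congr rfl fun b _ => ?_
      simp) j j.2 i i.2
  simpa using this

lemma exists_pow_mem (h : IsTaftPair ζ x β) {V : Submodule k H} (hV : IsLC V) (h0 : V ≠ ⊥)
    (hVS : V ≤ Submodule.span k (Set.range fun p : Fin 5 × Fin 5 => x ^ (p.1 : ℕ) * β ^ (p.2 : ℕ))) :
    ∃ i, β ^ i ∈ V := by
  classical
  obtain ⟨v, hvV, hv0⟩ := V.ne_bot_iff.mp h0
  obtain ⟨t, ht⟩ := (Submodule.mem_span_range_iff_exists_fun k).mp (hVS hvV)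
  have hne : (Finset.univ.filter fun p : Fin 5 × Fin 5 => t p ≠ 0).Nonempty := by
    by_contra hcon
    rw [Finset.not_nonempty_iff_eq_empty, Finset.filter_eq_empty_iff] at hcon
    apply hv0
    rw [← ht]
    exact Finset.sum_eq_zero fun p hp => by rw [not_not.mp (hcon hp), zero_smul]
  obtain ⟨p, hp, hmax⟩ := Finset.exists_max_image _ (fun p : Fin 5 × Fin 5 => (p.1 : ℕ)) hne
  obtain ⟨f, hf⟩ := exists_dual_of_linearIndependent h.linearIndependent_monomial
    fun q => if q = p then (1 : k) else 0
  have hf' : ∀ l < 5, ∀ e : ℕ, f (x ^ l * β ^ e) = if l = (p.1 : ℕ) ∧ e % 5 = (p.2 : ℕ) then 1 else 0 := by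
    intro l hl e
    rw [pow_eq_pow_mod e h.pow_five]
    have := hf (⟨l, hl⟩, ⟨e % 5, Nat.mod_lt _ (by norm_num)⟩)
    simpa [Prod.ext_iff, Fin.ext_iff] using this
  refine ⟨p.2, ?_⟩
  have hell : ell k H f v = t p • β ^ (p.2 : ℕ) := by
    rw [← ht, map_sum, Finset.sum_eq_single p]
    · rw [map_smul, ell_apply, h.comul_monomial, map_sum, Finset.sum_range_succ, Finset.sum_eq_zero]
      · rw [lslice_tmul, map_smul, qbin_self, hf' _ p.1.2, if_pos]
        · simp
        · simp [Nat.mod_eq_of_lt p.2.2]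
      · intro l hl
        have : l < p.1 := Finset.mem_range.mp hl
        rw [lslice_tmul, map_smul, hf' _ (by omega), if_neg (by omega), smul_zero, zero_smul]
    · intro q _ hq
      by_cases hq0 : t q = 0
      · rw [hq0, zero_smul, map_zero]
      · have hqp := hmax q (by simp [hq0])
        rw [map_smul, ell_apply, h.comul_monomial, map_sum, Finset.sum_eq_zero, smul_zero]
        intro l hl
        have hl' : l < (q.1 : ℕ) + 1 := Finset.mem_range.mp hl
        rw [lslice_tmul, map_smul, hf' _ (by omega), if_neg, smul_zero, zero_smul]
        rintro ⟨h1, h2⟩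
        apply hq
        have h3 : (q.1 : ℕ) = p.1 := le_antisymm hqp (by omega)
        have h4 : (q.2 : ℕ) = p.2 := by
          have := q.2.2
          omega
        exact Prod.ext (Fin.ext h3) (Fin.ext h4)
    · simp
  have hmem := hV f v hvV
  rw [hell] at hmem
  exact (V.smul_mem_iff (by simpa using hp)).mp hmem

end IsTaftPair
end Taft

section SkewDerivation

open Coalgebra

variable {k H : Type*} [Field k] [Ring H] [HopfAlgebra k H]

/-- The subspace of skew derivations `d (u v) = a u * d v + d u * v` commuting with the left hit
actions. -/
def skewDer (a : H →ₐ[k] H) : Submodule k (Module.End k H) where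
  carrier := {d | d ∈ RI k H ∧ ∀ u v, d (u * v) = a u * d v + d u * v}
  zero_mem' := ⟨zero_mem _, by simp⟩
  add_mem' := by
    rintro d e ⟨hd, hd'⟩ ⟨he, he'⟩
    refine ⟨add_mem hd he, fun u v => ?_⟩
    simp only [LinearMap.add_apply, hd', he', mul_add, add_mul]
    abel
  smul_mem' := by
    rintro c d ⟨hd, hd'⟩
    refine ⟨Subalgebra.smul_mem _ hd c, fun u v => ?_⟩
    simp only [LinearMap.smul_apply, hd', smul_add, mul_smul_comm, smul_mul_assoc]

lemma map_pow_end {M N : Type*} [AddCommGroup M] [Module k M] [AddCommGroup N] [Module k N]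
    (f : Module.End k M) (g : Module.End k N) (n : ℕ) :
    (TensorProduct.map f g : Module.End k (M ⊗[k] N)) ^ n = TensorProduct.map (f ^ n) (g ^ n) := by
  induction n with
  | zero => simp
  | succ n ih => rw [pow_succ, ih, pow_succ, pow_succ, TensorProduct.map_mul]

lemma pow_twisted {a d : Module.End k H} {ζ : k} (h : a * d = ζ • (d * a)) (m : ℕ) :
    (TensorProduct.map d 1 + TensorProduct.map a d : Module.End k (H ⊗[k] H)) ^ m =
      ∑ i ∈ Finset.range (m + 1),
        qbin ζ m i • TensorProduct.map (d ^ i * a ^ (m - i)) (d ^ (m - i)) := by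
  rw [add_pow_of_qcomm (ζ := ζ)]
  · refine Finset.sum_congr rfl fun i _ => ?_
    rw [map_pow_end, map_pow_end, ← TensorProduct.map_mul, one_pow, one_mul]
  · rw [← TensorProduct.map_mul, ← TensorProduct.map_mul, h, TensorProduct.map_smul_left, mul_one,
      one_mul]

lemma mul_comp_pow_twisted {a : H →ₐ[k] H} {d : Module.End k H}
    (hd : d ∈ skewDer a) (m : ℕ) :
    LinearMap.mul' k H ∘ₗ
      ((TensorProduct.map d 1 + TensorProduct.map a.toLinearMap d : Module.End k (H ⊗[k] H)) ^ m) =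
    (d ^ m : Module.End k H) ∘ₗ LinearMap.mul' k H := by
  have base : LinearMap.mul' k H ∘ₗ
      (TensorProduct.map d 1 + TensorProduct.map a.toLinearMap d : Module.End k (H ⊗[k] H)) =
      d ∘ₗ LinearMap.mul' k H := by
    ext u v
    simp [hd.2, add_comm]
  induction m with
  | zero => ext; simp
  | succ m ih =>
    refine LinearMap.ext fun t => ?_
    have h1 := LinearMap.congr_fun ih
      ((TensorProduct.map d 1 + TensorProduct.map a.toLinearMap d : Module.End k (H ⊗[k] H)) t)
    have h2 := LinearMap.congr_fun base t
    rw [LinearMap.comp_apply, LinearMap.comp_apply] at h1 h2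
    rw [LinearMap.comp_apply, LinearMap.comp_apply, pow_succ, pow_succ, Module.End.mul_apply,
      Module.End.mul_apply, h1, h2]

lemma skewDer_pow_mul {a : H →ₐ[k] H} {d : Module.End k H} {ζ : k} (hd : d ∈ skewDer a)
    (h : a.toLinearMap * d = ζ • (d * a.toLinearMap)) (m : ℕ) (u v : H) :
    (d ^ m) (u * v) = ∑ i ∈ Finset.range (m + 1),
      qbin ζ m i • ((d ^ i * a.toLinearMap ^ (m - i)) u * (d ^ (m - i)) v) := by
  have := LinearMap.congr_fun (mul_comp_pow_twisted hd m) (u ⊗ₜ v)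
  rw [LinearMap.comp_apply, LinearMap.comp_apply, LinearMap.mul'_apply, pow_twisted h] at this
  rw [← this, LinearMap.sum_apply, map_sum]
  simp

variable (k H) in
/-- The functional `ε ∘ D`. -/
noncomputable def evalOp : Module.End k H →ₗ[k] Module.Dual k H :=
  LinearMap.compRight k (counit (R := k) (A := H))

@[simp] lemma evalOp_apply (D : Module.End k H) (h : H) :
    evalOp k H D h = counit (R := k) (D h) := rfl

lemma evalOp_injOn {D D' : Module.End k H} (hD : D ∈ RI k H) (hD' : D' ∈ RI k H)
    (h : evalOp k H D = evalOp k H D') : D = D' :=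
  RI_ext hD hD' fun x => LinearMap.congr_fun h x

variable [FiniteDimensional k H]

lemma eq_smul_of_dependent_evalOp [Nontrivial H] {a : H →ₐ[k] H} {d : Module.End k H} {ζ : k}
    (ha : a.toLinearMap ∈ RI k H) (hau : IsUnit (a.toLinearMap : Module.End k H))
    (hd : d ∈ skewDer a) (h : a.toLinearMap * d = ζ • (d * a.toLinearMap)) {n : ℕ}
    (hq : ∀ m, m ≠ 0 → m < n → qbin ζ m 1 ≠ 0)
    (hn : ¬ LinearIndependent k fun i : Fin n => evalOp k H (d ^ (i : ℕ))) :
    ∃ c : k, d = c • (1 - a.toLinearMap) := by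
  have hε : evalOp k H ((d : Module.End k H) ^ 0) ≠ 0 := by
    intro h0
    have := LinearMap.congr_fun h0 (1 : H)
    simp at this
  have hΔ : ∀ m, ((TensorProduct.dualDistribEquiv k H H).symm.toLinearMap ∘ₗ
      (LinearMap.mul' k H).dualMap) (evalOp k H (d ^ m)) = ∑ i ∈ Finset.range (m + 1),
        (qbin ζ m i • evalOp k H (d ^ i * a.toLinearMap ^ (m - i))) ⊗ₜ[k]
          evalOp k H (d ^ (m - i)) := by
    intro m
    rw [LinearMap.comp_apply, LinearEquiv.coe_coe, LinearEquiv.symm_apply_eq, map_sum]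
    refine TensorProduct.ext' fun u v => ?_
    rw [LinearMap.dualMap_apply, LinearMap.mul'_apply, evalOp_apply, skewDer_pow_mul hd h, map_sum,
      LinearMap.sum_apply]
    refine Finset.sum_congr rfl fun i _ => ?_
    change _ = TensorProduct.dualDistrib k H H _ _
    rw [TensorProduct.dualDistrib_apply]
    simp [mul_assoc]
  obtain ⟨m, hm0, hmn, t, ht⟩ := exists_smul_eq_of_dependent _ (fun m => evalOp k H (d ^ m))
    (fun i j => evalOp k H (d ^ i * a.toLinearMap ^ j)) ζ hΔ hε hn
  refine ⟨(qbin ζ m 1)⁻¹ * t, ?_⟩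
  obtain ⟨m, rfl⟩ := Nat.exists_eq_succ_of_ne_zero hm0
  apply (hau.pow m).mul_right_cancel
  rw [mul_smul, smul_mul_assoc, eq_inv_smul_iff₀ (hq _ hm0 hmn)]
  rw [← map_smul, ← map_sub, ← map_smul] at ht
  have key := evalOp_injOn ?_ ?_ ht
  · simpa [sub_mul, pow_succ'] using key
  · exact Subalgebra.smul_mem _ (mul_mem (pow_mem hd.1 _) (pow_mem ha _)) _
  · exact Subalgebra.smul_mem _ (sub_mem (mul_mem (pow_mem hd.1 _) (pow_mem ha _))
      (mul_mem (pow_mem hd.1 _) (pow_mem ha _))) _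

lemma skewDer_eq_smul_of_commute [CharZero k] [Nontrivial H] {a : H →ₐ[k] H} {d : Module.End k H}
    (ha : a.toLinearMap ∈ RI k H) (hau : IsUnit (a.toLinearMap : Module.End k H))
    (hd : d ∈ skewDer a) (h : a.toLinearMap * d = d * a.toLinearMap) :
    ∃ c : k, d = c • (1 - a.toLinearMap) := by
  refine eq_smul_of_dependent_evalOp (ζ := (1 : k)) (n := Module.finrank k H + 1) ha hau hd
    (by simpa using h) (fun _ hm _ => qbin_one_right_ne_zero_of_one hm) ?_
  intro hli
  have := hli.fintype_card_le_finrank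
  simp [Subspace.dual_finrank_eq] at this

lemma skewDer_pow_four_ne_zero [Nontrivial H] {a : H →ₐ[k] H} {d : Module.End k H} {ζ : k}
    (hζ : IsPrimitiveRoot ζ 5)
    (ha : a.toLinearMap ∈ RI k H) (hau : IsUnit (a.toLinearMap : Module.End k H))
    (hd : d ∈ skewDer a) (h : a.toLinearMap * d = ζ • (d * a.toLinearMap)) (hd0 : d ≠ 0) :
    d ^ 4 ≠ 0 := by
  intro h4
  obtain ⟨c, hc⟩ := eq_smul_of_dependent_evalOp (n := 5) ha hau hd h
    (fun m hm hm5 => qbin_one_right_ne_zero hζ hm hm5) (fun hli => by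
      have := hli.ne_zero 4
      simp [h4] at this)
  have hcomm : a.toLinearMap * d = d * a.toLinearMap := by rw [hc]; simp [mul_sub, sub_mul]
  set b : Module.End k H := a.toLinearMap
  have h2 : (1 - ζ) • (d * b) = 0 := by
    rw [sub_smul 1 ζ (d * b), one_smul, ← h, hcomm, sub_self]
  rcases smul_eq_zero.mp h2 with h3 | h3
  · exact hζ.ne_one (by norm_num) (sub_eq_zero.mp h3).symm
  · exact hd0 (hau.mul_left_eq_zero.mp h3)

lemma skewDer_pow_five [CharZero k] [Nontrivial H] {a : H →ₐ[k] H} {d : Module.End k H} {ζ : k}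
    (hζ : IsPrimitiveRoot ζ 5) (ha5 : a.toLinearMap ^ 5 = 1)
    (hd : d ∈ skewDer a) (h : a.toLinearMap * d = ζ • (d * a.toLinearMap)) : d ^ 5 = 0 := by
  have hd5 : d ^ 5 ∈ skewDer (AlgHom.id k H) := by
    refine ⟨pow_mem hd.1 5, fun u v => ?_⟩
    rw [skewDer_pow_mul hd h]
    rw [Finset.sum_range_succ, Finset.sum_range_succ', Finset.sum_eq_zero]
    · simp [qbin_zero_right, qbin_self, ha5]
    · intro i hi
      have : i < 4 := Finset.mem_range.mp hi
      rw [qbin_five hζ (by omega) (by omega), zero_smul]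
  have hid : (AlgHom.id k H).toLinearMap = 1 := rfl
  obtain ⟨c, hc⟩ := skewDer_eq_smul_of_commute (a := AlgHom.id k H) (by rw [hid]; exact one_mem _)
    (by rw [hid]; exact isUnit_one) hd5 (by rw [hid, one_mul, mul_one])
  rw [hc, hid, sub_self, smul_zero]

lemma exists_skewDer_qcomm [CharZero k] [Nontrivial H] {ζ₀ : k} (hζ₀ : IsPrimitiveRoot ζ₀ 5)
    {a : H →ₐ[k] H} (ha : a.toLinearMap ∈ RI k H) (ha5 : a.toLinearMap ^ 5 = 1)
    {d₀ : Module.End k H} (hd₀ : d₀ ∈ skewDer a)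
    (hd₀' : d₀ ∉ Submodule.span k {1 - a.toLinearMap}) :
    ∃ d ∈ skewDer a, ∃ q : k, IsPrimitiveRoot q 5 ∧
      a.toLinearMap * d = q • (d * a.toLinearMap) ∧ d ^ 4 ≠ 0 ∧ d ^ 5 = 0 := by
  set b : Module.End k H := a.toLinearMap with hb
  let Φ : Module.End k (Module.End k H) := LinearMap.mulLeft k b * LinearMap.mulRight k (b ^ 4)
  have hΦa : ∀ y, Φ y = b * y * b ^ 4 := fun y => by simp [Φ, mul_assoc]
  have hb4 : b ^ 4 * b = 1 := by rw [← pow_succ, ha5]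
  have hbu : IsUnit b := IsUnit.of_pow_eq_one ha5 (by norm_num)
  have hpow : ∀ i y, (Φ ^ i) y = b ^ i * y * (b ^ 4) ^ i := by
    intro i y
    induction i with
    | zero => simp
    | succ i ih =>
      rw [pow_succ', Module.End.mul_apply, ih, hΦa, pow_succ' b i, pow_succ (b ^ 4) i]
      simp only [mul_assoc]
  have hΦ5 : Φ ^ 5 = 1 := by
    refine LinearMap.ext fun y => ?_
    rw [hpow, ha5, ← pow_mul, mul_comm 4 5, pow_mul, ha5]
    simp
  have hbpow : ∀ i u v, (b ^ i) (u * v) = (b ^ i) u * (b ^ i) v := by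
    intro i u v
    induction i with
    | zero => simp
    | succ i ih =>
      rw [pow_succ']
      simp only [Module.End.mul_apply, ih]
      simp [hb]
  have hstab : ∀ y ∈ skewDer a, Φ y ∈ skewDer a := by
    intro y hy
    rw [hΦa]
    refine ⟨mul_mem (mul_mem ha hy.1) (pow_mem ha 4), fun u v => ?_⟩
    have h5 : b (a ((b ^ 4) u)) = b u := by
      have : b ((b ^ 4) u) = u := by
        rw [← Module.End.mul_apply, ← pow_succ', ha5]; rfl
      exact congrArg b this
    have hbm : ∀ u v, b (u * v) = b u * b v := fun u v => by simp [hb]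
    simp only [Module.End.mul_apply, hbpow, hy.2, map_add, hbm, h5]
    congr 2
    rw [← Module.End.mul_apply b, ← pow_succ', ha5]
    rfl
  obtain ⟨j, hj, y, hyP, hyQ, hy⟩ := exists_eigenvector hΦ5 hζ₀ hstab hd₀ hd₀'
  have hcomm : b * y = ζ₀ ^ j • (y * b) := by
    have := congrArg (· * b) hy
    simp only [hΦa] at this
    rwa [mul_assoc, hb4, mul_one, smul_mul_assoc] at this
  have hy0 : y ≠ 0 := by rintro rfl; exact hyQ (zero_mem _)
  have hj0 : j ≠ 0 := by
    rintro rfl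
    obtain ⟨c, hc⟩ := skewDer_eq_smul_of_commute ha hbu hyP (by simpa using hcomm)
    exact hyQ (Submodule.mem_span_singleton.mpr ⟨c, hc.symm⟩)
  have hζ : IsPrimitiveRoot (ζ₀ ^ j) 5 := by
    apply hζ₀.pow_of_coprime
    exact ((Nat.Prime.coprime_iff_not_dvd (by norm_num)).mpr (by omega)).symm
  exact ⟨y, hyP, ζ₀ ^ j, hζ, hcomm, skewDer_pow_four_ne_zero hζ ha hbu hyP hcomm hy0,
    skewDer_pow_five hζ ha5 hyP hcomm⟩

end SkewDerivation

section Setup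

open Coalgebra HopfClass

variable {k H : Type*} [Field k] [Ring H] [HopfAlgebra k H]

lemma isGroupLikeElem_of_wrt {g : H} (hg : IsGrouplikeWrt k (comulL k H) g) :
    IsGroupLikeElem k g := by
  refine ⟨?_, hg.2⟩
  have := lslice_counit_comul (k := k) g
  have h2 : comul (R := k) g = g ⊗ₜ g := hg.2
  rw [h2, lslice_tmul] at this
  have h3 : (counit (R := k) g - 1) • g = 0 := by rw [sub_smul, this, one_smul, sub_self]
  rcases smul_eq_zero.mp h3 with h | h
  · exact sub_eq_zero.mp h
  · exact absurd h hg.1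

lemma card_groupLike (hG : (grouplikes k H).ncard = 5) : Nat.card (GroupLike k H) = 5 := by
  rw [← hG, ← Nat.card_coe_set_eq]
  refine Nat.card_congr ⟨fun g => ⟨g.val, g.2.ne_zero, g.2.comul_eq_tmul_self⟩,
    fun g => ⟨g.1, isGroupLikeElem_of_wrt g.2⟩, fun g => rfl, fun g => rfl⟩

lemma groupLike_pow_five (hc : Nat.card (GroupLike k H) = 5) {χ : H} (hχ : IsGroupLikeElem k χ) :
    χ ^ 5 = 1 := by
  have h : (⟨χ, hχ⟩ : GroupLike k H) ^ 5 = 1 := by rw [← hc]; exact pow_card_eq_one'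
  have := congrArg GroupLike.val h
  simpa using this

lemma exists_isTaftPair [FiniteDimensional k H] [CharZero k] {ζ₀ : k} (hζ₀ : IsPrimitiveRoot ζ₀ 5)
    (hc : Nat.card (GroupLike k H) = 5) {g h y : H} (hg : IsGroupLikeElem k g)
    (hh : IsGroupLikeElem k h) (hy : comul (R := k) y = g ⊗ₜ[k] y + y ⊗ₜ[k] h)
    (hy' : ∀ c : k, y ≠ c • (g - h)) : ∃ (ζ : k) (x β : H), IsTaftPair ζ x β := by
  have hh5 := groupLike_pow_five hc hh
  have hhi : h * h ^ 4 = 1 := by rw [← pow_succ', hh5]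
  have hh4 : IsGroupLikeElem k (h ^ 4) := hh.pow
  have hβ : IsGroupLikeElem k (g * h ^ 4) := hg.mul hh4
  have hβ5 := groupLike_pow_five hc hβ
  set β := g * h ^ 4 with hβdef
  have hβu : IsUnit β := IsUnit.of_pow_eq_one hβ5 (by norm_num)
  have hβ4 : β * β ^ 4 = 1 := by rw [← pow_succ', hβ5]
  let P : Submodule k H :=
    { carrier := {y | comul (R := k) y = y ⊗ₜ[k] 1 + β ⊗ₜ[k] y}
      zero_mem' := by simp
      add_mem' := by
        intro a b ha hb
        simp only [Set.mem_ofPred_eq] at *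
        rw [map_add, ha, hb, TensorProduct.add_tmul, TensorProduct.tmul_add]; abel
      smul_mem' := by
        intro c a ha
        simp only [Set.mem_ofPred_eq] at *
        rw [map_smul, ha, smul_add, TensorProduct.smul_tmul', TensorProduct.tmul_smul] }
  have hPstab : ∀ y ∈ P, β * y * β ^ 4 ∈ P := by
    intro y hy
    change comul (R := k) _ = _
    have hy2 : comul (R := k) y = y ⊗ₜ[k] 1 + β ⊗ₜ[k] y := hy
    rw [Bialgebra.comul_mul, Bialgebra.comul_mul, hy2, hβ.comul_eq_tmul_self,
      (hβ.pow (n := 4)).comul_eq_tmul_self]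
    simp only [mul_add, add_mul, Algebra.TensorProduct.tmul_mul_tmul, mul_one, hβ4]
    rw [mul_assoc β β, hβ4, mul_one]
  have hy₀ : y * h ^ 4 ∈ P := by
    change comul (R := k) _ = _
    rw [Bialgebra.comul_mul, hy, hh4.comul_eq_tmul_self, add_mul,
      Algebra.TensorProduct.tmul_mul_tmul, Algebra.TensorProduct.tmul_mul_tmul, hhi, add_comm]
  obtain ⟨x, hxP, ζ, hζ, hcomm, -, hx0, hβ1⟩ := exists_qcomm hζ₀ hβ5 (P := P) (fun y hy => hy) hPstab
    hy₀ (by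
      intro hmem
      obtain ⟨c, hc⟩ := Submodule.mem_span_singleton.mp hmem
      apply hy' (-c)
      have h1 := congrArg (· * h) hc
      simp only [mul_assoc, ← pow_succ, hh5, smul_mul_assoc, sub_mul, hβdef, one_mul, mul_one] at h1
      rw [← h1, ← neg_sub g h, neg_smul, smul_neg])
  exact ⟨ζ, x, β, hζ, hβ, hβ5, hβ1, hxP, hcomm, hx0⟩

/-- The algebra endomorphism `h ↦ h₁ f(h₂)` attached to a character `f`. -/
noncomputable def rhoAlgHom (f : H →ₐ[k] k) : H →ₐ[k] H :=
  ((Algebra.TensorProduct.rid k k H).toAlgHom.comp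
    (Algebra.TensorProduct.map (AlgHom.id k H) f)).comp (Bialgebra.comulAlgHom k H)

lemma rhoAlgHom_toLinearMap (f : H →ₐ[k] k) :
    (rhoAlgHom f).toLinearMap = rho (k := k) f.toLinearMap := by
  ext h
  simp only [rhoAlgHom, rho_apply, AlgHom.toLinearMap_apply, AlgHom.comp_apply,
    Bialgebra.comulAlgHom_apply]
  generalize comul (R := k) h = t
  induction t with
  | zero => simp
  | tmul a b => simp
  | add a b ha hb => rw [map_add, map_add, map_add, ha, hb]

variable [FiniteDimensional k H]

lemma one_mem_of_isLC {U W : Submodule k H} (hU : IsLC U) (h0 : U ≠ ⊥)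
    (hW : ∀ h, ∀ u ∈ U, h * u ∈ W) : (1 : H) ∈ W := by
  obtain ⟨v, -, hspan, E, -, hvE, -⟩ := exists_comatrix_of_finrank hU
  obtain ⟨u, huU, hu⟩ := hU.exists_counit_ne_zero h0
  have hv : ∃ i, counit (R := k) (v i) ≠ 0 := by
    by_contra hcon
    push Not at hcon
    apply hu
    have : U ≤ LinearMap.ker (counit (R := k) (A := H)) := by
      rw [← hspan, Submodule.span_le]
      rintro _ ⟨i, rfl⟩
      exact hcon i
    exact this huU
  obtain ⟨i, hi⟩ := hv
  have h1 := HopfAlgebra.mul_antipode_rTensor_comul_apply (R := k) (v i)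
  rw [hvE, map_sum, map_sum] at h1
  have h2 : algebraMap k H (counit (R := k) (v i)) ∈ W := by
    rw [← h1]
    refine W.sum_mem fun j _ => ?_
    rw [LinearMap.rTensor_tmul, LinearMap.mul'_apply]
    exact hW _ _ (by rw [← hspan]; exact Submodule.subset_span ⟨j, rfl⟩)
  rw [Algebra.algebraMap_eq_smul_one] at h2
  exact (W.smul_mem_iff hi).mp h2

lemma algHom_RI_injective [Nontrivial H] {a : H →ₐ[k] H} (ha : a.toLinearMap ∈ RI k H) :
    Function.Injective a := by
  have hker : LinearMap.ker a.toLinearMap = ⊥ := by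
    by_contra h0
    have := one_mem_of_isLC (isLC_ker ha) h0 (W := LinearMap.ker a.toLinearMap) (by
      intro h u hu
      rw [LinearMap.mem_ker] at hu ⊢
      simp only [AlgHom.toLinearMap_apply] at hu ⊢
      rw [map_mul, hu, mul_zero])
    simp at this
  exact LinearMap.ker_eq_bot.mp hker

lemma algHom_RI_bijective [Nontrivial H] {a : H →ₐ[k] H} (ha : a.toLinearMap ∈ RI k H) :
    Function.Bijective a :=
  ⟨algHom_RI_injective ha,
    LinearMap.surjective_of_injective (f := a.toLinearMap) (algHom_RI_injective ha)⟩

variable (k H) in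
/-- The algebra automorphisms commuting with the left hit actions. -/
noncomputable def autRI : Subgroup (H ≃ₐ[k] H) where
  carrier := {e | e.toLinearMap ∈ RI k H}
  mul_mem' := by
    intro a b ha hb
    exact mul_mem (S := Subalgebra k (Module.End k H)) (s := RI k H) ha hb
  one_mem' := one_mem (RI k H)
  inv_mem' := by
    intro a ha
    rw [Set.mem_ofPred_eq, mem_RI] at *
    intro f h
    apply a.injective
    have := ha f (a⁻¹ h)
    simp only [AlgEquiv.toLinearMap_apply] at this ⊢
    rw [← this]
    have h2 : ∀ z, a (a⁻¹ z) = z := fun z => AlgEquiv.apply_symm_apply a z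
    rw [h2, h2]

lemma dualComul_eq_iff (f : Module.Dual k H) (t : Module.Dual k H ⊗[k] Module.Dual k H) :
    dualComul k H f = t ↔ ∀ u v, f (u * v) = TensorProduct.dualDistrib k H H t (u ⊗ₜ v) := by
  rw [dualComul, LinearMap.comp_apply, LinearEquiv.coe_coe, LinearEquiv.symm_apply_eq]
  constructor
  · intro h u v
    have := LinearMap.congr_fun h (u ⊗ₜ v)
    rw [LinearMap.dualMap_apply, LinearMap.mul'_apply] at this
    exact this
  · intro h
    refine TensorProduct.ext' fun u v => ?_
    rw [LinearMap.dualMap_apply, LinearMap.mul'_apply]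
    exact h u v

lemma dual_grouplike_mul {f : Module.Dual k H} (hf : IsGrouplikeWrt k (dualComul k H) f) (u v : H) :
    f (u * v) = f u * f v := by
  rw [(dualComul_eq_iff f _).mp hf.2, TensorProduct.dualDistrib_apply]

lemma dual_grouplike_one {f : Module.Dual k H} (hf : IsGrouplikeWrt k (dualComul k H) f) :
    f 1 = 1 := by
  obtain ⟨u, hu⟩ : ∃ u, f u ≠ 0 := by
    by_contra hcon
    push Not at hcon
    exact hf.1 (LinearMap.ext hcon)
  have := dual_grouplike_mul hf 1 u
  rw [one_mul] at this
  exact mul_right_cancel₀ hu (by rw [one_mul]; exact this.symm)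

/-- The character underlying a grouplike element of the dual. -/
noncomputable def dualAlgHom {f : Module.Dual k H} (hf : IsGrouplikeWrt k (dualComul k H) f) :
    H →ₐ[k] k :=
  AlgHom.ofLinearMap f (dual_grouplike_one hf) (dual_grouplike_mul hf)

/-- The automorphism attached to a grouplike element of the dual. -/
noncomputable def dualAut [Nontrivial H] {f : Module.Dual k H}
    (hf : IsGrouplikeWrt k (dualComul k H) f) : autRI k H :=
  ⟨AlgEquiv.ofBijective (rhoAlgHom (dualAlgHom hf)) (algHom_RI_bijective (by
    rw [rhoAlgHom_toLinearMap]; exact rho_mem_RI _)), by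
    change (rhoAlgHom (dualAlgHom hf)).toLinearMap ∈ RI k H
    rw [rhoAlgHom_toLinearMap]; exact rho_mem_RI _⟩

lemma dualAut_apply [Nontrivial H] {f : Module.Dual k H}
    (hf : IsGrouplikeWrt k (dualComul k H) f) (h : H) : (dualAut hf).1 h = rho f h :=
  LinearMap.congr_fun (rhoAlgHom_toLinearMap (dualAlgHom hf)) h

lemma card_autRI [Nontrivial H] (hG : (dualGrouplikes k H).ncard = 5) :
    Nat.card (autRI k H) = 5 := by
  rw [← hG, ← Nat.card_coe_set_eq]
  symm
  let Ψ : dualGrouplikes k H → autRI k H := fun f => dualAut (show IsGrouplikeWrt k _ f.1 from f.2)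
  have hΨ : ∀ f h, (Ψ f).1 h = rho f.1 h := fun f h => dualAut_apply _ h
  refine Nat.card_congr (Equiv.ofBijective Ψ ⟨fun f g h => ?_, fun e => ?_⟩)
  · apply Subtype.ext
    refine LinearMap.ext fun z => ?_
    rw [← counit_rho (k := k) f.1 z, ← counit_rho (k := k) g.1 z, ← hΨ, ← hΨ, h]
  · have hmul : ∀ u v : H, evalOp k H e.1.toLinearMap (u * v) =
        evalOp k H e.1.toLinearMap u * evalOp k H e.1.toLinearMap v := by
      intro u v; simp
    refine ⟨⟨evalOp k H e.1.toLinearMap, ?_, ?_⟩, ?_⟩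
    · intro h0
      have := LinearMap.congr_fun h0 (1 : H)
      simp at this
    · rw [dualComul_eq_iff]
      intro u v
      rw [TensorProduct.dualDistrib_apply, hmul]
    · apply Subtype.ext
      ext h
      rw [hΨ]
      refine LinearMap.congr_fun (RI_ext (rho_mem_RI _) e.2 fun z => ?_) h
      rw [counit_rho, evalOp_apply]

lemma exists_skewDer [CharZero k] [Nontrivial H] {ζ₀ : k} (hζ₀ : IsPrimitiveRoot ζ₀ 5)
    (hG : (dualGrouplikes k H).ncard = 5) {f g y : Module.Dual k H}
    (hf : IsGrouplikeWrt k (dualComul k H) f) (hg : IsGrouplikeWrt k (dualComul k H) g)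
    (hy : IsSkewPrimitiveWrt k (dualComul k H) f g y) (hy' : ∀ c : k, y ≠ c • (f - g)) :
    ∃ a : H →ₐ[k] H, a.toLinearMap ∈ RI k H ∧ a.toLinearMap ^ 5 = 1 ∧ ∃ d ∈ skewDer a,
      ∃ q : k, IsPrimitiveRoot q 5 ∧ a.toLinearMap * d = q • (d * a.toLinearMap) ∧
        d ^ 4 ≠ 0 ∧ d ^ 5 = 0 := by
  have hcard := card_autRI hG
  set F := dualAut hf
  set G := dualAut hg
  have hFa : ∀ h, F.1 h = rho f h := dualAut_apply hf
  have hGa : ∀ h, G.1 h = rho g h := dualAut_apply hg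
  have hGi : ∀ h, G.1 ((G⁻¹).1 h) = h := fun h => AlgEquiv.apply_symm_apply G.1 h
  have hGi' : ∀ h, (G⁻¹).1 (G.1 h) = h := fun h => AlgEquiv.symm_apply_apply G.1 h
  have hymul : ∀ u v, y (u * v) = f u * y v + y u * g v := by
    intro u v
    rw [(dualComul_eq_iff y _).mp hy, map_add, LinearMap.add_apply,
      TensorProduct.dualDistrib_apply, TensorProduct.dualDistrib_apply]
  have hY : ∀ u v, rho y (u * v) = F.1 u * rho y v + rho y u * G.1 v := by
    intro u v
    rw [hFa, hGa]
    simp only [rho_apply]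
    rw [Bialgebra.comul_mul]
    generalize comul (R := k) u = s
    generalize comul (R := k) v = t
    induction s with
    | zero => simp
    | add a b ha hb => rw [add_mul, map_add, ha, hb]; simp only [map_add, add_mul]; abel
    | tmul a b =>
      induction t with
      | zero => simp
      | add c d hc hd => rw [mul_add, map_add, hc, hd]; simp only [map_add, mul_add]; abel
      | tmul c d =>
        simp only [Algebra.TensorProduct.tmul_mul_tmul, rslice_tmul, hymul, add_smul,
          smul_mul_smul_comm]
  let a : H →ₐ[k] H := ((F * G⁻¹).1 : H ≃ₐ[k] H).toAlgHom
  have ha : a.toLinearMap ∈ RI k H := (F * G⁻¹).2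
  have haa : ∀ h, a h = F.1 ((G⁻¹).1 h) := fun h => rfl
  have ha5 : a.toLinearMap ^ 5 = 1 := by
    have h5 : (F * G⁻¹) ^ 5 = 1 := by rw [← hcard]; exact pow_card_eq_one'
    have key : ∀ n h, (a.toLinearMap ^ n) h = ((F * G⁻¹) ^ n).1 h := by
      intro n
      induction n with
      | zero => intro h; simp
      | succ n ih => intro h; rw [pow_succ, pow_succ, Module.End.mul_apply, ih]; rfl
    ext h
    rw [key, h5]; rfl
  refine ⟨a, ha, ha5, exists_skewDer_qcomm hζ₀ ha ha5
    (d₀ := rho y * ((G⁻¹).1 : H ≃ₐ[k] H).toLinearMap) ⟨mul_mem (rho_mem_RI y) (G⁻¹).2, ?_⟩ ?_⟩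
  · intro u v
    simp only [Module.End.mul_apply, AlgEquiv.toLinearMap_apply, map_mul, hY, hGi, haa]
  · intro hmem
    obtain ⟨c, hc⟩ := Submodule.mem_span_singleton.mp hmem
    apply hy' (-c)
    refine LinearMap.ext fun h => ?_
    have h1 := congrArg (counit (R := k)) (LinearMap.congr_fun hc (G.1 h))
    simp only [Module.End.mul_apply, AlgEquiv.toLinearMap_apply, LinearMap.smul_apply,
      LinearMap.sub_apply, Module.End.one_apply, AlgHom.toLinearMap_apply, haa, hGi'] at h1
    rw [counit_rho, map_smul, map_sub, hFa, hGa, counit_rho, counit_rho] at h1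
    rw [← h1]
    simp only [LinearMap.smul_apply, LinearMap.sub_apply, smul_eq_mul]
    ring

lemma exists_simpleLC_of_not_isPointed (hnp : ¬ IsPointed k H) :
    ∃ V : Submodule k H, IsSimpleLC V ∧ 2 ≤ Module.finrank k V := by
  rw [IsPointed, IsPointedWrt] at hnp
  push Not at hnp
  obtain ⟨C, ⟨hC, hC0, hCmin⟩, hC1⟩ := hnp
  have hLC : IsLC C := by
    intro f v hv
    obtain ⟨t, ht⟩ := hC v hv
    have ht' : comul (R := k) v = TensorProduct.map C.subtype C.subtype t := ht.symm
    rw [ell_apply, ht']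
    clear ht ht'
    induction t with
    | zero => simp
    | tmul a b => simpa using C.smul_mem _ b.2
    | add a b ha hb => rw [map_add, map_add]; exact C.add_mem ha hb
  obtain ⟨V, hVC, hV⟩ := hLC.exists_simple hC0
  refine ⟨V, hV, ?_⟩
  have hpos : 0 < Module.finrank k V := by
    rw [Module.finrank_pos_iff]
    exact (Submodule.nontrivial_iff_ne_bot).mpr hV.ne_bot
  by_contra hlt
  obtain ⟨χ, hχ, hVχ⟩ := hV.isLC.exists_grouplike_of_finrank_one (by omega)
  have hsub : IsSubcoalgWrt k (comulL k H) V := by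
    rw [hVχ]
    intro z hz
    obtain ⟨c, rfl⟩ := Submodule.mem_span_singleton.mp hz
    have h1 : χ ∈ Submodule.span k {χ} := Submodule.mem_span_singleton_self χ
    refine ⟨c • ((⟨χ, h1⟩ : Submodule.span k {χ}) ⊗ₜ[k] (⟨χ, h1⟩ : Submodule.span k {χ})), ?_⟩
    rw [map_smul, TensorProduct.map_tmul, map_smul]
    change _ = c • comul (R := k) χ
    rw [hχ.comul_eq_tmul_self]
    rfl
  rcases hVC.lt_or_eq with h | h
  · exact hV.ne_bot (hCmin V hsub h)
  · apply hC1
    rw [← h]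
    omega

end Setup

section Freeness

open Coalgebra HopfAlgebra

variable {k H : Type*} [Field k] [Ring H] [HopfAlgebra k H]

lemma IsComatrix.sum_mul_antipode {n : ℕ} {E : Matrix (Fin n) (Fin n) H}
    (hE : IsComatrix (k := k) E) (i j : Fin n) :
    ∑ l, E i l * antipode k (E l j) = if i = j then 1 else 0 := by
  have := mul_antipode_lTensor_comul_apply (R := k) (E i j)
  rw [hE.comul_eq, hE.counit_eq, map_sum, map_sum] at this
  simp only [LinearMap.lTensor_tmul, LinearMap.mul'_apply] at this
  rw [this]
  split_ifs <;> simp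

lemma IsComatrix.sum_antipode_mul {n : ℕ} {E : Matrix (Fin n) (Fin n) H}
    (hE : IsComatrix (k := k) E) (i j : Fin n) :
    ∑ l, antipode k (E i l) * E l j = if i = j then 1 else 0 := by
  have := mul_antipode_rTensor_comul_apply (R := k) (E i j)
  rw [hE.comul_eq, hE.counit_eq, map_sum, map_sum] at this
  simp only [LinearMap.rTensor_tmul, LinearMap.mul'_apply] at this
  rw [this]
  split_ifs <;> simp

variable (k H) in
/-- The Galois map `u ⊗ v ↦ u₁ ⊗ u₂ v`. -/
noncomputable def galMap : H ⊗[k] H →ₗ[k] H ⊗[k] H :=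
  (LinearMap.mul' k H).lTensor H ∘ₗ (TensorProduct.assoc k H H H).toLinearMap ∘ₗ
    (comul (R := k) (A := H)).rTensor H

lemma galMap_tmul (u v : H) :
    galMap k H (u ⊗ₜ v) = (LinearMap.mulRight k v).lTensor H (comul (R := k) u) := by
  simp only [galMap, LinearMap.comp_apply, LinearMap.rTensor_tmul, LinearEquiv.coe_coe]
  generalize comul (R := k) u = t
  induction t with
  | zero => simp
  | tmul a b => simp
  | add a b ha hb => rw [TensorProduct.add_tmul, map_add, map_add, ha, hb, map_add]

lemma galMap_comp {a : H →ₐ[k] H} {d : Module.End k H} (ha : a.toLinearMap ∈ RI k H)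
    (hd : d ∈ skewDer a) :
    galMap k H ∘ₗ (TensorProduct.map d 1 + TensorProduct.map a.toLinearMap d) =
      d.lTensor H ∘ₗ galMap k H := by
  refine TensorProduct.ext' fun u v => ?_
  simp only [LinearMap.comp_apply, LinearMap.add_apply, TensorProduct.map_tmul, map_add,
    galMap_tmul, Module.End.one_apply]
  rw [comul_RI hd.1, comul_RI ha]
  generalize comul (R := k) u = t
  induction t with
  | zero => simp
  | tmul x y =>
    simp only [LinearMap.lTensor_tmul, LinearMap.mulRight_apply, ← TensorProduct.tmul_add,
      AlgHom.toLinearMap_apply]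
    rw [hd.2, add_comm]
  | add x y hx hy =>
    simp only [map_add] at *
    rw [← hx, ← hy]; abel

/-- A skew derivation of nilpotency order five which `q`-commutes with its automorphism. -/
structure IsDerPair (q : k) (a : H →ₐ[k] H) (d : Module.End k H) : Prop where
  prim : IsPrimitiveRoot q 5
  mem : a.toLinearMap ∈ RI k H
  pow_five : a.toLinearMap ^ 5 = 1
  skew : d ∈ skewDer a
  comm : a.toLinearMap * d = q • (d * a.toLinearMap)
  pow_four_ne : d ^ 4 ≠ 0
  nil : d ^ 5 = 0

namespace IsDerPair

variable {q : k} {a : H →ₐ[k] H} {d : Module.End k H}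

lemma twisted_injective (h : IsDerPair q a d) {F₀ : Submodule k H}
    (hF : F₀ ⊓ LinearMap.ker (d ^ 4) = ⊥) :
    Function.Injective (((TensorProduct.map d 1 + TensorProduct.map a.toLinearMap d :
      Module.End k (H ⊗[k] H)) ^ 4) ∘ₗ F₀.subtype.rTensor H) := by
  refine (injective_iff_map_eq_zero _).mpr fun t ht => ?_
  rw [LinearMap.comp_apply] at ht
  have hinj : Function.Injective (((d ^ 4 : Module.End k H) ∘ₗ F₀.subtype).rTensor H) := by
    apply Module.Flat.rTensor_preserves_injective_linearMap
    rw [← LinearMap.ker_eq_bot, Submodule.eq_bot_iff]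
    intro x hx
    have : (x : H) ∈ F₀ ⊓ LinearMap.ker (d ^ 4) := ⟨x.2, hx⟩
    rw [hF] at this
    exact Subtype.ext this
  have key : ∀ m, (d ^ (m + 1)).lTensor F₀ t = 0 → (d ^ m).lTensor F₀ t = 0 := by
    intro m hm
    apply hinj
    rw [map_zero]
    have h2 := congrArg ((d ^ m).lTensor H) ht
    rw [map_zero, pow_twisted h.comm, LinearMap.sum_apply, map_sum, Finset.sum_range_succ,
      Finset.sum_eq_zero] at h2
    · rw [← h2, zero_add, qbin_self, one_smul]
      clear h2 hm ht
      induction t with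
      | zero => simp
      | tmul x y => simp
      | add x y hx hy => simp only [map_add, hx, hy]
    · intro i hi
      rw [Finset.mem_range] at hi
      rw [LinearMap.smul_apply, map_smul]
      have : ∀ t, (d ^ m).lTensor H ((TensorProduct.map (d ^ i * a.toLinearMap ^ (4 - i)) (d ^ (4 - i)))
          (F₀.subtype.rTensor H t)) = (TensorProduct.map ((d ^ i * a.toLinearMap ^ (4 - i)) ∘ₗ F₀.subtype)
            (d ^ (3 - i))) ((d ^ (m + 1)).lTensor F₀ t) := by
        intro t
        induction t with
        | zero => simp
        | tmul x y =>
          simp only [LinearMap.rTensor_tmul, LinearMap.lTensor_tmul, TensorProduct.map_tmul,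
            LinearMap.comp_apply, ← Module.End.mul_apply, ← pow_add]
          rw [show m + (4 - i) = 3 - i + (m + 1) by omega]
        | add x y hx hy => simp only [map_add, hx, hy]
      rw [this, hm, map_zero, smul_zero]
  have h0 : (d ^ 5).lTensor F₀ t = 0 := by rw [h.nil]; simp
  have := key 0 (key 1 (key 2 (key 3 (key 4 h0))))
  rwa [pow_zero, Module.End.one_eq_id, LinearMap.lTensor_id] at this

end IsDerPair

variable [FiniteDimensional k H]

lemma galMap_injective : Function.Injective (galMap k H) := by
  rw [LinearMap.injective_iff_surjective, ← LinearMap.range_eq_top, eq_top_iff]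
  obtain ⟨v, -, hspan, E, hE, -, hvE⟩ := exists_comatrix_of_finrank (isLC_top (k := k) (H := H))
  rw [← TensorProduct.span_tmul_eq_top, Submodule.span_le]
  rintro _ ⟨u, w, rfl⟩
  have hkey : ∀ i j, E i j ⊗ₜ[k] w ∈ LinearMap.range (galMap k H) := by
    intro i j
    refine ⟨∑ l, E i l ⊗ₜ (antipode k (E l j) * w), ?_⟩
    rw [map_sum]
    simp only [galMap_tmul, hE.comul_eq, map_sum, LinearMap.lTensor_tmul, LinearMap.mulRight_apply]
    rw [Finset.sum_comm]
    simp only [← TensorProduct.tmul_sum, ← mul_assoc, ← Finset.sum_mul, hE.sum_mul_antipode]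
    rw [Finset.sum_eq_single j]
    · simp
    · intro l _ hl; simp [hl]
    · simp
  have hu : u ∈ Submodule.span k (Set.range v) := by rw [hspan]; trivial
  change u ⊗ₜ[k] w ∈ LinearMap.range (galMap k H)
  induction hu using Submodule.span_induction with
  | mem z hz =>
    obtain ⟨i, rfl⟩ := hz
    rw [hvE, TensorProduct.sum_tmul]
    refine Submodule.sum_mem _ fun j _ => ?_
    rw [← TensorProduct.smul_tmul']
    exact Submodule.smul_mem _ _ (hkey i j)
  | zero => simp
  | add x y _ _ hx hy => rw [TensorProduct.add_tmul]; exact add_mem hx hy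
  | smul c x _ hx => rw [← TensorProduct.smul_tmul']; exact Submodule.smul_mem _ _ hx

lemma finrank_range_twisted_le {a : H →ₐ[k] H} {d : Module.End k H} (ha : a.toLinearMap ∈ RI k H)
    (hd : d ∈ skewDer a) (m : ℕ) :
    Module.finrank k (LinearMap.range
      ((TensorProduct.map d 1 + TensorProduct.map a.toLinearMap d : Module.End k (H ⊗[k] H)) ^ m)) ≤
    Module.finrank k H * Module.finrank k (LinearMap.range (d ^ m)) := by
  set D : Module.End k (H ⊗[k] H) := TensorProduct.map d 1 + TensorProduct.map a.toLinearMap d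
  have hD : ∀ m, galMap k H ∘ₗ (D ^ m : Module.End k _) = (d ^ m).lTensor H ∘ₗ galMap k H := by
    intro m
    induction m with
    | zero =>
      rw [pow_zero, pow_zero, Module.End.one_eq_id, Module.End.one_eq_id, LinearMap.lTensor_id]
      rfl
    | succ m ih =>
      have h1 : (D ^ (m + 1) : Module.End k _) = (D ^ m) ∘ₗ D := pow_succ D m
      have h2 : (d ^ (m + 1) : Module.End k _) = (d ^ m) ∘ₗ d := pow_succ d m
      rw [h1, ← LinearMap.comp_assoc, ih, LinearMap.comp_assoc, galMap_comp ha hd, h2,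
        LinearMap.lTensor_comp, LinearMap.comp_assoc]
  have h1 : (LinearMap.range (D ^ m)).map (galMap k H) ≤
      LinearMap.range ((LinearMap.range (d ^ m)).subtype.lTensor H) := by
    rw [← LinearMap.range_comp, hD]
    have : d ^ m = (LinearMap.range (d ^ m)).subtype ∘ₗ (d ^ m).rangeRestrict := rfl
    conv_lhs => rw [this]
    rw [LinearMap.lTensor_comp, LinearMap.comp_assoc]
    exact LinearMap.range_comp_le_range _ _
  calc _ = Module.finrank k ((LinearMap.range (D ^ m)).map (galMap k H)) :=
        (Submodule.equivMapOfInjective _ galMap_injective _).finrank_eq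
    _ ≤ _ := Submodule.finrank_mono h1
    _ ≤ Module.finrank k (H ⊗[k] LinearMap.range (d ^ m)) := LinearMap.finrank_range_le _
    _ = _ := Module.finrank_tensorProduct

lemma finrank_map_add_finrank_inf_ker {M N : Type*} [AddCommGroup M] [Module k M] [AddCommGroup N]
    [Module k N] [FiniteDimensional k M] (f : M →ₗ[k] N) (V : Submodule k M) :
    Module.finrank k (V.map f) + Module.finrank k (V ⊓ LinearMap.ker f : Submodule k M) =
      Module.finrank k V := by
  rw [← (f.domRestrict V).finrank_range_add_finrank_ker]
  congr 1
  · rw [LinearMap.range_domRestrict]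
  · rw [(Submodule.equivMapOfInjective V.subtype V.subtype_injective
      (LinearMap.ker (f.domRestrict V))).finrank_eq]
    have : V ⊓ LinearMap.ker f = (LinearMap.ker (f.domRestrict V)).map V.subtype := by
      ext x
      simp [LinearMap.mem_ker, and_comm]
    rw [this]

lemma finrank_iSup_le {M ι : Type*} [AddCommGroup M] [Module k M] [FiniteDimensional k M] [Fintype ι]
    (S : ι → Submodule k M) :
    Module.finrank k (⨆ i, S i : Submodule k M) ≤ ∑ i, Module.finrank k (S i) := by
  classical
  rw [← Finset.sup_univ_eq_iSup]
  induction (Finset.univ : Finset ι) using Finset.induction_on with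
  | empty => simp
  | insert i s his ih =>
    rw [Finset.sup_insert, Finset.sum_insert his]
    exact (Submodule.finrank_add_le_finrank_add_finrank _ _).trans (Nat.add_le_add_left ih _)

lemma eq_zero_of_sum_smul_pow {M : Type*} [AddCommGroup M] [Module k M] {d : Module.End k M} (h4 : d ^ 4 ≠ 0)
    (h5 : d ^ 5 = 0) (s : ℕ → k) (hs : ∑ i ∈ Finset.range 5, s i • d ^ i = 0) (i : ℕ) (hi : i < 5) :
    s i = 0 := by
  induction i using Nat.strong_induction_on with
  | _ i ih =>
    have h1 := congrArg (· * d ^ (4 - i)) hs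
    simp only [Finset.sum_mul, zero_mul] at h1
    rw [Finset.sum_eq_single i] at h1
    · rw [smul_mul_assoc, ← pow_add, show i + (4 - i) = 4 by omega] at h1
      exact (smul_eq_zero.mp h1).resolve_right h4
    · intro j hj hji
      rcases lt_or_gt_of_ne hji with h | h
      · rw [ih j h (by omega), zero_smul, zero_mul]
      · rw [smul_mul_assoc, ← pow_add, show j + (4 - i) = 5 + (j - i - 1) by omega, pow_add, h5,
          zero_mul, smul_zero]
    · intro h; simp at h; omega

namespace IsDerPair

variable {q : k} {a : H →ₐ[k] H} {d : Module.End k H}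

lemma finrank_le (h : IsDerPair q a d) :
    Module.finrank k H ≤ 5 * Module.finrank k (LinearMap.range (d ^ 4)) := by
  obtain ⟨F₀, hF₀⟩ := Submodule.exists_isCompl (LinearMap.ker (d ^ 4))
  set ρ := Module.finrank k (LinearMap.range (d ^ 4))
  have hfr : Module.finrank k F₀ = ρ := by
    have h1 := Submodule.finrank_add_eq_of_isCompl hF₀
    have h2 := (d ^ 4).finrank_range_add_finrank_ker
    omega
  set D : Module.End k (H ⊗[k] H) := TensorProduct.map d 1 + TensorProduct.map a.toLinearMap d with hD
  have hinj := h.twisted_injective (F₀ := F₀) hF₀.symm.inf_eq_bot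
  have hrange : LinearMap.range ((D ^ 4) ∘ₗ F₀.subtype.rTensor H) = LinearMap.range (D ^ 4) := by
    apply Submodule.eq_of_le_of_finrank_le (LinearMap.range_comp_le_range _ _)
    rw [LinearMap.finrank_range_of_inj hinj, Module.finrank_tensorProduct, hfr, mul_comm]
    exact finrank_range_twisted_le h.mem h.skew 4
  let F : Submodule k H := ⨆ i : Fin 5, F₀.map (d ^ (i : ℕ) * a.toLinearMap ^ (4 - (i : ℕ)))
  have hslice : ∀ (f : Module.Dual k H) t, rslice f ((D ^ 4) (F₀.subtype.rTensor H t)) ∈ F := by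
    intro f t
    induction t with
    | zero => simp
    | add x y hx hy => simp only [map_add]; exact F.add_mem hx hy
    | tmul x y =>
      rw [hD, pow_twisted h.comm, LinearMap.sum_apply, map_sum]
      refine F.sum_mem fun i hi => ?_
      rw [LinearMap.smul_apply, map_smul, LinearMap.rTensor_tmul, TensorProduct.map_tmul,
        rslice_tmul]
      refine F.smul_mem _ (F.smul_mem _ ?_)
      exact Submodule.mem_iSup_of_mem (⟨i, by simpa using hi⟩ : Fin 5)
        (Submodule.mem_map_of_mem x.2)
  have hFtop : F = ⊤ := by
    rw [eq_top_iff]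
    intro e _
    have he : e = (a.toLinearMap ^ 4) (a e) := by
      have := LinearMap.congr_fun h.pow_five e
      rw [pow_succ] at this
      exact this.symm
    rw [he]
    set e' := a e
    by_contra hmem
    obtain ⟨ψ, hψ, hψF⟩ := exists_dual_ne_zero_of_notMem hmem
    apply hψ
    have hsum : ∑ i ∈ Finset.range 5, (qbin q 4 (4 - i) *
        ψ ((d ^ (4 - i) * a.toLinearMap ^ i) e')) • d ^ i = 0 := by
      ext y
      have hz : lslice ψ ((D ^ 4) (e' ⊗ₜ y)) = 0 := by
        apply eq_zero_of_dual (k := k)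
        intro g
        rw [apply_lslice]
        apply hψF
        have : (D ^ 4) (e' ⊗ₜ y) ∈ LinearMap.range ((D ^ 4) ∘ₗ F₀.subtype.rTensor H) := by
          rw [hrange]; exact ⟨_, rfl⟩
        obtain ⟨t, ht⟩ := this
        rw [← ht]
        exact hslice g t
      rw [LinearMap.zero_apply, ← hz, hD, pow_twisted h.comm, LinearMap.sum_apply,
        LinearMap.sum_apply, map_sum, ← Finset.sum_range_reflect]
      refine Finset.sum_congr rfl fun i hi => ?_
      rw [Finset.mem_range] at hi
      simp only [LinearMap.smul_apply, map_smul, TensorProduct.map_tmul, lslice_tmul, smul_smul]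
      rw [show 5 - 1 - i = 4 - i by omega, show 4 - (4 - i) = i by omega]
    have h4 := h.pow_four_ne
    have h5 := h.nil
    let s : ℕ → k := fun i => qbin q 4 (4 - i) * ψ ((d ^ (4 - i) * a.toLinearMap ^ i) e')
    have : s 4 = 0 := eq_zero_of_sum_smul_pow h4 h5 s hsum 4 (by norm_num)
    change qbin q 4 (4 - 4) * ψ ((d ^ (4 - 4) * a.toLinearMap ^ 4) e') = 0 at this
    rw [Nat.sub_self, qbin_zero_right, one_mul, pow_zero, one_mul] at this
    exact this
  have hF : Module.finrank k F ≤ 5 * ρ := by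
    calc _ ≤ ∑ i : Fin 5, Module.finrank k (F₀.map (d ^ (i : ℕ) * a.toLinearMap ^ (4 - (i : ℕ)))) :=
          finrank_iSup_le _
      _ ≤ ∑ i : Fin 5, ρ := Finset.sum_le_sum fun i _ => (Submodule.finrank_map_le _ _).trans hfr.le
      _ = _ := by simp
  rwa [hFtop, finrank_top] at hF

lemma finrank_ker_le (h : IsDerPair q a d) :
    Module.finrank k (LinearMap.ker d) ≤
      Module.finrank k H - 4 * Module.finrank k (LinearMap.range (d ^ 4)) := by
  have step : ∀ i < 4, Module.finrank k (LinearMap.range (d ^ (i + 1))) +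
      Module.finrank k (LinearMap.range (d ^ 4)) ≤ Module.finrank k (LinearMap.range (d ^ i)) := by
    intro i hi
    rw [← finrank_map_add_finrank_inf_ker d (LinearMap.range (d ^ i))]
    apply add_le_add
    · rw [pow_succ', Module.End.mul_eq_comp, LinearMap.range_comp]
    · refine Submodule.finrank_mono (le_inf ?_ ?_)
      · rw [show 4 = i + (4 - i) by omega, pow_add]
        exact LinearMap.range_comp_le_range _ _
      · rintro _ ⟨x, rfl⟩
        rw [LinearMap.mem_ker, ← Module.End.mul_apply, ← pow_succ', h.nil]; rfl
  have h0 := step 1 (by norm_num)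
  have h1 := step 2 (by norm_num)
  have h2 := step 3 (by norm_num)
  have h3 := d.finrank_range_add_finrank_ker
  have h4 : LinearMap.range (d ^ 1) = LinearMap.range d := by rw [pow_one]
  rw [h4] at h0
  simp only [Nat.reduceAdd] at h0 h1 h2
  omega

end IsDerPair

end Freeness

section Linked

open Coalgebra HopfAlgebra

variable {k H : Type*} [Field k] [Ring H] [HopfAlgebra k H]

lemma RI_grouplike {D : Module.End k H} (hD : D ∈ RI k H) {χ : H} (hχ : IsGroupLikeElem k χ) :
    D χ = counit (R := k) (D χ) • χ := by
  apply eq_of_dual (k := k)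
  intro f
  rw [apply_eq_counit hD, ell_grouplike hχ, map_smul, map_smul, map_smul, smul_eq_mul, smul_eq_mul,
    mul_comm]

lemma RI_skewPrimitive {D : Module.End k H} (hD : D ∈ RI k H) {x β : H}
    (hx : comul (R := k) x = x ⊗ₜ[k] 1 + β ⊗ₜ[k] x) :
    D x = counit (R := k) (D 1) • x + counit (R := k) (D x) • β := by
  apply eq_of_dual (k := k)
  intro f
  rw [apply_eq_counit hD, ell_apply, hx]
  simp only [map_add, lslice_tmul, map_smul, smul_eq_mul]
  ring

lemma isLC_map_mulRight {V : Submodule k H} (hV : IsLC V) {χ : H} (hχ : IsGroupLikeElem k χ) :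
    IsLC (V.map (LinearMap.mulRight k χ)) := by
  rintro f _ ⟨v, hv, rfl⟩
  refine ⟨ell k H (f ∘ₗ LinearMap.mulRight k χ) v, hV _ v hv, ?_⟩
  simp only [LinearMap.mulRight_apply, ell_apply]
  rw [Bialgebra.comul_mul, hχ.comul_eq_tmul_self]
  generalize comul (R := k) v = t
  induction t with
  | zero => simp
  | tmul a b => simp
  | add a b ha hb => simp only [map_add, add_mul, ha, hb]

lemma IsSimpleLC.mulRight {V : Submodule k H} (hV : IsSimpleLC V) {χ : H}
    (hχ : IsGroupLikeElem k χ) :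
    IsSimpleLC (V.map (LinearMap.mulRight k χ)) ∧
      Module.finrank k (V.map (LinearMap.mulRight k χ)) = Module.finrank k V := by
  have hinv : χ * antipode k χ = 1 := hχ.mul_antipode_cancel
  have hinv' : antipode k χ * χ = 1 := hχ.antipode_mul_cancel
  have hinj : Function.Injective (LinearMap.mulRight k χ) := by
    intro u v huv
    have := congrArg (· * antipode k χ) huv
    simpa [mul_assoc, hinv] using this
  refine ⟨⟨isLC_map_mulRight hV.isLC hχ, ?_, ?_⟩, (Submodule.equivMapOfInjective _ hinj _).symm.finrank_eq⟩
  · intro h0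
    obtain ⟨v, hv, hv0⟩ := Submodule.exists_mem_ne_zero_of_ne_bot hV.ne_bot
    have : LinearMap.mulRight k χ v ∈ (⊥ : Submodule k H) := h0 ▸ Submodule.mem_map_of_mem hv
    exact hv0 (hinj (by rw [map_zero]; exact this))
  · intro W hW hWV hW0
    have hcomp : ∀ U : Submodule k H, (U.map (LinearMap.mulRight k (antipode k χ))).map
        (LinearMap.mulRight k χ) = U := by
      intro U
      rw [← Submodule.map_comp]
      have : LinearMap.mulRight k χ ∘ₗ LinearMap.mulRight k (antipode k χ) = LinearMap.id := by
        ext z; simp [mul_assoc, hinv']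
      rw [this, Submodule.map_id]
    have h1 : W.map (LinearMap.mulRight k (antipode k χ)) = V := by
      refine hV.eq_of_le _ (isLC_map_mulRight hW hχ.antipode) ?_ ?_
      · rintro _ ⟨w, hw, rfl⟩
        obtain ⟨v, hv, rfl⟩ := hWV hw
        simpa [mul_assoc, hinv] using hv
      · intro h0
        apply hW0
        rw [← hcomp W, h0, Submodule.map_bot]
    rw [← h1, hcomp]

/-- A non-commuting pair of a skew-primitive and a skew derivation, normalised so that the
derivation maps `x` to `β`, on a Hopf algebra of dimension `125` whose grouplikes are the powers of
`β`. -/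
structure IsLinked (ζ : k) (x β : H) (a : H →ₐ[k] H) (d : Module.End k H) : Prop where
  taft : IsTaftPair ζ x β
  der : IsDerPair ζ a d
  gl_eq : ∀ χ : H, IsGroupLikeElem k χ → ∃ i, χ = β ^ i
  dim : Module.finrank k H = 125
  a_β : a β = ζ • β
  a_x : a x = x
  d_β : d β = 0
  d_x : d x = β

namespace IsDerPair

variable {q : k} {a : H →ₐ[k] H} {d : Module.End k H}

lemma d_one (h : IsDerPair q a d) : d 1 = 0 := by
  have := h.skew.2 1 1
  rw [map_one, one_mul, mul_one, one_mul] at this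
  simpa using this

lemma d_grouplike (h : IsDerPair q a d) {χ : H} (hχ : IsGroupLikeElem k χ) : d χ = 0 := by
  have h1 := RI_grouplike h.skew.1 hχ
  set c := counit (R := k) (d χ)
  have h2 : ∀ n, (d ^ n) χ = c ^ n • χ := by
    intro n
    induction n with
    | zero => simp
    | succ n ih => rw [pow_succ', Module.End.mul_apply, ih, map_smul, h1, smul_smul, pow_succ]
  have h3 := h2 5
  rw [h.nil, LinearMap.zero_apply] at h3
  have h4 : c = 0 := by
    by_contra hc
    rcases smul_eq_zero.mp h3.symm with h | h
    · exact hc (pow_eq_zero_iff (by norm_num) |>.mp h)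
    · have := hχ.counit_eq_one; rw [h, map_zero] at this; exact zero_ne_one this
  rw [h1, h4, zero_smul]

lemma a_grouplike (h : IsDerPair q a d) {χ : H} (hχ : IsGroupLikeElem k χ) :
    a χ = counit (R := k) (a χ) • χ := RI_grouplike h.mem hχ

lemma mul_mem_ker (h : IsDerPair q a d) {u v : H} (hu : d u = 0) (hv : d v = 0) :
    d (u * v) = 0 := by
  rw [h.skew.2, hu, hv, mul_zero, zero_mul, add_zero]

lemma d_a (h : IsDerPair q a d) {u : H} (hu : d u = 0) : d (a u) = 0 := by
  have := LinearMap.congr_fun h.comm u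
  simp only [Module.End.mul_apply, hu, map_zero, LinearMap.smul_apply] at this
  exact (smul_eq_zero.mp this.symm).resolve_left (h.prim.ne_zero (by norm_num))

lemma counit_a_grouplike_ne_zero (h : IsDerPair q a d) {χ : H} (hχ : IsGroupLikeElem k χ) :
    counit (R := k) (a χ) ≠ 0 := by
  intro h0
  have h1 := h.a_grouplike hχ
  rw [h0, zero_smul] at h1
  have h2 := LinearMap.congr_fun h.pow_five χ
  rw [pow_succ, Module.End.mul_apply, AlgHom.toLinearMap_apply, h1, map_zero] at h2
  have := hχ.counit_eq_one
  rw [show χ = 0 from h2.symm, map_zero] at this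
  exact zero_ne_one this

lemma a_skewPrimitive (h : IsDerPair q a d) {ζ : k} {x β : H} (ht : IsTaftPair ζ x β) : a x = x := by
  have h1 := RI_skewPrimitive h.mem ht.comul_eq
  simp only [AlgHom.toLinearMap_apply, map_one, Bialgebra.counit_one, one_smul] at h1
  have h2 := congrArg (fun z => counit (R := k) (a z)) ht.comm
  simp only [map_mul, map_smul, Bialgebra.counit_mul, smul_eq_mul] at h2
  have h3 : (1 - ζ) * counit (R := k) (a β) * counit (R := k) (a x) = 0 := by
    linear_combination h2
  have h4 : (1 - ζ) ≠ 0 := sub_ne_zero.mpr (ht.prim.ne_one (by norm_num)).symm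
  have h5 : counit (R := k) (a x) = 0 := by
    rcases mul_eq_zero.mp h3 with h' | h'
    · exact absurd h' (mul_ne_zero h4 (h.counit_a_grouplike_ne_zero ht.gl))
    · exact h'
  rw [h1, h5, zero_smul, add_zero]

lemma d_skewPrimitive (h : IsDerPair q a d) {ζ : k} {x β : H} (ht : IsTaftPair ζ x β) :
    d x = counit (R := k) (d x) • β := by
  have h1 := RI_skewPrimitive h.skew.1 ht.comul_eq
  rwa [h.d_one, map_zero, zero_smul, zero_add] at h1

lemma isLinked (h : IsDerPair q a d) {ζ : k} {x β : H}
    (ht : IsTaftPair ζ x β) (hdim : Module.finrank k H = 125) (hx : d x ≠ 0)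
    (hgl : ∀ χ : H, IsGroupLikeElem k χ → ∃ i, χ = β ^ i) :
    ∃ x' : H, IsLinked ζ x' β a d := by
  have h1 := h.d_skewPrimitive ht
  set κ := counit (R := k) (d x)
  have hκ : κ ≠ 0 := fun h0 => hx (by rw [h1, h0, zero_smul])
  have hβ := h.a_grouplike ht.gl
  set γ := counit (R := k) (a β)
  have hββ : β * β ≠ 0 := by
    intro h0
    have := (ht.gl.mul ht.gl).counit_eq_one
    rw [h0, map_zero] at this
    exact zero_ne_one this
  have hβ0 : β ≠ 0 := fun h0 => hββ (by rw [h0, mul_zero])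
  have hγζ : γ = ζ := by
    have h2 := congrArg d ht.comm
    rw [map_smul, h.skew.2, h.skew.2, h.d_grouplike ht.gl, h1, hβ] at h2
    simp only [mul_zero, zero_mul, add_zero, zero_add, smul_mul_assoc, mul_smul_comm, smul_smul] at h2
    have h3 := smul_left_injective k hββ h2
    exact mul_right_cancel₀ hκ (by linear_combination h3)
  have hγq : γ = q := by
    have h2 := LinearMap.congr_fun h.comm x
    simp only [Module.End.mul_apply, AlgHom.toLinearMap_apply, LinearMap.smul_apply,
      h.a_skewPrimitive ht, h1, map_smul, hβ, smul_smul] at h2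
    have h3 := smul_left_injective k hβ0 h2
    exact mul_right_cancel₀ hκ (by linear_combination h3)
  rw [hγζ] at hβ hγq
  subst hγq
  refine ⟨κ⁻¹ • x, ⟨ht.prim, ht.gl, ht.pow_five, ht.ne_one, ?_, ?_, smul_ne_zero (inv_ne_zero hκ) ht.ne_zero⟩,
    h, hgl, hdim, hβ, ?_, h.d_grouplike ht.gl, ?_⟩
  · rw [map_smul, ht.comul_eq, smul_add, TensorProduct.smul_tmul', TensorProduct.tmul_smul]
  · rw [mul_smul_comm, ht.comm, smul_mul_assoc, smul_comm]
  · rw [map_smul, h.a_skewPrimitive ht]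
  · rw [map_smul, h1, smul_smul, inv_mul_cancel₀ hκ, one_smul]

variable [FiniteDimensional k H]

/-- If the derivation kills the skew-primitive then its kernel is the Taft subalgebra, and every
simple left coideal is one-dimensional. -/
lemma false_of_d_eq_zero [CharZero k] (h : IsDerPair q a d) {ζ : k} {x β : H}
    (ht : IsTaftPair ζ x β) (hdim : Module.finrank k H = 125) (hx : d x = 0) {V : Submodule k H}
    (hV : IsSimpleLC V) (hV2 : 2 ≤ Module.finrank k V) : False := by
  set S := Submodule.span k (Set.range fun p : Fin 5 × Fin 5 => x ^ (p.1 : ℕ) * β ^ (p.2 : ℕ))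
  have hS : S ≤ LinearMap.ker d := by
    rw [Submodule.span_le]
    rintro _ ⟨p, rfl⟩
    have hp : ∀ {u : H}, d u = 0 → ∀ n : ℕ, d (u ^ n) = 0 := by
      intro u hu n
      induction n with
      | zero => rw [pow_zero, h.d_one]
      | succ n ih => rw [pow_succ]; exact h.mul_mem_ker ih hu
    exact h.mul_mem_ker (hp hx _) (hp (h.d_grouplike ht.gl) _)
  have hSdim : Module.finrank k S = 25 := by
    rw [finrank_span_eq_card ht.linearIndependent_monomial]; simp
  have hSker : S = LinearMap.ker d := by
    apply Submodule.eq_of_le_of_finrank_le hS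
    have h1 := h.finrank_le
    have h2 := h.finrank_ker_le
    omega
  classical
  have hex : ∃ m, V.map (d ^ m) = ⊥ := ⟨5, by rw [h.nil, Submodule.map_zero]⟩
  obtain ⟨m, hm⟩ : ∃ m, Nat.find hex = m + 1 := by
    refine Nat.exists_eq_succ_of_ne_zero fun h0 => hV.ne_bot ?_
    have := Nat.find_spec hex
    rwa [h0, pow_zero, Module.End.one_eq_id, Submodule.map_id] at this
  have hne := Nat.find_min hex (show m < Nat.find hex by omega)
  have hz := Nat.find_spec hex
  rw [hm] at hz
  obtain ⟨hV', hf⟩ := hV.map (pow_mem h.skew.1 m) hne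
  have hle : V.map (d ^ m) ≤ S := by
    rw [hSker, LinearMap.le_ker_iff_map, ← Submodule.map_comp, ← Module.End.mul_eq_comp, ← pow_succ']
    exact hz
  obtain ⟨i, hi⟩ := ht.exists_pow_mem hV'.isLC hV'.ne_bot hle
  exact hV'.grouplike_notMem (by omega) ht.gl.pow hi

end IsDerPair

end Linked

section Coinvariants

open Coalgebra HopfAlgebra

variable {k H : Type*} [Field k] [Ring H] [HopfAlgebra k H]

/-- The elements fixed by `a` and killed by `d`. -/
def coinv (a : H →ₐ[k] H) (d : Module.End k H) : Submodule k H :=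
  LinearMap.ker d ⊓ LinearMap.ker (a.toLinearMap - 1)

lemma mem_coinv {a : H →ₐ[k] H} {d : Module.End k H} {r : H} :
    r ∈ coinv a d ↔ d r = 0 ∧ a r = r := by
  rw [coinv, Submodule.mem_inf, LinearMap.mem_ker, LinearMap.mem_ker, LinearMap.sub_apply,
    sub_eq_zero]
  rfl

namespace IsDerPair

variable {q : k} {a : H →ₐ[k] H} {d : Module.End k H}

lemma isLC_coinv (h : IsDerPair q a d) : IsLC (coinv a d) :=
  (isLC_ker h.skew.1).inf (isLC_ker (sub_mem h.mem (one_mem _)))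

lemma one_mem_coinv (h : IsDerPair q a d) : (1 : H) ∈ coinv a d :=
  mem_coinv.mpr ⟨h.d_one, map_one a⟩

lemma mul_mem_coinv (h : IsDerPair q a d) {r s : H} (hr : r ∈ coinv a d) (hs : s ∈ coinv a d) :
    r * s ∈ coinv a d := by
  rw [mem_coinv] at *
  exact ⟨h.mul_mem_ker hr.1 hs.1, by rw [map_mul, hr.2, hs.2]⟩

lemma pow_mem_coinv (h : IsDerPair q a d) {r : H} (hr : r ∈ coinv a d) (n : ℕ) :
    r ^ n ∈ coinv a d := by
  induction n with
  | zero => rw [pow_zero]; exact h.one_mem_coinv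
  | succ n ih => rw [pow_succ]; exact h.mul_mem_coinv ih hr

end IsDerPair

namespace IsLinked

variable {ζ : k} {x β : H} {a : H →ₐ[k] H} {d : Module.End k H}

lemma a_pow (h : IsLinked ζ x β a d) (i : ℕ) : a (β ^ i) = ζ ^ i • β ^ i := by
  rw [map_pow, h.a_β, smul_pow]

lemma eq_one_of_fixed (h : IsLinked ζ x β a d) {χ : H} (hχ : IsGroupLikeElem k χ) (ha : a χ = χ) :
    χ = 1 := by
  obtain ⟨i, rfl⟩ := h.gl_eq χ hχ
  rw [h.a_pow] at ha
  have h1 := congrArg (counit (R := k)) ha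
  rw [map_smul, hχ.counit_eq_one, smul_eq_mul, mul_one] at h1
  obtain ⟨j, rfl⟩ := (h.taft.prim.pow_eq_one_iff_dvd i).mp h1
  rw [pow_mul, h.taft.pow_five, one_pow]

lemma d_pow_x (h : IsLinked ζ x β a d) (j : ℕ) :
    d (x ^ (j + 1)) = qbin ζ (j + 1) 1 • (x ^ j * β) := by
  induction j with
  | zero => simp [h.d_x, qbin_one_right]
  | succ j ih =>
    rw [pow_succ', h.der.skew.2, ih, h.a_x, h.d_x, pow_mul_qcomm h.taft.comm, mul_smul_comm,
      ← mul_assoc, ← pow_succ', ← add_smul, qbin_one_right, qbin_one_right,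
      Finset.sum_range_succ _ (j + 1)]

lemma exists_d_eq [CharZero k] (h : IsLinked ζ x β a d) {m : ℕ} (hm : m ≤ 4) {t : H}
    (ht : t ∈ Submodule.span k {y : H | ∃ j < m, ∃ l, d l = 0 ∧ y = x ^ j * l}) :
    ∃ s ∈ Submodule.span k {y : H | ∃ j < m + 1, ∃ l, d l = 0 ∧ y = x ^ j * l}, d s = t := by
  induction ht using Submodule.span_induction with
  | mem y hy =>
    obtain ⟨j, hj, l, hl, rfl⟩ := hy
    have hc : qbin ζ (j + 1) 1 ≠ 0 := qbin_one_right_ne_zero h.taft.prim (by omega) (by omega)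
    refine ⟨(qbin ζ (j + 1) 1)⁻¹ • (x ^ (j + 1) * (β ^ 4 * l)), Submodule.smul_mem _ _
      (Submodule.subset_span ⟨j + 1, by omega, β ^ 4 * l, ?_, rfl⟩), ?_⟩
    · exact h.der.mul_mem_ker (h.der.d_grouplike h.taft.gl.pow) hl
    · have hd : d (β ^ 4 * l) = 0 := h.der.mul_mem_ker (h.der.d_grouplike h.taft.gl.pow) hl
      rw [map_smul, h.der.skew.2, hd, h.d_pow_x, mul_zero, zero_add, smul_mul_assoc, smul_smul,
        inv_mul_cancel₀ hc, one_smul, mul_assoc, ← mul_assoc β, ← pow_succ', h.taft.pow_five,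
        one_mul]
  | zero => exact ⟨0, zero_mem _, map_zero _⟩
  | add u v _ _ hu hv =>
    obtain ⟨s, hs, rfl⟩ := hu
    obtain ⟨s', hs', rfl⟩ := hv
    exact ⟨s + s', add_mem hs hs', map_add _ _ _⟩
  | smul c u _ hu =>
    obtain ⟨s, hs, rfl⟩ := hu
    exact ⟨c • s, Submodule.smul_mem _ _ hs, map_smul _ _ _⟩

lemma mem_span_of_d_pow [CharZero k] (h : IsLinked ζ x β a d) {m : ℕ} (hm : m ≤ 5) {z : H}
    (hz : (d ^ m) z = 0) :
    z ∈ Submodule.span k {y : H | ∃ j < m, ∃ l, d l = 0 ∧ y = x ^ j * l} := by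
  induction m generalizing z with
  | zero =>
    have : z = 0 := hz
    rw [this]; exact zero_mem _
  | succ m ih =>
    rw [pow_succ, Module.End.mul_apply] at hz
    obtain ⟨s, hs, hsz⟩ := h.exists_d_eq (by omega) (ih (by omega) hz)
    have h1 : z - s ∈ Submodule.span k {y : H | ∃ j < m + 1, ∃ l, d l = 0 ∧ y = x ^ j * l} :=
      Submodule.subset_span ⟨0, by omega, z - s, by rw [map_sub, hsz, sub_self], by simp⟩
    rw [← sub_add_cancel z s]
    exact add_mem h1 hs

lemma mul_pow_mem_coinv (h : IsLinked ζ x β a d) {l : H} (hl : d l = 0) {i : ℕ} (hi : i < 5)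
    (ha : a l = ζ ^ i • l) : l * β ^ (5 - i) ∈ coinv a d ∧ β ^ (5 - i) * l ∈ coinv a d := by
  have hd := h.der.d_grouplike (h.taft.gl.pow (n := 5 - i))
  have h1 : ζ ^ i * ζ ^ (5 - i) = 1 := by
    rw [← pow_add, show i + (5 - i) = 5 by omega, h.taft.prim.pow_eq_one]
  rw [mem_coinv, mem_coinv]
  refine ⟨⟨h.der.mul_mem_ker hl hd, ?_⟩, h.der.mul_mem_ker hd hl, ?_⟩
  · rw [map_mul, ha, h.a_pow, smul_mul_smul_comm, h1, one_smul]
  · rw [map_mul, ha, h.a_pow, smul_mul_smul_comm, mul_comm, h1, one_smul]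

lemma eq_sum_eigProj [CharZero k] (h : IsLinked ζ x β a d) {z : H} :
    z = (5 : k)⁻¹ • ∑ j ∈ Finset.range 5, eigProj a.toLinearMap (ζ ^ j) z := by
  have h1 := LinearMap.congr_fun (sum_eigProj (Φ := a.toLinearMap) h.taft.prim) z
  rw [LinearMap.sum_apply] at h1
  rw [h1, LinearMap.smul_apply, Module.End.one_apply, smul_smul, inv_mul_cancel₀ (by norm_num),
    one_smul]

lemma eigProj_spec (h : IsLinked ζ x β a d) {z : H} (hz : d z = 0) (j : ℕ) :
    d (eigProj a.toLinearMap (ζ ^ j) z) = 0 ∧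
      a (eigProj a.toLinearMap (ζ ^ j) z) = ζ ^ j • eigProj a.toLinearMap (ζ ^ j) z := by
  refine ⟨?_, ?_⟩
  · exact eigProj_mem (P := LinearMap.ker d) (fun u hu => h.der.d_a hu) _ hz
  · exact LinearMap.congr_fun (mul_eigProj h.der.pow_five (ω := ζ ^ j)
      (by rw [← pow_mul, mul_comm, pow_mul, h.taft.prim.pow_eq_one, one_pow])) z

lemma ker_le_iSup [CharZero k] (h : IsLinked ζ x β a d) :
    LinearMap.ker d ≤ ⨆ i : Fin 5, (coinv a d).map (LinearMap.mulLeft k (β ^ (i : ℕ))) := by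
  intro z hz
  rw [h.eq_sum_eigProj (z := z)]
  refine Submodule.smul_mem _ _ (Submodule.sum_mem _ fun j hj => ?_)
  rw [Finset.mem_range] at hj
  obtain ⟨h1, h2⟩ := h.eigProj_spec hz j
  refine Submodule.mem_iSup_of_mem (⟨j, hj⟩ : Fin 5) ⟨_, (h.mul_pow_mem_coinv h1 hj h2).2, ?_⟩
  rw [LinearMap.mulLeft_apply, ← mul_assoc, ← pow_add, show j + (5 - j) = 5 by omega,
    h.taft.pow_five, one_mul]

lemma iSup_eq_top [CharZero k] (h : IsLinked ζ x β a d) :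
    ⨆ p : Fin 5 × Fin 5, (coinv a d).map (LinearMap.mulLeft k (x ^ (p.1 : ℕ) * β ^ (p.2 : ℕ))) = ⊤ := by
  rw [eq_top_iff]
  intro z _
  have hz : (d ^ 5) z = 0 := by rw [h.der.nil]; rfl
  refine (Submodule.span_le.mpr ?_) (h.mem_span_of_d_pow le_rfl hz)
  rintro _ ⟨j, hj, l, hl, rfl⟩
  have h1 := Submodule.mem_map_of_mem (f := LinearMap.mulLeft k (x ^ j)) (h.ker_le_iSup hl)
  rw [Submodule.map_iSup] at h1
  refine SetLike.le_def.mp (iSup_le fun i => ?_) h1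
  rw [← Submodule.map_comp, ← LinearMap.mulLeft_mul]
  exact le_iSup (fun p : Fin 5 × Fin 5 =>
    (coinv a d).map (LinearMap.mulLeft k (x ^ (p.1 : ℕ) * β ^ (p.2 : ℕ)))) (⟨j, hj⟩, i)

/-- A nonzero left coideal has a nonzero image inside the coinvariants under an operator commuting
with the left hit actions, followed by right multiplication by a grouplike. -/
lemma exists_transport [CharZero k] (h : IsLinked ζ x β a d) {Z : Submodule k H} (hZ0 : Z ≠ ⊥) :
    ∃ P ∈ RI k H, ∃ i, Z.map P ≠ ⊥ ∧ ∀ z ∈ Z, P z * β ^ i ∈ coinv a d := by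
  classical
  have hex : ∃ m, Z.map (d ^ m) = ⊥ := ⟨5, by rw [h.der.nil, Submodule.map_zero]⟩
  obtain ⟨m, hm⟩ : ∃ m, Nat.find hex = m + 1 := by
    refine Nat.exists_eq_succ_of_ne_zero fun h0 => hZ0 ?_
    have := Nat.find_spec hex
    rwa [h0, pow_zero, Module.End.one_eq_id, Submodule.map_id] at this
  have hne := Nat.find_min hex (show m < Nat.find hex by omega)
  have hz := Nat.find_spec hex
  rw [hm] at hz
  have hker : ∀ z ∈ Z, d ((d ^ m) z) = 0 := by
    intro z hzZ
    have : (d ^ (m + 1)) z ∈ Z.map (d ^ (m + 1)) := Submodule.mem_map_of_mem hzZ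
    rwa [hz, Submodule.mem_bot, pow_succ', Module.End.mul_apply] at this
  obtain ⟨y, hy, hy0⟩ := Submodule.exists_mem_ne_zero_of_ne_bot hne
  obtain ⟨z, hzZ, rfl⟩ := hy
  obtain ⟨j, hj, hj0⟩ : ∃ j < 5, eigProj a.toLinearMap (ζ ^ j) ((d ^ m) z) ≠ 0 := by
    by_contra hcon
    push Not at hcon
    apply hy0
    rw [h.eq_sum_eigProj (z := (d ^ m) z), Finset.sum_eq_zero, smul_zero]
    intro j hj
    exact hcon j (Finset.mem_range.mp hj)
  refine ⟨eigProj a.toLinearMap (ζ ^ j) * d ^ m, ?_, 5 - j, ?_, ?_⟩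
  · refine mul_mem ?_ (pow_mem h.der.skew.1 m)
    exact sum_mem fun i _ => Subalgebra.smul_mem _ (pow_mem h.der.mem i) _
  · intro h0
    have : (eigProj a.toLinearMap (ζ ^ j) * d ^ m) z ∈
      Z.map (eigProj a.toLinearMap (ζ ^ j) * d ^ m) := Submodule.mem_map_of_mem hzZ
    rw [h0, Submodule.mem_bot] at this
    exact hj0 this
  · intro w hw
    obtain ⟨h1, h2⟩ := h.eigProj_spec (hker w hw) j
    exact (h.mul_pow_mem_coinv h1 hj h2).1

lemma exists_simple [CharZero k] (h : IsLinked ζ x β a d) {V : Submodule k H} (hV : IsSimpleLC V) :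
    ∃ V' ≤ coinv a d, IsSimpleLC V' ∧ Module.finrank k V' = Module.finrank k V := by
  obtain ⟨P, hP, i, hne, hmem⟩ := h.exists_transport hV.ne_bot
  obtain ⟨h1, h2⟩ := hV.map hP hne
  obtain ⟨h3, h4⟩ := h1.mulRight (h.taft.gl.pow (n := i))
  refine ⟨_, ?_, h3, h4.trans h2⟩
  rintro _ ⟨_, ⟨v, hv, rfl⟩, rfl⟩
  exact hmem v hv

variable [FiniteDimensional k H]

lemma eq_coinv_of_ideal [CharZero k] (h : IsLinked ζ x β a d)
    (hfr : Module.finrank k (coinv a d) ≤ 5) {U : Submodule k H} (hUR : U ≤ coinv a d)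
    (hU : IsLC U) (h0 : U ≠ ⊥) (hmul : ∀ r ∈ coinv a d, ∀ u ∈ U, r * u ∈ U) :
    U = coinv a d := by
  set W : Submodule k H := ⨆ p : Fin 5 × Fin 5, U.map (LinearMap.mulLeft k (x ^ (p.1 : ℕ) * β ^ (p.2 : ℕ)))
    with hW
  have hHU : ∀ z : H, ∀ u ∈ U, z * u ∈ W := by
    intro z u hu
    have hz : z ∈ ⨆ p : Fin 5 × Fin 5,
      (coinv a d).map (LinearMap.mulLeft k (x ^ (p.1 : ℕ) * β ^ (p.2 : ℕ))) := by
      rw [h.iSup_eq_top]; trivial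
    have h1 := Submodule.mem_map_of_mem (f := LinearMap.mulRight k u) hz
    rw [Submodule.map_iSup] at h1
    refine SetLike.le_def.mp (iSup_le fun p => ?_) h1
    rintro _ ⟨_, ⟨r, hr, rfl⟩, rfl⟩
    refine Submodule.mem_iSup_of_mem p ⟨r * u, hmul r hr u hu, ?_⟩
    simp [mul_assoc]
  have htop : W = ⊤ := by
    have h1 : (1 : H) ∈ Submodule.span k {y : H | ∃ z, ∃ u ∈ U, y = z * u} :=
      one_mem_of_isLC hU h0 fun z u hu => Submodule.subset_span ⟨z, u, hu, rfl⟩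
    rw [eq_top_iff]
    intro w _
    have h2 : ∀ y ∈ Submodule.span k {y : H | ∃ z, ∃ u ∈ U, y = z * u}, w * y ∈ W := by
      intro y hy
      induction hy using Submodule.span_induction with
      | mem y hy =>
        obtain ⟨z, u, hu, rfl⟩ := hy
        rw [← mul_assoc]; exact hHU _ u hu
      | zero => rw [mul_zero]; exact zero_mem _
      | add u v _ _ hu hv => rw [mul_add]; exact add_mem hu hv
      | smul c u _ hu => rw [mul_smul_comm]; exact Submodule.smul_mem _ _ hu
    have := h2 1 h1
    rwa [mul_one] at this
  have hfW : Module.finrank k W ≤ 25 * Module.finrank k U := by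
    calc _ ≤ ∑ p : Fin 5 × Fin 5, Module.finrank k
          (U.map (LinearMap.mulLeft k (x ^ (p.1 : ℕ) * β ^ (p.2 : ℕ)))) := finrank_iSup_le _
      _ ≤ ∑ p : Fin 5 × Fin 5, Module.finrank k U :=
        Finset.sum_le_sum fun i _ => Submodule.finrank_map_le _ _
      _ = _ := by simp
  rw [htop, finrank_top, h.dim] at hfW
  exact Submodule.eq_of_le_of_finrank_le hUR (by omega)

lemma finrank_coinv [CharZero k] (h : IsLinked ζ x β a d) : Module.finrank k (coinv a d) = 5 := by
  apply le_antisymm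
  · have h1 := h.der.finrank_le
    have h2 := h.der.finrank_ker_le
    rw [h.dim] at h1 h2
    have hind : iSupIndep fun i : Fin 5 => (coinv a d).map (LinearMap.mulLeft k (β ^ (i : ℕ))) := by
      have h3 : iSupIndep fun i : Fin 5 => Module.End.eigenspace a.toLinearMap (ζ ^ (i : ℕ)) :=
        (Module.End.eigenspaces_iSupIndep a.toLinearMap).comp fun i j hij =>
          Fin.ext (h.taft.prim.pow_inj i.2 j.2 hij)
      refine h3.mono fun i => ?_
      rintro _ ⟨r, hr, rfl⟩
      rw [Module.End.mem_eigenspace_iff, LinearMap.mulLeft_apply, AlgHom.toLinearMap_apply, map_mul,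
        (mem_coinv.mp hr).2, h.a_pow, smul_mul_assoc]
    set φ : (Fin 5 → coinv a d) →ₗ[k] LinearMap.ker d := ∑ i : Fin 5,
      ((LinearMap.mulLeft k (β ^ (i : ℕ))).restrict (p := coinv a d) (q := LinearMap.ker d)
        fun r hr => h.der.mul_mem_ker (h.der.d_grouplike h.taft.gl.pow) (mem_coinv.mp hr).1) ∘ₗ
        LinearMap.proj i with hφ
    have hinj : Function.Injective φ := by
      rw [← LinearMap.ker_eq_bot, LinearMap.ker_eq_bot']
      intro r hr
      have h4 : ∑ i : Fin 5, β ^ (i : ℕ) * (r i : H) = 0 := by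
        have := congrArg Subtype.val hr
        simp only [hφ, LinearMap.sum_apply, AddSubmonoidClass.coe_finsetSum] at this
        exact this
      have h5 := (iSupIndep_iff_finsetSum_eq_zero_imp_eq_zero _).mp hind Finset.univ
        (fun i => β ^ (i : ℕ) * (r i : H)) (fun i _ => ⟨r i, (r i).2, rfl⟩) h4
      funext i
      refine Subtype.ext ?_
      have h6 := h5 i (Finset.mem_univ i)
      exact ((h.taft.isUnit.pow (i : ℕ)).mul_right_eq_zero).mp h6
    have h6 := LinearMap.finrank_le_finrank_of_injective hinj
    rw [Module.finrank_pi_fintype, Finset.sum_const, Finset.card_univ, Fintype.card_fin,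
      smul_eq_mul] at h6
    omega
  · have h1 := finrank_iSup_le fun p : Fin 5 × Fin 5 =>
      (coinv a d).map (LinearMap.mulLeft k (x ^ (p.1 : ℕ) * β ^ (p.2 : ℕ)))
    rw [h.iSup_eq_top, finrank_top, h.dim] at h1
    have h2 : ∑ p : Fin 5 × Fin 5, Module.finrank k
        ((coinv a d).map (LinearMap.mulLeft k (x ^ (p.1 : ℕ) * β ^ (p.2 : ℕ)))) ≤
        ∑ p : Fin 5 × Fin 5, Module.finrank k (coinv a d) :=
      Finset.sum_le_sum fun i _ => Submodule.finrank_map_le _ _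
    simp at h2
    omega

end IsLinked

end Coinvariants

section TwoDim

open Coalgebra HopfAlgebra

variable {k H : Type*} [Field k] [Ring H] [HopfAlgebra k H] [FiniteDimensional k H]

lemma exists_skewPrimitive_of_finrank_two [Nontrivial H] {N : Submodule k H} (hN : IsLC N)
    (h1 : (1 : H) ∈ N)
    (h2 : Module.finrank k N = 2) : ∃ y ∈ N, ∃ χ, y ≠ 0 ∧ counit (R := k) y = 0 ∧
      IsGroupLikeElem k χ ∧ comul (R := k) y = y ⊗ₜ[k] 1 + χ ⊗ₜ[k] y := by
  have hne : N ⊓ LinearMap.ker (counit (R := k) (A := H)) ≠ ⊥ := by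
    intro h0
    have h3 := finrank_map_add_finrank_inf_ker (counit (R := k) (A := H)) N
    have h4 := Submodule.finrank_le (N.map (counit (R := k) (A := H)))
    rw [h0, h2, finrank_bot] at h3
    rw [Module.finrank_self] at h4
    omega
  obtain ⟨y, ⟨hyN, hye⟩, hy0⟩ := Submodule.exists_mem_ne_zero_of_ne_bot hne
  rw [SetLike.mem_coe, LinearMap.mem_ker] at hye
  have hli : LinearIndependent k ![1, y] := by
    rw [LinearIndependent.pair_iff]
    intro s t hst
    have h3 := congrArg (counit (R := k)) hst
    rw [map_add, map_smul, map_smul, hye, Bialgebra.counit_one, map_zero, smul_zero, add_zero,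
      smul_eq_mul, mul_one] at h3
    rw [h3, zero_smul, zero_add] at hst
    exact ⟨h3, (smul_eq_zero.mp hst).resolve_right hy0⟩
  have hspan : Submodule.span k (Set.range ![1, y]) = N := by
    apply Submodule.eq_of_le_of_finrank_eq
    · rw [Submodule.span_le]
      rintro _ ⟨i, rfl⟩
      fin_cases i
      · exact h1
      · exact hyN
    · rw [finrank_span_eq_card hli, h2, Fintype.card_fin]
  obtain ⟨E, hE, hv, hvE⟩ := exists_comatrix hli (by rw [hspan]; exact hN)
  have h00 : E 0 0 = 1 := by
    have := hvE 0
    simp [hye] at this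
    exact this.symm
  have h10 : E 1 0 = y := by
    have := hvE 1
    simp [hye] at this
    exact this.symm
  obtain ⟨f, hf⟩ := exists_dual_of_linearIndependent hli ![0, 1]
  have h01 : E 0 1 = 0 := by
    have h3 := congrArg (rslice f) (hv 0)
    have hf0 := hf 0
    have hf1 := hf 1
    simp at hf0 hf1
    simpa [hf0, hf1, Algebra.TensorProduct.one_def] using h3.symm
  refine ⟨y, hyN, E 1 1, hy0, hye, ⟨?_, ?_⟩, ?_⟩
  · simpa using hE.counit_eq 1 1
  · simpa [h01] using hE.comul_eq 1 1
  · simpa [h10] using hv 1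

lemma IsLinked.false_of_finrank_two [CharZero k] [Nontrivial H] {ζ : k} {x β : H} {a : H →ₐ[k] H}
    {d : Module.End k H} (h : IsLinked ζ x β a d) {V N : Submodule k H} (hVR : V ≤ coinv a d)
    (hV : IsSimpleLC V) (hV2 : 2 ≤ Module.finrank k V) (hN : IsLC N) (hNR : N ≤ coinv a d)
    (h1 : (1 : H) ∈ N) (h2 : Module.finrank k N = 2) : False := by
  obtain ⟨y₀, hy₀N, χ, hy₀0, hy₀e, hχ, hy₀⟩ := exists_skewPrimitive_of_finrank_two hN h1 h2
  obtain ⟨i, hi⟩ := h.gl_eq χ hχ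
  have hχ5 : χ ^ 5 = 1 := by rw [hi, ← pow_mul, mul_comm, pow_mul, h.taft.pow_five, one_pow]
  have hPmem : ∀ y, y ∈ coinv a d ⊓ LinearMap.ker (comul (R := k) (A := H) -
      (TensorProduct.mk k H H).flip 1 - TensorProduct.mk k H H χ) ↔
      y ∈ coinv a d ∧ comul (R := k) y = y ⊗ₜ[k] 1 + χ ⊗ₜ[k] y := by
    intro y
    rw [Submodule.mem_inf, LinearMap.mem_ker, LinearMap.sub_apply, LinearMap.sub_apply,
      LinearMap.flip_apply, TensorProduct.mk_apply, TensorProduct.mk_apply, sub_sub, sub_eq_zero]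
  set P := coinv a d ⊓ LinearMap.ker (comul (R := k) (A := H) -
      (TensorProduct.mk k H H).flip 1 - TensorProduct.mk k H H χ) with hP
  obtain ⟨y, hyP, ζ', hζ', hcomm, -, hy0, hχ1⟩ := exists_qcomm h.taft.prim hχ5 (P := P) (y₀ := y₀)
    (fun y hy => ((hPmem y).mp hy).2) (by
      intro y hy
      rw [hPmem, mem_coinv] at hy ⊢
      obtain ⟨⟨hd, ha⟩, hΔ⟩ := hy
      refine ⟨⟨h.der.mul_mem_ker (h.der.mul_mem_ker (h.der.d_grouplike hχ) hd)
        (h.der.d_grouplike hχ.pow), ?_⟩, ?_⟩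
      · have haχ : a χ = ζ ^ i • χ := by rw [hi, h.a_pow]
        have hc : ζ ^ i * (ζ ^ i) ^ 4 = 1 := by
          rw [← pow_succ', ← pow_mul, mul_comm, pow_mul, h.taft.prim.pow_eq_one, one_pow]
        rw [map_mul, map_mul, map_pow, ha, haχ, smul_pow, smul_mul_assoc, smul_mul_smul_comm, hc,
          one_smul]
      · rw [Bialgebra.comul_mul, Bialgebra.comul_mul, hΔ, hχ.comul_eq_tmul_self,
          (hχ.pow (n := 4)).comul_eq_tmul_self, mul_add, add_mul]
        simp only [Algebra.TensorProduct.tmul_mul_tmul]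
        rw [mul_one, ← pow_succ', mul_assoc χ χ, ← pow_succ', hχ5, mul_one])
    ((hPmem _).mpr ⟨hNR hy₀N, hy₀⟩) (by
      rw [Submodule.mem_span_singleton]
      rintro ⟨c, hc⟩
      have hc0 : c ≠ 0 := by
        rintro rfl
        rw [zero_smul] at hc
        exact hy₀0 hc.symm
      have haχ : a χ = χ := by
        have h3 := (mem_coinv.mp (hNR hy₀N)).2
        rw [← hc, map_smul, map_sub, map_one] at h3
        exact sub_right_injective (smul_right_injective H hc0 h3)
      rw [h.eq_one_of_fixed hχ haχ, sub_self, smul_zero] at hc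
      exact hy₀0 hc.symm)
  rw [hPmem] at hyP
  have ht : IsTaftPair ζ' y χ := ⟨hζ', hχ, hχ5, hχ1, hyP.2, hcomm, hy0⟩
  have hspan : Submodule.span k (Set.range fun j : Fin 5 => y ^ (j : ℕ)) = coinv a d := by
    apply Submodule.eq_of_le_of_finrank_eq
    · rw [Submodule.span_le]
      rintro _ ⟨j, rfl⟩
      exact h.der.pow_mem_coinv hyP.1 _
    · rw [finrank_span_eq_card ht.linearIndependent_pow, h.finrank_coinv, Fintype.card_fin]
  obtain ⟨j, hj⟩ := ht.exists_pow_mem hV.isLC hV.ne_bot (hVR.trans (by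
    rw [← hspan, Submodule.span_le]
    rintro _ ⟨j, rfl⟩
    exact Submodule.subset_span ⟨(j, 0), by simp⟩))
  exact hV.grouplike_notMem hV2 hχ.pow hj

end TwoDim

section Pairing

open Coalgebra HopfAlgebra

variable {k H : Type*} [Field k] [Ring H] [HopfAlgebra k H]

/-- The elements of `R` orthogonal to `U` for the form `(u, r) ↦ lam (u * r)`. -/
def perp (R : Submodule k H) (lam : Module.Dual k H) (U : Submodule k H) : Submodule k H where
  carrier := {r | r ∈ R ∧ ∀ u ∈ U, lam (u * r) = 0}
  zero_mem' := ⟨zero_mem _, fun u _ => by rw [mul_zero, map_zero]⟩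
  add_mem' := fun hr hs => ⟨add_mem hr.1 hs.1, fun u hu => by
    rw [mul_add, map_add, hr.2 u hu, hs.2 u hu, add_zero]⟩
  smul_mem' := fun c r hr => ⟨Submodule.smul_mem _ _ hr.1, fun u hu => by
    rw [mul_smul_comm, map_smul, hr.2 u hu, smul_zero]⟩

lemma mem_perp {R U : Submodule k H} {lam : Module.Dual k H} {r : H} :
    r ∈ perp R lam U ↔ r ∈ R ∧ ∀ u ∈ U, lam (u * r) = 0 := Iff.rfl

lemma rslice_comul_mul {n : ℕ} {v : Fin n → H} {E : Matrix (Fin n) (Fin n) H}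
    (hv : ∀ i, comul (R := k) (v i) = ∑ j, E i j ⊗ₜ[k] v j) (lam : Module.Dual k H) (i : Fin n)
    (r : H) : rho lam (v i * r) =
      ∑ j, E i j * rho (lam ∘ₗ LinearMap.mulLeft k (v j)) r := by
  simp only [rho_apply, Bialgebra.comul_mul, hv]
  generalize comul (R := k) r = t
  induction t with
  | zero => simp
  | add s t hs ht => simp only [mul_add, map_add, hs, ht, Finset.sum_add_distrib]
  | tmul b c => simp [Finset.sum_mul, Algebra.TensorProduct.tmul_mul_tmul]

variable [FiniteDimensional k H]

lemma isLC_perp {R U : Submodule k H} (hR : IsLC R) (hU : IsLC U) {lam : Module.Dual k H} {χ : H}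
    (hmul : ∀ u ∈ U, ∀ r ∈ R, u * r ∈ R) (hlam : ∀ r ∈ R, rho lam r = lam r • χ) :
    IsLC (perp R lam U) := by
  intro f r hr
  refine ⟨hR f r hr.1, ?_⟩
  obtain ⟨v, -, hspan, E, hE, hv, -⟩ := exists_comatrix_of_finrank hU
  have hvU : ∀ i, v i ∈ U := fun i => by
    rw [← hspan]
    exact Submodule.subset_span ⟨i, rfl⟩
  have h1 : ∀ i, ∑ j, E i j * rho (lam ∘ₗ LinearMap.mulLeft k (v j)) r = 0 := by
    intro i
    rw [← rslice_comul_mul hv, hlam _ (hmul _ (hvU i) _ hr.1), hr.2 _ (hvU i), zero_smul]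
  have h2 : ∀ i, rho (lam ∘ₗ LinearMap.mulLeft k (v i)) r = 0 := by
    intro i
    have h3 : ∑ l, antipode k (E i l) *
        ∑ j, E l j * rho (lam ∘ₗ LinearMap.mulLeft k (v j)) r = 0 := by
      simp [h1]
    simp only [Finset.mul_sum, ← mul_assoc] at h3
    rw [Finset.sum_comm] at h3
    simp only [← Finset.sum_mul, hE.sum_antipode_mul] at h3
    simpa using h3
  intro u hu
  rw [← hspan] at hu
  induction hu using Submodule.span_induction with
  | mem u hu =>
    obtain ⟨i, rfl⟩ := hu
    have h3 := congrArg f (h2 i)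
    rw [map_zero, rho_apply, ← apply_lslice, ← ell_apply] at h3
    exact h3
  | zero => rw [zero_mul, map_zero]
  | add u v _ _ hu hv => rw [add_mul, map_add, hu, hv, add_zero]
  | smul c u _ hu => rw [smul_mul_assoc, map_smul, hu, smul_zero]

lemma IsLinked.perp_self_eq_bot [CharZero k] {ζ : k} {x β : H} {a : H →ₐ[k] H}
    {d : Module.End k H} (h : IsLinked ζ x β a d) {lam : Module.Dual k H} {χ : H}
    (hlam : ∀ r ∈ coinv a d, rho lam r = lam r • χ) (hne : ∃ r ∈ coinv a d, lam r ≠ 0) :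
    perp (coinv a d) lam (coinv a d) = ⊥ := by
  by_contra h0
  have h1 := h.eq_coinv_of_ideal h.finrank_coinv.le (fun r hr => (mem_perp.mp hr).1)
    (isLC_perp h.der.isLC_coinv h.der.isLC_coinv (fun u hu r hr => h.der.mul_mem_coinv hu hr) hlam)
    h0 (fun r hr u hu => ⟨h.der.mul_mem_coinv hr hu.1, fun s hs => by
      rw [← mul_assoc]; exact hu.2 _ (h.der.mul_mem_coinv hs hr)⟩)
  obtain ⟨r, hr, hr0⟩ := hne
  have h2 : (1 : H) ∈ perp (coinv a d) lam (coinv a d) := by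
    rw [h1]; exact h.der.one_mem_coinv
  exact hr0 (by simpa using h2.2 r hr)

lemma finrank_perp {R U : Submodule k H} (hUR : U ≤ R) {lam : Module.Dual k H}
    (hperp : perp R lam R = ⊥) :
    Module.finrank k (perp R lam U) + Module.finrank k U = Module.finrank k R := by
  set B : R →ₗ[k] Module.Dual k R :=
    ((LinearMap.mul k H).compr₂ lam).flip.compl₁₂ R.subtype R.subtype with hB
  have hBa : ∀ r s : R, B r s = lam ((s : H) * r) := fun r s => rfl
  have hinj : Function.Injective B := by
    rw [← LinearMap.ker_eq_bot, LinearMap.ker_eq_bot']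
    intro r hr
    have : (r : H) ∈ perp R lam R := ⟨r.2, fun u hu => by
      rw [← hBa r ⟨u, hu⟩, hr, LinearMap.zero_apply]⟩
    rw [hperp] at this
    exact Subtype.ext this
  have hbij : Function.Bijective B := ⟨hinj, (LinearMap.injective_iff_surjective_of_finrank_eq_finrank
    Subspace.dual_finrank_eq.symm).mp hinj⟩
  set e := LinearEquiv.ofBijective B hbij
  set U' : Submodule k R := U.comap R.subtype with hU'
  have h1 := Subspace.finrank_add_finrank_dualAnnihilator_eq U'
  have h2 : Module.finrank k U' = Module.finrank k U := by
    rw [hU']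
    exact (Submodule.comapSubtypeEquivOfLe hUR).finrank_eq
  have h3 : perp R lam U = ((U'.dualAnnihilator.comap B).map R.subtype) := by
    ext r
    rw [mem_perp]
    constructor
    · rintro ⟨hr, hru⟩
      refine ⟨⟨r, hr⟩, ?_, rfl⟩
      rw [SetLike.mem_coe, Submodule.mem_comap, Submodule.mem_dualAnnihilator]
      intro w hw
      exact hru _ hw
    · rintro ⟨s, hs, rfl⟩
      rw [SetLike.mem_coe, Submodule.mem_comap, Submodule.mem_dualAnnihilator] at hs
      exact ⟨s.2, fun u hu => hs ⟨u, hUR hu⟩ hu⟩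
  have h4 : Module.finrank k (U'.dualAnnihilator.comap B) =
      Module.finrank k U'.dualAnnihilator := by
    have : U'.dualAnnihilator.comap B = U'.dualAnnihilator.map (e.symm : _ →ₗ[k] R) := by
      exact (Submodule.map_equiv_eq_comap_symm e.symm _).symm
    rw [this]
    exact e.symm.finrank_map_eq _
  have h5 : Module.finrank k (perp R lam U) = Module.finrank k (U'.dualAnnihilator.comap B) := by
    rw [h3]
    exact (Submodule.equivMapOfInjective R.subtype R.injective_subtype _).finrank_eq.symm
  omega

/-- No chain of left coideals of dimensions three and four inside the coinvariants. -/
lemma IsLinked.false_of_flag [CharZero k] [Nontrivial H] {ζ : k} {x β : H} {a : H →ₐ[k] H}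
    {d : Module.End k H} (h : IsLinked ζ x β a d) {V U W : Submodule k H} (hVR : V ≤ coinv a d)
    (hV : IsSimpleLC V) (hV2 : 2 ≤ Module.finrank k V) (hU : IsLC U) (hW : IsLC W) (hUW : U ≤ W)
    (hWR : W ≤ coinv a d) (hU3 : Module.finrank k U = 3) (hW4 : Module.finrank k W = 4) :
    False := by
  have hlt : W < coinv a d := lt_of_le_of_ne hWR fun h0 => by
    have := h.finrank_coinv
    rw [← h0] at this
    omega
  obtain ⟨r₀, hr₀, hr₀W⟩ := SetLike.exists_of_lt hlt
  obtain ⟨f, hf, hfW⟩ := exists_dual_ne_zero_of_notMem hr₀W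
  set lam : Module.Dual k H := (f r₀)⁻¹ • f with hlam
  have hlam0 : lam r₀ = 1 := by rw [hlam, LinearMap.smul_apply, smul_eq_mul, inv_mul_cancel₀ hf]
  have hlamW : ∀ w ∈ W, lam w = 0 := fun w hw => by
    rw [hlam, LinearMap.smul_apply, hfW w hw, smul_zero]
  have hrhoW : ∀ w ∈ W, rho lam w = 0 := by
    intro w hw
    refine eq_zero_of_dual (k := k) fun g => ?_
    rw [rho_apply, ← apply_lslice, ← ell_apply]
    exact hlamW _ (hW g w hw)
  have hdec : ∀ r ∈ coinv a d, ∃ w ∈ W, ∃ c : k, r = w + c • r₀ := by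
    have hsup : W ⊔ Submodule.span k {r₀} = coinv a d := by
      apply Submodule.eq_of_le_of_finrank_le
      · exact sup_le hWR ((Submodule.span_singleton_le_iff_mem _ _).mpr hr₀)
      · have : W < W ⊔ Submodule.span k {r₀} := lt_of_le_of_ne le_sup_left fun h0 =>
          hr₀W (by rw [h0]; exact Submodule.mem_sup_right (Submodule.mem_span_singleton_self r₀))
        have := Submodule.finrank_lt_finrank_of_lt this
        rw [h.finrank_coinv]
        omega
    intro r hr
    rw [← hsup, Submodule.mem_sup] at hr
    obtain ⟨w, hw, z, hz, rfl⟩ := hr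
    obtain ⟨c, rfl⟩ := Submodule.mem_span_singleton.mp hz
    exact ⟨w, hw, c, rfl⟩
  have hrho : ∀ r ∈ coinv a d, rho lam r = lam r • rho lam r₀ := by
    intro r hr
    obtain ⟨w, hw, c, rfl⟩ := hdec r hr
    rw [map_add, map_add, hrhoW w hw, hlamW w hw, map_smul, map_smul, hlam0, zero_add, zero_add,
      smul_eq_mul, mul_one]
  have hperp := h.perp_self_eq_bot hrho ⟨r₀, hr₀, by rw [hlam0]; exact one_ne_zero⟩
  have hUR := hUW.trans hWR
  have hfr := finrank_perp hUR hperp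
  rw [hU3, h.finrank_coinv] at hfr
  exact h.false_of_finrank_two hVR hV hV2
    (isLC_perp h.der.isLC_coinv hU (fun u hu r hr => h.der.mul_mem_coinv (hUR hu) hr) hrho)
    (fun r hr => (mem_perp.mp hr).1)
    ⟨h.der.one_mem_coinv, fun u hu => by rw [mul_one]; exact hlamW u (hUW hu)⟩ (by omega)

end Pairing

section CMat

open Coalgebra

variable {k H : Type*} [Field k] [AddCommGroup H] [Module k H] [Coalgebra k H]

lemma rho_counit_comp {D : Module.End k H} (hD : D ∈ RI k H) (h : H) :
    rho (counit (R := k) ∘ₗ D) h = D h := by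
  have h1 := rslice_counit_comul (k := k) (D h)
  rw [comul_RI hD] at h1
  rw [← h1, rho_apply]
  generalize comul (R := k) h = t
  induction t with
  | zero => simp
  | add a b ha hb => simp only [map_add, ha, hb]
  | tmul a b => simp

/-- The matrix `ε(D(E i j))`. -/
def cmat {ι : Type*} (E : Matrix ι ι H) (D : Module.End k H) : Matrix ι ι k :=
  fun i j => counit (R := k) (D (E i j))

lemma cmat_apply {ι : Type*} {E : Matrix ι ι H} (D : Module.End k H) (i j : ι) :
    cmat E D i j = counit (R := k) (D (E i j)) :=
  rfl

variable {n : ℕ} {E : Matrix (Fin n) (Fin n) H}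

lemma cmat_smul (c : k) (D : Module.End k H) : cmat E (c • D) = c • cmat E D := by
  ext i j
  simp [cmat_apply]

namespace IsComatrix

lemma RI_apply {ι : Type*} [Fintype ι] [DecidableEq ι] {E : Matrix ι ι H}
    (hE : IsComatrix (k := k) E) {D : Module.End k H} (hD : D ∈ RI k H) (i j : ι) :
    D (E i j) = ∑ l, cmat E D l j • E i l := by
  rw [← rho_counit_comp hD, rho_apply, hE.comul_eq, map_sum]
  rfl

lemma cmat_one (hE : IsComatrix (k := k) E) : cmat E (1 : Module.End k H) = 1 := by
  ext i j
  rw [cmat_apply, Module.End.one_apply, hE.counit_eq, Matrix.one_apply]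

lemma cmat_mul (hE : IsComatrix (k := k) E) {D D' : Module.End k H} (hD' : D' ∈ RI k H) :
    cmat E (D * D') = cmat E D * cmat E D' := by
  ext i j
  rw [cmat_apply, Module.End.mul_apply, hE.RI_apply hD', Matrix.mul_apply, map_sum, map_sum]
  refine Finset.sum_congr rfl fun l _ => ?_
  rw [map_smul, map_smul, smul_eq_mul, mul_comm]
  rfl

lemma cmat_pow (hE : IsComatrix (k := k) E) {D : Module.End k H} (hD : D ∈ RI k H) (m : ℕ) :
    cmat E (D ^ m) = cmat E D ^ m := by
  induction m with
  | zero => rw [pow_zero, pow_zero, hE.cmat_one]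
  | succ m ih => rw [pow_succ, pow_succ, hE.cmat_mul hD, ih]

end IsComatrix

/-- A matrix over `H` is row irreducible when no proper nonzero space of row vectors is stable
under all its scalar images. -/
def RowIrreducible (E : Matrix (Fin n) (Fin n) H) : Prop :=
  ∀ U : Submodule k (Fin n → k), (∀ f : Module.Dual k H, ∀ ψ ∈ U, Matrix.vecMul ψ (E.map f) ∈ U) →
    U = ⊥ ∨ U = ⊤

lemma IsSimpleLC.exists_comatrix [FiniteDimensional k H] {V : Submodule k H} (hV : IsSimpleLC V)
    (hn : Module.finrank k V = n) : ∃ v : Fin n → H, LinearIndependent k v ∧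
      Submodule.span k (Set.range v) = V ∧ ∃ E : Matrix (Fin n) (Fin n) H, IsComatrix (k := k) E ∧
        (∀ i, comul (R := k) (v i) = ∑ j, E i j ⊗ₜ[k] v j) ∧
        (∀ i, v i = ∑ j, counit (R := k) (v j) • E i j) ∧ RowIrreducible (k := k) E := by
  subst hn
  obtain ⟨v, hv, hspan, E, hE, hvE, hvc⟩ := exists_comatrix_of_finrank hV.isLC
  refine ⟨v, hv, hspan, E, hE, hvE, hvc, fun U hU => ?_⟩
  set T : (Fin (Module.finrank k V) → k) →ₗ[k] H := Fintype.linearCombination k v with hT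
  have hTa : ∀ ψ, T ψ = ∑ i, ψ i • v i := fun ψ => Fintype.linearCombination_apply k v ψ
  have hinj : Function.Injective T := by
    rw [← LinearMap.ker_eq_bot, LinearMap.ker_eq_bot']
    intro ψ hψ
    rw [hTa] at hψ
    exact funext (Fintype.linearIndependent_iff.mp hv ψ hψ)
  have hrange : LinearMap.range T = V := by rw [hT, Fintype.range_linearCombination, hspan]
  have hLC : IsLC (U.map T) := by
    rintro f _ ⟨ψ, hψ, rfl⟩
    refine ⟨Matrix.vecMul ψ (E.map f), hU f ψ hψ, ?_⟩
    rw [hTa, hTa, map_sum]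
    simp only [map_smul, ell_apply, hvE, map_sum, lslice_tmul, Matrix.vecMul, dotProduct,
      Matrix.map_apply, Finset.smul_sum, Finset.sum_smul, smul_smul]
    exact Finset.sum_comm
  by_cases h0 : U.map T = ⊥
  · left
    exact Submodule.map_injective_of_injective hinj (by rw [h0, Submodule.map_bot])
  · right
    have h1 := hV.eq_of_le _ hLC (LinearMap.map_le_range.trans hrange.le) h0
    rw [eq_top_iff]
    intro ψ _
    have h2 : T ψ ∈ U.map T := by
      rw [h1]
      exact hrange.le (LinearMap.mem_range_self T ψ)
    obtain ⟨ψ', h3, h4⟩ := h2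
    rwa [← hinj h4]

end CMat

section Schur

open Coalgebra HopfAlgebra

variable {k H : Type*} [Field k] [Ring H] [HopfAlgebra k H] {n : ℕ}
  {E : Matrix (Fin n) (Fin n) H} {A : Matrix (Fin n) (Fin n) k} {χ : H}

lemma RowIrreducible.det_ne_zero_of_mul (hirr : RowIrreducible (k := k) E) (hA : A ≠ 0)
    (h : ∀ i m, ∑ j, A j m • E i j = ∑ j, A i j • (E j m * χ)) : A.det ≠ 0 := by
  have hf : ∀ f : Module.Dual k H, E.map f * A = A * E.map (f ∘ₗ LinearMap.mulRight k χ) := by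
    intro f
    ext i m
    have h1 := congrArg f (h i m)
    simp only [map_sum, map_smul, smul_eq_mul] at h1
    rw [Matrix.mul_apply, Matrix.mul_apply]
    simpa [mul_comm] using h1
  rcases hirr (LinearMap.ker A.vecMulLinear) (fun f ψ hψ => by
    rw [LinearMap.mem_ker, Matrix.vecMulLinear_apply] at *
    rw [Matrix.vecMul_vecMul, hf, ← Matrix.vecMul_vecMul, hψ, Matrix.zero_vecMul]) with h0 | h0
  · intro hdet
    obtain ⟨ψ, hψ, h1⟩ := Matrix.exists_vecMul_eq_zero_iff.mpr hdet
    have : ψ ∈ LinearMap.ker A.vecMulLinear := h1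
    rw [h0] at this
    exact hψ this
  · exfalso
    apply hA
    ext i j
    have h1 : (Pi.single i 1 : Fin n → k) ∈ LinearMap.ker A.vecMulLinear := by
      rw [h0]; trivial
    rw [LinearMap.mem_ker, Matrix.vecMulLinear_apply] at h1
    simpa using congrFun h1 j

lemma RowIrreducible.det_ne_zero_of_mul' (hirr : RowIrreducible (k := k) E) (hA : A ≠ 0)
    (h : ∀ i m, ∑ j, A i j • E j m = ∑ j, A j m • (E i j * χ)) : A.det ≠ 0 := by
  have hf : ∀ f : Module.Dual k H, A * E.map f = E.map (f ∘ₗ LinearMap.mulRight k χ) * A := by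
    intro f
    ext i m
    have h1 := congrArg f (h i m)
    simp only [map_sum, map_smul, smul_eq_mul] at h1
    rw [Matrix.mul_apply, Matrix.mul_apply]
    simpa [mul_comm] using h1
  rcases hirr (LinearMap.range A.vecMulLinear) (fun f ψ hψ => by
    obtain ⟨φ, rfl⟩ := hψ
    refine ⟨Matrix.vecMul φ (E.map (f ∘ₗ LinearMap.mulRight k χ)), ?_⟩
    rw [Matrix.vecMulLinear_apply, Matrix.vecMulLinear_apply, Matrix.vecMul_vecMul, ← hf,
      Matrix.vecMul_vecMul]) with h0 | h0
  · exfalso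
    apply hA
    ext i j
    have h1 : A.vecMulLinear (Pi.single i 1) ∈ LinearMap.range A.vecMulLinear :=
      LinearMap.mem_range_self _ _
    rw [h0, Submodule.mem_bot, Matrix.vecMulLinear_apply] at h1
    simpa using congrFun h1 j
  · have h1 : Function.Surjective A.vecMul := LinearMap.range_eq_top.mp h0
    rw [Matrix.vecMul_surjective_iff_isUnit, Matrix.isUnit_iff_isUnit_det] at h1
    exact h1.ne_zero

lemma RowIrreducible.eq_smul_one [IsAlgClosed k] [NeZero n] (hirr : RowIrreducible (k := k) E)
    (h : ∀ i m, ∑ j, A j m • E i j = ∑ j, A i j • E j m) : ∃ μ : k, A = μ • 1 := by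
  obtain ⟨μ, hμ⟩ := Module.End.exists_eigenvalue (Matrix.toLin' A)
  refine ⟨μ, ?_⟩
  by_contra hne
  have hB : A - μ • 1 ≠ 0 := sub_ne_zero.mpr hne
  refine hirr.det_ne_zero_of_mul (χ := 1) hB (fun i m => ?_) ?_
  · simp only [Matrix.sub_apply, Matrix.smul_apply, smul_eq_mul, sub_smul, Finset.sum_sub_distrib,
      mul_one, h, Matrix.one_apply]
    simp
  · obtain ⟨ψ, hψ⟩ := hμ.exists_hasEigenvector
    rw [← Matrix.exists_mulVec_eq_zero_iff]
    refine ⟨ψ, hψ.2, ?_⟩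
    have h1 := hψ.apply_eq_smul
    rw [Matrix.toLin'_apply] at h1
    rw [Matrix.sub_mulVec, h1, Matrix.smul_mulVec, Matrix.one_mulVec, sub_self]

namespace IsLinked

variable {ζ : k} {x β : H} {a : H →ₐ[k] H} {d : Module.End k H}

lemma cmat_a_pow (h : IsLinked ζ x β a d) (hE : IsComatrix (k := k) E) :
    cmat E a.toLinearMap ^ 5 = 1 := by
  rw [← hE.cmat_pow h.der.mem, h.der.pow_five, hE.cmat_one]

lemma cmat_comm (h : IsLinked ζ x β a d) (hE : IsComatrix (k := k) E) :
    cmat E a.toLinearMap * cmat E d = ζ • (cmat E d * cmat E a.toLinearMap) := by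
  rw [← hE.cmat_mul h.der.skew.1, h.der.comm, cmat_smul, hE.cmat_mul h.der.mem]

lemma det_cmat_a_ne_zero (h : IsLinked ζ x β a d) (hE : IsComatrix (k := k) E) :
    (cmat E a.toLinearMap).det ≠ 0 := by
  intro h0
  have h1 := congrArg Matrix.det (h.cmat_a_pow hE)
  rw [Matrix.det_pow, h0, Matrix.det_one, zero_pow (by norm_num)] at h1
  exact zero_ne_one h1

lemma eq_one_of_counit_pow (h : IsLinked ζ x β a d) (hn : Nat.Coprime n 5)
    (hχ : IsGroupLikeElem k χ) (h1 : counit (R := k) (a χ) ^ n = 1) : χ = 1 := by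
  obtain ⟨i, rfl⟩ := h.gl_eq χ hχ
  rw [h.a_pow, map_smul, hχ.counit_eq_one, smul_eq_mul, mul_one] at h1
  apply h.eq_one_of_fixed hχ
  have h2 : (ζ ^ i) ^ 5 = 1 := by
    rw [← pow_mul, mul_comm, pow_mul, h.taft.prim.pow_eq_one, one_pow]
  have h3 : ζ ^ i = 1 := by
    rw [← orderOf_eq_one_iff]
    exact Nat.eq_one_of_dvd_coprimes hn (orderOf_dvd_of_pow_eq_one h1) (orderOf_dvd_of_pow_eq_one h2)
  rw [h.a_pow, h3, one_smul]

lemma pow_eq_one_of_mul_eq {Γ : Matrix (Fin n) (Fin n) k} {c : k} (hΓ : Γ.det ≠ 0)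
    (hA : A.det ≠ 0) (h : Γ * A = c • (A * Γ)) : c ^ n = 1 := by
  have h1 := congrArg Matrix.det h
  rw [Matrix.det_smul, Matrix.det_mul, Matrix.det_mul, Fintype.card_fin, mul_comm A.det] at h1
  exact mul_right_cancel₀ (mul_ne_zero hΓ hA) (by rw [← h1, one_mul])

lemma schur [IsAlgClosed k] [NeZero n] (h : IsLinked ζ x β a d) (hn : Nat.Coprime n 5)
    (hE : IsComatrix (k := k) E)
    (hirr : RowIrreducible (k := k) E) (hA : A ≠ 0) (hχ : IsGroupLikeElem k χ)
    (hEA : ∀ i m, ∑ j, A j m • E i j = ∑ j, A i j • (E j m * χ)) :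
    χ = 1 ∧ ∃ μ : k, μ ≠ 0 ∧ A = μ • 1 := by
  have hdet := hirr.det_ne_zero_of_mul hA hEA
  have hχ1 : χ = 1 := by
    refine h.eq_one_of_counit_pow hn hχ
      (pow_eq_one_of_mul_eq (A := A) (h.det_cmat_a_ne_zero hE) hdet ?_)
    ext i m
    have h1 := congrArg (fun z => counit (R := k) (a z)) (hEA i m)
    simp only [map_sum, map_smul, smul_eq_mul, map_mul, Bialgebra.counit_mul] at h1
    simp only [Matrix.smul_apply, Matrix.mul_apply, cmat_apply, AlgHom.toLinearMap_apply,
      smul_eq_mul, Finset.mul_sum]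
    simpa [mul_comm, mul_assoc, mul_left_comm] using h1
  subst hχ1
  simp only [mul_one] at hEA
  obtain ⟨μ, hμ⟩ := hirr.eq_smul_one hEA
  refine ⟨rfl, μ, ?_, hμ⟩
  rintro rfl
  exact hA (by rw [hμ, zero_smul])

lemma schur' [IsAlgClosed k] [NeZero n] (h : IsLinked ζ x β a d) (hn : Nat.Coprime n 5)
    (hE : IsComatrix (k := k) E)
    (hirr : RowIrreducible (k := k) E) (hA : A ≠ 0) (hχ : IsGroupLikeElem k χ)
    (hAE : ∀ i m, ∑ j, A i j • E j m = ∑ j, A j m • (E i j * χ)) :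
    χ = 1 ∧ ∃ μ : k, μ ≠ 0 ∧ A = μ • 1 := by
  have hdet := hirr.det_ne_zero_of_mul' hA hAE
  have hχ1 : χ = 1 := by
    refine h.eq_one_of_counit_pow hn hχ
      (pow_eq_one_of_mul_eq (A := cmat E a.toLinearMap) hdet (h.det_cmat_a_ne_zero hE) ?_)
    ext i m
    have h1 := congrArg (fun z => counit (R := k) (a z)) (hAE i m)
    simp only [map_sum, map_smul, smul_eq_mul, map_mul, Bialgebra.counit_mul] at h1
    simp only [Matrix.smul_apply, Matrix.mul_apply, cmat_apply, AlgHom.toLinearMap_apply,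
      smul_eq_mul, Finset.mul_sum]
    simpa [mul_comm, mul_assoc, mul_left_comm] using h1
  subst hχ1
  simp only [mul_one] at hAE
  obtain ⟨μ, hμ⟩ := hirr.eq_smul_one fun i m => (hAE i m).symm
  refine ⟨rfl, μ, ?_, hμ⟩
  rintro rfl
  exact hA (by rw [hμ, zero_smul])

end IsLinked

end Schur

section BlockFour

variable {k : Type*} [Field k] [CharZero k]

lemma false_of_block_four {ζ : k} (hζ : IsPrimitiveRoot ζ 5) {Γ Ξ J : Matrix (Fin 4) (Fin 4) k}
    (hΓ : Γ ^ 5 = 1) (hcomm : Γ * Ξ = ζ • (Ξ * Γ)) (hΞ : Ξ ^ 5 = 0) {e : Fin 4 → k}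
    (hΓe : Γ.mulVec e = e)
    (hker : ∀ (φ : Fin 4 → k) (c : k), c ^ 5 = 1 → Ξ.mulVec φ = 0 → Γ.mulVec φ = c • φ →
      φ ∈ Submodule.span k {e})
    (hJΓ : Γ * J * Γ.transpose = J) (hJΞ : Γ * J * Ξ.transpose + Ξ * J = 0)
    (hJ : ∀ ψ, J.mulVec ψ = 0 → ψ = 0) : False := by
  have hroot : ∀ j : ℕ, (ζ ^ j) ^ 5 = 1 := fun j => by
    rw [← pow_mul, mul_comm, pow_mul, hζ.pow_eq_one, one_pow]
  set N := Matrix.toLin' Ξ with hN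
  set Φ := Matrix.toLin' Γ with hΦ
  have hΦ5 : Φ ^ 5 = 1 := by rw [hΦ, ← Matrix.toLin'_pow, hΓ]; exact Matrix.toLin'_one
  have hNΦ : ∀ w, Φ (N w) = ζ • N (Φ w) := by
    intro w
    simp only [hN, hΦ, Matrix.toLin'_apply, Matrix.mulVec_mulVec, hcomm, Matrix.smul_mulVec]
  have hkerN : ∀ w, N w = 0 → w ∈ Submodule.span k {e} := by
    intro w hw
    by_contra hwe
    obtain ⟨j, -, y, hy, hye, hyΦ⟩ := exists_eigenvector hΦ5 hζ (P := LinearMap.ker N)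
      (Q := Submodule.span k {e}) (fun u hu => by
        rw [LinearMap.mem_ker] at hu ⊢
        have h1 := hNΦ u
        rw [hu, map_zero] at h1
        exact (smul_eq_zero.mp h1.symm).resolve_left (hζ.ne_zero (by norm_num))) hw hwe
    exact hye (hker y (ζ ^ j) (hroot j) hy hyΦ)
  have hkerN1 : Module.finrank k (LinearMap.ker N) ≤ 1 :=
    (Submodule.finrank_mono hkerN).trans ((finrank_span_le_card ({e} : Set (Fin 4 → k))).trans
      (by rw [Set.toFinset_singleton, Finset.card_singleton]))
  have hN4 : N ^ 4 = 0 := by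
    have h1 := Module.End.ker_pow_eq_ker_pow_finrank_of_le (f := N) (m := 5) (by simp)
    rw [Module.finrank_fin_fun] at h1
    rw [← LinearMap.ker_eq_top, ← h1, LinearMap.ker_eq_top, hN, ← Matrix.toLin'_pow, hΞ, map_zero]
  have hrank : ∀ j, Module.finrank k (LinearMap.range (N ^ j)) ≤
      Module.finrank k (LinearMap.range (N ^ (j + 1))) + 1 := by
    intro j
    have h1 := finrank_map_add_finrank_inf_ker N (LinearMap.range (N ^ j))
    rw [← LinearMap.range_comp] at h1
    have h2 := Submodule.finrank_mono (inf_le_right : LinearMap.range (N ^ j) ⊓ LinearMap.ker N ≤ _)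
    rw [pow_succ', Module.End.mul_eq_comp]
    omega
  have hr0 : Module.finrank k (LinearMap.range (N ^ 0)) = 4 := by
    rw [pow_zero, Module.End.one_eq_id, LinearMap.range_id, finrank_top, Module.finrank_fin_fun]
  have hr1 := hrank 0
  have hr2 := hrank 1
  have hr3 := hrank 2
  have hN3 : N ^ 3 ≠ 0 := by
    intro h0
    rw [show 2 + 1 = 3 from rfl, h0, LinearMap.range_zero, finrank_bot] at hr3
    simp only [zero_add, Nat.reduceAdd] at hr1 hr2 hr3
    omega
  obtain ⟨w₀, hw₀⟩ : ∃ w, w ∉ LinearMap.ker (N ^ 3) := by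
    by_contra hcon
    push Not at hcon
    exact hN3 (LinearMap.ext fun w => hcon w)
  obtain ⟨j, -, w, -, hw, hwΦ⟩ := exists_eigenvector hΦ5 hζ (P := ⊤) (Q := LinearMap.ker (N ^ 3))
    (fun _ _ => trivial) (x := w₀) trivial hw₀
  have hpow : Φ ((N ^ 3) w) = (ζ ^ 3 * ζ ^ j) • (N ^ 3) w := by
    have h1 : (N ^ 3) w = N (N (N w)) := rfl
    rw [h1, hNΦ, hNΦ, hNΦ, hwΦ]
    simp only [map_smul, smul_smul]
    congr 1
    ring
  have hΦe : ∀ u ∈ Submodule.span k {e}, Φ u = u := by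
    intro u hu
    obtain ⟨c, rfl⟩ := Submodule.mem_span_singleton.mp hu
    rw [map_smul, hΦ, Matrix.toLin'_apply, hΓe]
  have hw1 : ζ ^ 3 * ζ ^ j = 1 := by
    have h1 : N ((N ^ 3) w) = 0 := by
      rw [← Module.End.mul_apply, ← pow_succ', hN4, LinearMap.zero_apply]
    have h2 := hΦe _ (hkerN _ h1)
    rw [hpow] at h2
    have h3 : (ζ ^ 3 * ζ ^ j - 1) • (N ^ 3) w = 0 := by rw [sub_smul, h2, one_smul, sub_self]
    exact sub_eq_zero.mp ((smul_eq_zero.mp h3).resolve_right hw)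
  have hζj : ζ ^ j ≠ 1 := by
    intro h0
    rw [h0, mul_one] at hw1
    exact absurd (hζ.dvd_of_pow_eq_one 3 hw1) (by norm_num)
  have hdet : Ξ.det = 0 := by
    have h1 := congrArg Matrix.det hΞ
    rw [Matrix.det_pow, Matrix.det_zero] at h1
    exact pow_eq_zero_iff (by norm_num) |>.mp h1
  obtain ⟨ψ₀, hψ₀, hψ₀Ξ⟩ := Matrix.exists_mulVec_eq_zero_iff.mpr
    (show Ξ.transpose.det = 0 by rw [Matrix.det_transpose, hdet])
  obtain ⟨i, -, ψ, hψ, hψ0, hψΦ⟩ := exists_eigenvector (Φ := Matrix.toLin' Γ.transpose)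
    (by rw [← Matrix.toLin'_pow, ← Matrix.transpose_pow, hΓ, Matrix.transpose_one,
      Matrix.toLin'_one]; rfl) hζ
    (P := LinearMap.ker (Matrix.toLin' Ξ.transpose)) (Q := ⊥) (fun u hu => by
      rw [LinearMap.mem_ker, Matrix.toLin'_apply] at *
      rw [Matrix.toLin'_apply, Matrix.mulVec_mulVec, ← Matrix.transpose_mul, hcomm,
        Matrix.transpose_smul, Matrix.transpose_mul, Matrix.smul_mulVec, ← Matrix.mulVec_mulVec,
        hu, Matrix.mulVec_zero, smul_zero]) (x := ψ₀) hψ₀Ξ hψ₀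
  rw [LinearMap.mem_ker, Matrix.toLin'_apply] at hψ
  rw [Matrix.toLin'_apply] at hψΦ
  have hJψ : J.mulVec ψ ≠ 0 := fun h0 => hψ0 (hJ ψ h0)
  have hJψe : J.mulVec ψ ∈ Submodule.span k {e} := by
    apply hkerN
    have h1 := congrArg (fun M => Matrix.mulVec M ψ) hJΞ
    simp only [Matrix.add_mulVec, Matrix.zero_mulVec] at h1
    rw [← Matrix.mulVec_mulVec, hψ, Matrix.mulVec_zero, zero_add, ← Matrix.mulVec_mulVec] at h1
    exact h1
  have hζi : ζ ^ i = 1 := by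
    have h1 := congrArg (fun M => Matrix.mulVec M ψ) hJΓ
    have h2 := hΦe _ hJψe
    rw [hΦ, Matrix.toLin'_apply] at h2
    rw [← Matrix.mulVec_mulVec, hψΦ, Matrix.mulVec_smul, ← Matrix.mulVec_mulVec, h2] at h1
    have h3 : (ζ ^ i - 1) • J.mulVec ψ = 0 := by rw [sub_smul, h1, one_smul, sub_self]
    exact sub_eq_zero.mp ((smul_eq_zero.mp h3).resolve_right hJψ)
  rw [hζi, one_smul] at hψΦ
  set g : Module.Dual k (Fin 4 → k) := dotProductBilin k k ψ with hg
  have hga : ∀ u, g u = ψ ⬝ᵥ u := fun u => rfl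
  have hgw : g w = 0 := by
    have h1 : g (Φ w) = g w := by
      rw [hga, hga, hΦ, Matrix.toLin'_apply, Matrix.dotProduct_mulVec, ← Matrix.mulVec_transpose,
        hψΦ]
    rw [hwΦ, map_smul, smul_eq_mul] at h1
    have h2 : (ζ ^ j - 1) * g w = 0 := by rw [sub_mul, h1, one_mul, sub_self]
    exact (mul_eq_zero.mp h2).resolve_left (sub_ne_zero.mpr hζj)
  have hle : LinearMap.range N ≤ LinearMap.ker g := by
    rintro _ ⟨u, rfl⟩
    rw [LinearMap.mem_ker, hga, hN, Matrix.toLin'_apply, Matrix.dotProduct_mulVec,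
      ← Matrix.mulVec_transpose, hψ, zero_dotProduct]
  have hg0 : g ≠ 0 := by
    intro h0
    apply hψ0
    rw [Submodule.mem_bot]
    funext l
    have h1 := LinearMap.congr_fun h0 (Pi.single l 1)
    rw [hga] at h1
    simpa using h1
  have hlt : LinearMap.ker g < ⊤ := lt_top_iff_ne_top.mpr fun h0 => hg0 (LinearMap.ker_eq_top.mp h0)
  have h4 := Submodule.finrank_lt_finrank_of_lt hlt
  rw [finrank_top, Module.finrank_fin_fun] at h4
  have heq : LinearMap.range N = LinearMap.ker g := by
    apply Submodule.eq_of_le_of_finrank_le hle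
    rw [zero_add, pow_one] at hr1
    omega
  have hwN : w ∈ LinearMap.range N := by rw [heq]; exact hgw
  obtain ⟨u, rfl⟩ := hwN
  apply hw
  rw [LinearMap.mem_ker, ← Module.End.mul_apply, ← pow_succ, hN4, LinearMap.zero_apply]

end BlockFour

section LargeSimple

open Coalgebra HopfAlgebra

variable {k H : Type*} [Field k] [Ring H] [HopfAlgebra k H]

lemma isLC_one_sup {V : Submodule k H} (hV : IsLC V) : IsLC (Submodule.span k {(1 : H)} ⊔ V) :=
  (isLC_span_grouplike .one).sup hV

lemma IsLinked.one_sup_le {ζ : k} {x β : H} {a : H →ₐ[k] H} {d : Module.End k H}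
    (h : IsLinked ζ x β a d) {V : Submodule k H} (hVR : V ≤ coinv a d) :
    Submodule.span k {(1 : H)} ⊔ V ≤ coinv a d :=
  sup_le ((Submodule.span_singleton_le_iff_mem _ _).mpr h.der.one_mem_coinv) hVR

variable [FiniteDimensional k H] [Nontrivial H]

lemma finrank_one_sup {V : Submodule k H} (h1 : (1 : H) ∉ V) :
    Module.finrank k (Submodule.span k {(1 : H)} ⊔ V : Submodule k H) = Module.finrank k V + 1 := by
  have h2 := Submodule.finrank_sup_add_finrank_inf_eq (Submodule.span k {(1 : H)}) V
  rw [((Submodule.disjoint_span_singleton' one_ne_zero).mpr h1).symm.eq_bot, finrank_bot,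
    finrank_span_singleton one_ne_zero] at h2
  omega

namespace IsLinked

variable [CharZero k] {ζ : k} {x β : H} {a : H →ₐ[k] H} {d : Module.End k H}

lemma finrank_simple_le (h : IsLinked ζ x β a d) {V : Submodule k H} (hVR : V ≤ coinv a d)
    (hV : IsSimpleLC V) (hV2 : 2 ≤ Module.finrank k V) : Module.finrank k V ≤ 4 := by
  have h1 := Submodule.finrank_mono (h.one_sup_le hVR)
  rw [finrank_one_sup (hV.grouplike_notMem hV2 .one), h.finrank_coinv] at h1
  omega

lemma false_of_finrank_three (h : IsLinked ζ x β a d) {V : Submodule k H} (hVR : V ≤ coinv a d)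
    (hV : IsSimpleLC V) (hV3 : Module.finrank k V = 3) : False := by
  have hV2 : 2 ≤ Module.finrank k V := by omega
  exact h.false_of_flag hVR hV hV2 hV.isLC (isLC_one_sup hV.isLC) le_sup_right (h.one_sup_le hVR)
    hV3 (by rw [finrank_one_sup (hV.grouplike_notMem hV2 .one), hV3])

lemma false_of_finrank_four [IsAlgClosed k] (h : IsLinked ζ x β a d) {V : Submodule k H}
    (hVR : V ≤ coinv a d) (hV : IsSimpleLC V) (hV4 : Module.finrank k V = 4) : False := by
  have h1V := hV.grouplike_notMem (by omega) (IsGroupLikeElem.one (R := k) (A := H))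
  obtain ⟨f, hf, hfV⟩ := exists_dual_ne_zero_of_notMem h1V
  set lam : Module.Dual k H := (f 1)⁻¹ • f with hlam
  have hlam1 : lam 1 = 1 := by rw [hlam, LinearMap.smul_apply, smul_eq_mul, inv_mul_cancel₀ hf]
  have hlamV : ∀ w ∈ V, lam w = 0 := fun w hw => by
    rw [hlam, LinearMap.smul_apply, hfV w hw, smul_zero]
  have hsup : Submodule.span k {(1 : H)} ⊔ V = coinv a d := by
    apply Submodule.eq_of_le_of_finrank_eq (h.one_sup_le hVR)
    rw [finrank_one_sup h1V, hV4, h.finrank_coinv]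
  have hdec : ∀ r ∈ coinv a d, ∃ w ∈ V, r = lam r • 1 + w := by
    intro r hr
    rw [← hsup, Submodule.mem_sup] at hr
    obtain ⟨z, hz, w, hw, rfl⟩ := hr
    obtain ⟨c, rfl⟩ := Submodule.mem_span_singleton.mp hz
    refine ⟨w, hw, ?_⟩
    rw [map_add, map_smul, hlam1, hlamV w hw, add_zero, smul_eq_mul, mul_one]
  have hrho : ∀ r ∈ coinv a d, rho lam r = lam r • (1 : H) := by
    intro r hr
    obtain ⟨w, hw, hrw⟩ := hdec r hr
    have h2 : rho lam w = 0 := by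
      refine eq_zero_of_dual (k := k) fun g => ?_
      rw [rho_apply, ← apply_lslice, ← ell_apply]
      exact hlamV _ (hV.isLC g w hw)
    have h3 : rho lam (1 : H) = 1 := by
      rw [rho_apply, Bialgebra.comul_one, Algebra.TensorProduct.one_def, rslice_tmul, hlam1,
        one_smul]
    conv_lhs => rw [hrw]
    rw [map_add, map_smul, h2, h3, add_zero]
  have hperp := h.perp_self_eq_bot hrho ⟨1, h.der.one_mem_coinv, by rw [hlam1]; exact one_ne_zero⟩
  obtain ⟨v, hv, hspan, E, hE, hvE, hvc, hirr⟩ := hV.exists_comatrix hV4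
  have hvV : ∀ i, v i ∈ V := fun i => by
    rw [← hspan]
    exact Submodule.subset_span ⟨i, rfl⟩
  have hvR : ∀ i, v i ∈ coinv a d := fun i => hVR (hvV i)
  set Γ := cmat E a.toLinearMap with hΓ
  set Ξ := cmat E d with hΞ
  set J : Matrix (Fin 4) (Fin 4) k := fun i j => lam (v i * v j) with hJ
  set e : Fin 4 → k := fun i => counit (R := k) (v i) with he
  have hJ1 : ∀ i l, ∑ j, ∑ m, J j m • (E i j * E l m) = J i l • (1 : H) := by
    intro i l
    have h2 := hrho _ (h.der.mul_mem_coinv (hvR i) (hvR l))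
    rw [rho_apply, Bialgebra.comul_mul, hvE, hvE, Finset.sum_mul_sum, map_sum] at h2
    rw [hJ, ← h2]
    refine Finset.sum_congr rfl fun j _ => ?_
    rw [map_sum]
    refine Finset.sum_congr rfl fun m _ => ?_
    rw [Algebra.TensorProduct.tmul_mul_tmul, rslice_tmul]
  refine false_of_block_four h.taft.prim (h.cmat_a_pow hE) (h.cmat_comm hE) (Γ := Γ) (Ξ := Ξ)
    (J := J) (e := e) ?_ ?_ ?_ ?_ ?_ ?_
  · rw [hΞ, ← hE.cmat_pow h.der.skew.1, h.der.nil]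
    ext i j
    rw [cmat_apply, LinearMap.zero_apply, map_zero, Matrix.zero_apply]
  · funext i
    have h2 := congrArg (counit (R := k)) ((mem_coinv.mp (hvR i)).2)
    rw [hvc i, map_sum, map_sum] at h2
    rw [Matrix.mulVec, dotProduct]
    simp only [he]
    conv_rhs => rw [hvc i, ← h2]
    refine Finset.sum_congr rfl fun j _ => ?_
    rw [map_smul, map_smul, smul_eq_mul, mul_comm]
    rfl
  · intro φ c hc hΞφ hΓφ
    by_cases hφ0 : φ = 0
    · rw [hφ0]; exact zero_mem _
    have hF : ∀ i, d (∑ j, φ j • E i j) = 0 := by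
      intro i
      simp only [map_sum, map_smul, hE.RI_apply h.der.skew.1, Finset.smul_sum, smul_smul]
      rw [Finset.sum_comm]
      simp only [← Finset.sum_smul]
      refine Finset.sum_eq_zero fun l _ => ?_
      have h2 := congrFun hΞφ l
      rw [Matrix.mulVec, dotProduct, Pi.zero_apply] at h2
      have h4 : ∑ j, φ j * cmat E d l j = 0 := by
        rw [← h2]
        exact Finset.sum_congr rfl fun j _ => mul_comm _ _
      rw [h4, zero_smul]
    have haF : ∀ i, a (∑ j, φ j • E i j) = c • ∑ j, φ j • E i j := by
      intro i
      have h3 := fun i j => hE.RI_apply h.der.mem i j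
      simp only [AlgHom.toLinearMap_apply] at h3
      simp only [map_sum, map_smul, h3, Finset.smul_sum, smul_smul]
      rw [Finset.sum_comm]
      simp only [← Finset.sum_smul]
      refine Finset.sum_congr rfl fun l _ => ?_
      have h2 := congrFun hΓφ l
      rw [Matrix.mulVec, dotProduct, Pi.smul_apply, smul_eq_mul] at h2
      rw [← h2]
      congr 1
      exact Finset.sum_congr rfl fun j _ => mul_comm _ _
    obtain ⟨s, hs, rfl⟩ := h.taft.prim.eq_pow_of_pow_eq_one hc
    have hG : ∀ i, (∑ j, φ j • E i j) * β ^ (5 - s) ∈ coinv a d := fun i =>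
      (h.mul_pow_mem_coinv (hF i) hs (haF i)).1
    have hEβ : β ^ (5 - s) * β ^ s = 1 := by
      rw [← pow_add, show 5 - s + s = 5 by omega, h.taft.pow_five]
    set G : Fin 4 → H := fun i => (∑ j, φ j • E i j) * β ^ (5 - s) with hGdef
    have hGΔ : ∀ i, comul (R := k) (G i) = ∑ l, (E i l * β ^ (5 - s)) ⊗ₜ[k] G l := by
      intro i
      simp only [hGdef, Bialgebra.comul_mul, map_sum, map_smul, hE.comul_eq,
        (h.taft.gl.pow (n := 5 - s)).comul_eq_tmul_self, Finset.smul_sum, Finset.sum_mul,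
        smul_mul_assoc, Algebra.TensorProduct.tmul_mul_tmul, TensorProduct.tmul_sum,
        TensorProduct.tmul_smul]
      exact Finset.sum_comm
    have hlamG : ∀ i, lam (G i) = 0 := by
      have h2 : ∀ i, ∑ l, lam (G l) • (E i l * β ^ (5 - s)) = lam (G i) • 1 := by
        intro i
        have h3 := hrho _ (hG i)
        rw [rho_apply, hGΔ, map_sum] at h3
        simpa only [rslice_tmul] using h3
      have h4 : ∀ i, ∑ l, lam (G l) • E i l = lam (G i) • β ^ s := by
        intro i
        have h3 := congrArg (fun z => z * β ^ s) (h2 i)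
        simpa only [Finset.sum_mul, smul_mul_assoc, mul_assoc, hEβ, mul_one, one_mul] using h3
      rcases hirr (LinearMap.ker (dotProductBilin k k (fun i => lam (G i))))
        (fun g ψ hψ => by
          rw [LinearMap.mem_ker] at hψ ⊢
          change (fun i => lam (G i)) ⬝ᵥ ψ = 0 at hψ
          change (fun i => lam (G i)) ⬝ᵥ Matrix.vecMul ψ (E.map g) = 0
          rw [dotProduct_comm, ← Matrix.dotProduct_mulVec]
          have h5 : (E.map g).mulVec (fun i => lam (G i)) = g (β ^ s) • fun i => lam (G i) := by
            funext i
            have h6 := congrArg g (h4 i)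
            rw [map_sum, map_smul, smul_eq_mul, mul_comm] at h6
            rw [Matrix.mulVec, dotProduct, Pi.smul_apply, smul_eq_mul, ← h6]
            refine Finset.sum_congr rfl fun l _ => ?_
            rw [map_smul, smul_eq_mul, mul_comm, Matrix.map_apply]
          rw [h5, dotProduct_smul, dotProduct_comm, hψ, smul_zero]) with h0 | h0
      · exfalso
        have h5 := LinearMap.finrank_range_add_finrank_ker
          (dotProductBilin k k (fun i => lam (G i)))
        have h6 := Submodule.finrank_le (LinearMap.range (dotProductBilin k k (fun i => lam (G i))))
        rw [h0, finrank_bot, Module.finrank_fin_fun] at h5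
        rw [Module.finrank_self] at h6
        omega
      · intro i
        have h5 : (Pi.single i 1 : Fin 4 → k) ∈
            LinearMap.ker (dotProductBilin k k (fun i => lam (G i))) := by rw [h0]; trivial
        rw [LinearMap.mem_ker] at h5
        change (fun i => lam (G i)) ⬝ᵥ Pi.single i 1 = 0 at h5
        simpa using h5
    have hGV : ∀ i, ∃ A : Fin 4 → k, ∑ j, A j • v j = G i := by
      intro i
      obtain ⟨w, hw, hGw⟩ := hdec _ (hG i)
      rw [hlamG, zero_smul, zero_add] at hGw
      rw [show G i = w from hGw]
      rw [← hspan] at hw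
      exact (Submodule.mem_span_range_iff_exists_fun k).mp hw
    choose A hA using hGV
    have hEA : ∀ i m, ∑ j, A j m • (E i j * β ^ (5 - s)) = ∑ j, A i j • E j m := by
      intro i m
      obtain ⟨g, hg⟩ := exists_dual_of_linearIndependent hv (Pi.single m 1)
      have h2 := congrArg (rslice g) (hGΔ i)
      rw [← hA i, map_sum, map_sum, map_sum] at h2
      simp only [map_smul, hvE, map_sum, rslice_tmul, hg, ← hA, smul_eq_mul] at h2
      simpa [Pi.single_apply] using h2.symm
    have hA0 : Matrix.of A ≠ 0 := by
      intro h0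
      apply hφ0
      funext i
      have h2 : G i = 0 := by
        rw [← hA i]
        refine Finset.sum_eq_zero fun j _ => ?_
        rw [show A i j = 0 from congrFun (congrFun h0 i) j, zero_smul]
      have h3 := congrArg (counit (R := k)) h2
      rw [Bialgebra.counit_mul, h.taft.gl.pow.counit_eq_one, mul_one, map_sum, map_zero] at h3
      simpa [hE.counit_eq] using h3
    obtain ⟨hχ, μ, hμ0, hμ⟩ := h.schur (A := Matrix.of A) (by norm_num) hE hirr hA0
      (h.taft.gl.pow (n := s)) (fun i m => by
        have h2 := congrArg (fun z => z * β ^ s) (hEA i m)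
        simpa only [Finset.sum_mul, smul_mul_assoc, mul_assoc, hEβ, mul_one, Matrix.of_apply] using h2)
    rw [Submodule.mem_span_singleton]
    refine ⟨μ, ?_⟩
    funext i
    have h2 := congrArg (counit (R := k)) (hA i)
    have h3 : ∀ j, A i j = (μ • (1 : Matrix (Fin 4) (Fin 4) k)) i j := fun j =>
      congrFun (congrFun hμ i) j
    rw [Bialgebra.counit_mul, h.taft.gl.pow.counit_eq_one, mul_one, map_sum, map_sum] at h2
    simp only [map_smul, h3, Matrix.smul_apply, Matrix.one_apply, hE.counit_eq] at h2
    simpa [he] using h2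
  · ext i l
    have h2 := congrArg (fun z => counit (R := k) (a z)) (hJ1 i l)
    simp only [map_sum, map_smul, map_mul, map_one, Bialgebra.counit_mul, Bialgebra.counit_one,
      smul_eq_mul, mul_one] at h2
    rw [← h2, Matrix.mul_apply]
    simp only [Matrix.mul_apply, Matrix.transpose_apply, Finset.sum_mul]
    rw [Finset.sum_comm]
    refine Finset.sum_congr rfl fun j _ => Finset.sum_congr rfl fun m _ => ?_
    rw [hΓ, cmat_apply, cmat_apply, AlgHom.toLinearMap_apply, AlgHom.toLinearMap_apply]
    ring
  · ext i l
    have h2 := congrArg (fun z => counit (R := k) (d z)) (hJ1 i l)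
    simp only [map_sum, map_smul, h.der.skew.2, h.der.d_one, map_add, map_zero, Bialgebra.counit_mul,
      smul_eq_mul, mul_zero, hE.counit_eq] at h2
    rw [Matrix.zero_apply, ← h2, Matrix.add_apply, Matrix.mul_apply, Matrix.mul_apply]
    simp only [Matrix.mul_apply, Matrix.transpose_apply, Finset.sum_mul, mul_add,
      Finset.sum_add_distrib]
    congr 1
    · rw [Finset.sum_comm]
      refine Finset.sum_congr rfl fun j _ => Finset.sum_congr rfl fun m _ => ?_
      rw [hΓ, hΞ, cmat_apply, cmat_apply, AlgHom.toLinearMap_apply]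
      ring
    · simp [hΞ, cmat_apply, mul_comm]
  · intro ψ hψ
    have h2 : ∑ j, ψ j • v j ∈ perp (coinv a d) lam (coinv a d) := by
      refine ⟨Submodule.sum_mem _ fun j _ => Submodule.smul_mem _ _ (hvR j), fun u hu => ?_⟩
      obtain ⟨w, hw, huw⟩ := hdec u hu
      rw [huw, add_mul, map_add, smul_mul_assoc, one_mul, map_smul, hlamV (∑ j, ψ j • v j)
        (Submodule.sum_mem _ fun j _ => Submodule.smul_mem _ _ (hvV j)), smul_zero, zero_add]
      clear huw
      rw [← hspan] at hw
      induction hw using Submodule.span_induction with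
      | mem u hu =>
        obtain ⟨i, rfl⟩ := hu
        have h3 := congrFun hψ i
        rw [Matrix.mulVec, dotProduct, Pi.zero_apply] at h3
        rw [Finset.mul_sum, map_sum, ← h3]
        refine Finset.sum_congr rfl fun j _ => ?_
        rw [mul_smul_comm, map_smul, smul_eq_mul, mul_comm]
      | zero => rw [zero_mul, map_zero]
      | add u v _ _ hu hv => rw [add_mul, map_add, hu, hv, add_zero]
      | smul c u _ hu => rw [smul_mul_assoc, map_smul, hu, smul_zero]
    rw [hperp, Submodule.mem_bot] at h2
    exact funext (Fintype.linearIndependent_iff.mp hv ψ h2)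

end IsLinked

end LargeSimple

section StableSubspaces

open Coalgebra HopfAlgebra

variable {k H ι : Type*} [Field k] [Ring H] [HopfAlgebra k H] [Fintype ι]

/-- A space of row vectors is stable under all scalar images of the matrix `Y`. -/
def RowStable (Y : Matrix ι ι H) (K : Submodule k (ι → k)) : Prop :=
  ∀ f : Module.Dual k H, ∀ c ∈ K, Matrix.vecMul c (Y.map f) ∈ K

namespace RowStable

variable {Y : Matrix ι ι H}

lemma inf {K L : Submodule k (ι → k)} (hK : RowStable Y K) (hL : RowStable Y L) :
    RowStable Y (K ⊓ L) := fun f c hc => ⟨hK f c hc.1, hL f c hc.2⟩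

lemma of_mul {u v : H} (huv : u * v = 1) {K : Submodule k (ι → k)}
    (hK : RowStable (fun I J => Y I J * u) K) : RowStable Y K := by
  intro f c hc
  have h1 := hK (f ∘ₗ LinearMap.mulRight k v) c hc
  convert h1 using 2
  ext I J
  change f (Y I J) = f (Y I J * u * v)
  rw [mul_assoc, huv, mul_one]

lemma exists_isGroupLikeElem_of_line [DecidableEq ι] (hY : IsComatrix (k := k) Y) {c : ι → k}
    (hc : c ≠ 0) (hK : RowStable Y (Submodule.span k {c})) :
    ∃ χ : H, IsGroupLikeElem k χ ∧ ∀ J, ∑ I, c I • Y I J = c J • χ := by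
  obtain ⟨J₀, hJ₀⟩ := Function.ne_iff.mp hc
  rw [Pi.zero_apply] at hJ₀
  set χ := (c J₀)⁻¹ • ∑ I, c I • Y I J₀ with hχ
  have h1 : ∀ J, ∑ I, c I • Y I J = c J • χ := by
    intro J
    refine eq_of_dual (k := k) fun f => ?_
    obtain ⟨t, ht⟩ := Submodule.mem_span_singleton.mp (hK f c (Submodule.mem_span_singleton_self c))
    have h2 : ∀ J, f (∑ I, c I • Y I J) = t * c J := by
      intro J
      have h3 := congrFun ht J
      rw [Pi.smul_apply, smul_eq_mul, Matrix.vecMul, dotProduct] at h3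
      rw [h3, map_sum]
      refine Finset.sum_congr rfl fun I _ => ?_
      rw [map_smul, smul_eq_mul, Matrix.map_apply]
    rw [hχ, map_smul, map_smul, h2, h2, smul_eq_mul, smul_eq_mul]
    field_simp
  refine ⟨χ, ⟨?_, ?_⟩, h1⟩
  · rw [hχ, map_smul, map_sum]
    simp [hY.counit_eq, hJ₀]
  · have h2 : comul (R := k) (∑ I, c I • Y I J₀) = χ ⊗ₜ[k] ∑ I, c I • Y I J₀ := by
      simp only [map_sum, map_smul, hY.comul_eq, Finset.smul_sum]
      rw [Finset.sum_comm]
      rw [TensorProduct.tmul_sum]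
      refine Finset.sum_congr rfl fun L _ => ?_
      rw [TensorProduct.tmul_smul, TensorProduct.smul_tmul', ← h1 L, TensorProduct.sum_tmul]
      rfl
    rw [hχ, map_smul, h2, ← TensorProduct.tmul_smul]

lemma exists_isGroupLikeElem_of_hyperplane [DecidableEq ι] (hY : IsComatrix (k := k) Y) {N : ι → k}
    (hN : N ≠ 0) (hK : RowStable Y (LinearMap.ker (dotProductBilin k k N))) :
    ∃ χ : H, IsGroupLikeElem k χ ∧ ∀ I, ∑ J, N J • Y I J = N I • χ := by
  obtain ⟨I₀, hI₀⟩ := Function.ne_iff.mp hN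
  rw [Pi.zero_apply] at hI₀
  set χ := (N I₀)⁻¹ • ∑ J, N J • Y I₀ J with hχ
  have h1 : ∀ I, ∑ J, N J • Y I J = N I • χ := by
    intro I
    refine eq_of_dual (k := k) fun f => ?_
    have h2 := hK f (N I₀ • Pi.single I 1 - N I • Pi.single I₀ 1) (by
      rw [LinearMap.mem_ker, map_sub, map_smul, map_smul]
      change N I₀ • (N ⬝ᵥ Pi.single I 1) - N I • (N ⬝ᵥ Pi.single I₀ 1) = 0
      simp [mul_comm])
    rw [LinearMap.mem_ker] at h2
    change N ⬝ᵥ Matrix.vecMul _ (Y.map f) = 0 at h2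
    rw [Matrix.sub_vecMul, Matrix.smul_vecMul, Matrix.smul_vecMul, dotProduct_sub, dotProduct_smul,
      dotProduct_smul] at h2
    simp only [Matrix.single_one_vecMul, smul_eq_mul, dotProduct, Matrix.row, Matrix.map_apply] at h2
    rw [hχ]
    simp only [map_smul, map_sum, smul_eq_mul]
    field_simp
    linear_combination h2
  refine ⟨χ, ⟨?_, ?_⟩, h1⟩
  · rw [hχ, map_smul, map_sum]
    simp [hY.counit_eq, hI₀]
  · have h2 : comul (R := k) (∑ J, N J • Y I₀ J) = (∑ J, N J • Y I₀ J) ⊗ₜ[k] χ := by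
      simp only [map_sum, map_smul, hY.comul_eq, Finset.smul_sum]
      rw [Finset.sum_comm, TensorProduct.sum_tmul]
      refine Finset.sum_congr rfl fun L _ => ?_
      rw [← TensorProduct.smul_tmul', ← TensorProduct.tmul_smul, ← h1 L, TensorProduct.tmul_sum]
      refine Finset.sum_congr rfl fun J _ => ?_
      rw [TensorProduct.tmul_smul]
    rw [hχ, map_smul, h2, TensorProduct.smul_tmul']

lemma ell_linearCombination {F : ι → H} (hF : ∀ I, comul (R := k) (F I) = ∑ L, Y I L ⊗ₜ[k] F L)
    (f : Module.Dual k H) (c : ι → k) : ell k H f (Fintype.linearCombination k F c) =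
      Fintype.linearCombination k F (Matrix.vecMul c (Y.map f)) := by
  simp only [Fintype.linearCombination_apply, map_sum, map_smul, ell_apply, hF, lslice_tmul,
    Matrix.vecMul, dotProduct, Finset.sum_smul, Finset.smul_sum, smul_smul, Matrix.map_apply]
  exact Finset.sum_comm

lemma comap {F : ι → H} (hF : ∀ I, comul (R := k) (F I) = ∑ L, Y I L ⊗ₜ[k] F L)
    {W : Submodule k H} (hW : IsLC W) :
    RowStable Y (W.comap (Fintype.linearCombination k F)) := by
  intro f c hc
  rw [Submodule.mem_comap] at hc ⊢
  rw [← ell_linearCombination hF]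
  exact hW f _ hc

lemma isLC_range {F : ι → H} (hF : ∀ I, comul (R := k) (F I) = ∑ L, Y I L ⊗ₜ[k] F L) :
    IsLC (LinearMap.range (Fintype.linearCombination k F)) := by
  rintro f _ ⟨c, rfl⟩
  exact ⟨_, (ell_linearCombination hF f c).symm⟩

end RowStable

end StableSubspaces

section Conjugation

open Coalgebra HopfAlgebra

variable {k H : Type*} [Field k] [Ring H] [HopfAlgebra k H] {n : ℕ} {E : Matrix (Fin n) (Fin n) H}

lemma IsComatrix.comul_antipode (hE : IsComatrix (k := k) E) (i j : Fin n) :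
    comul (R := k) (antipode k (E i j)) = ∑ l, antipode k (E l j) ⊗ₜ[k] antipode k (E i l) := by
  set X : Matrix (Fin n) (Fin n) (H ⊗[k] H) := fun i j => comul (R := k) (antipode k (E i j))
  set D : Matrix (Fin n) (Fin n) (H ⊗[k] H) := fun i j => comul (R := k) (E i j)
  set Z : Matrix (Fin n) (Fin n) (H ⊗[k] H) :=
    fun i j => ∑ l, antipode k (E l j) ⊗ₜ[k] antipode k (E i l)
  have hXD : X * D = 1 := by
    ext i j
    rw [Matrix.mul_apply]
    simp only [X, D, ← Bialgebra.comul_mul, ← map_sum, hE.sum_antipode_mul, Matrix.one_apply]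
    split_ifs
    · exact Bialgebra.comul_one
    · exact map_zero _
  have hDZ : D * Z = 1 := by
    ext i j
    rw [Matrix.mul_apply]
    simp only [D, Z, hE.comul_eq, Finset.sum_mul_sum, Algebra.TensorProduct.tmul_mul_tmul]
    rw [Finset.sum_comm]
    have h1 : ∀ p, ∑ m, ∑ l, (E i p * antipode k (E l j)) ⊗ₜ[k] (E p m * antipode k (E m l)) =
        (E i p * antipode k (E p j)) ⊗ₜ[k] (1 : H) := by
      intro p
      rw [Finset.sum_comm]
      simp only [← TensorProduct.tmul_sum, hE.sum_mul_antipode]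
      rw [Finset.sum_eq_single p (fun l _ hl => by rw [if_neg (Ne.symm hl), TensorProduct.tmul_zero])
        (by simp), if_pos rfl]
    simp only [h1, ← TensorProduct.sum_tmul, hE.sum_mul_antipode, Matrix.one_apply]
    split_ifs
    · rfl
    · exact TensorProduct.zero_tmul _ _
  have h2 : X = Z := left_inv_eq_right_inv hXD hDZ
  exact congrFun (congrFun h2 i) j

/-- The matrix of the conjugation coaction `S(E_ml) E_ip`. -/
def conjMatrix (k : Type*) {H : Type*} [Field k] [Ring H] [HopfAlgebra k H] {n : ℕ}
    (E : Matrix (Fin n) (Fin n) H) : Matrix (Fin n × Fin n) (Fin n × Fin n) H :=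
  fun I J => antipode k (E J.2 I.2) * E I.1 J.1

lemma isComatrix_conjMatrix (hE : IsComatrix (k := k) E) :
    IsComatrix (k := k) (conjMatrix k E) where
  comul_eq I J := by
    simp only [conjMatrix, Bialgebra.comul_mul, hE.comul_antipode, hE.comul_eq,
      Finset.sum_mul_sum, Algebra.TensorProduct.tmul_mul_tmul, Fintype.sum_prod_type]
    exact Finset.sum_comm
  counit_eq I J := by
    rw [conjMatrix, Bialgebra.counit_mul, HopfAlgebra.counit_antipode, hE.counit_eq,
      hE.counit_eq]
    by_cases h1 : I.1 = J.1 <;> by_cases h2 : I.2 = J.2 <;> simp [Prod.ext_iff, h1, h2, eq_comm (a := J.2)]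

end Conjugation

section ConjugationStable

open Coalgebra HopfAlgebra

lemma IsComatrix.comul_sum {k H ι : Type*} [Field k] [AddCommGroup H] [Module k H] [Coalgebra k H]
    [Fintype ι] [DecidableEq ι] {Y : Matrix ι ι H} (hY : IsComatrix (k := k) Y) (M : ι → k) (I : ι) :
    comul (R := k) (∑ J, M J • Y I J) = ∑ L, Y I L ⊗ₜ[k] ∑ J, M J • Y L J := by
  simp only [map_sum, map_smul, hY.comul_eq, Finset.smul_sum, TensorProduct.tmul_sum,
    TensorProduct.tmul_smul]
  exact Finset.sum_comm

/-- The identity matrix, as a vector. -/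
def idVec (k : Type*) [Field k] (n : ℕ) : Fin n × Fin n → k := fun I => if I.1 = I.2 then 1 else 0

variable {k H : Type*} [Field k] [Ring H] [HopfAlgebra k H] {n : ℕ} {E : Matrix (Fin n) (Fin n) H}

lemma sum_idVec {M : Type*} [AddCommGroup M] [Module k M] (F : Fin n × Fin n → M) :
    ∑ I, idVec k n I • F I = ∑ i, F (i, i) := by
  simp [Fintype.sum_prod_type, idVec]

lemma sum_idVec_conjMatrix (hE : IsComatrix (k := k) E) (M : Fin n × Fin n → k) :
    ∑ I, idVec k n I • ∑ J, M J • conjMatrix k E I J = (∑ i, M (i, i)) • (1 : H) := by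
  rw [sum_idVec, Finset.sum_comm]
  simp only [← Finset.smul_sum, conjMatrix, hE.sum_antipode_mul, Fintype.sum_prod_type,
    smul_ite, smul_zero, Finset.sum_ite_eq', Finset.mem_univ, if_true, Finset.sum_smul]

lemma counit_sum_conjMatrix (hE : IsComatrix (k := k) E) (M : Fin n × Fin n → k)
    (I : Fin n × Fin n) : counit (R := k) (∑ J, M J • conjMatrix k E I J) = M I := by
  simp [map_sum, map_smul, (isComatrix_conjMatrix hE).counit_eq]

namespace IsLinked

variable {ζ : k} {x β : H} {a : H →ₐ[k] H} {d : Module.End k H}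

lemma sum_conjMatrix_mem_coinv (h : IsLinked ζ x β a d) (hE : IsComatrix (k := k) E)
    (I : Fin n × Fin n) :
    ∑ J : Fin n × Fin n, cmat E a.toLinearMap J.1 J.2 • conjMatrix k E I J ∈ coinv a d := by
  set Γ := cmat E a.toLinearMap with hΓ
  set Ξ := cmat E d with hΞ
  have hΓ' : ∀ i j, counit (R := k) (a (E i j)) = Γ i j := fun i j => rfl
  have hΞ' : ∀ i j, counit (R := k) (d (E i j)) = Ξ i j := fun i j => rfl
  have key : ∀ D ∈ RI k H, D (∑ J : Fin n × Fin n, Γ J.1 J.2 • conjMatrix k E I J) =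
      ∑ L, (∑ J : Fin n × Fin n, cmat (conjMatrix k E) D L J * Γ J.1 J.2) • conjMatrix k E I L := by
    intro D hD
    simp only [map_sum, map_smul, (isComatrix_conjMatrix hE).RI_apply hD, Finset.smul_sum, smul_smul,
      Finset.sum_smul]
    rw [Finset.sum_comm]
    simp only [mul_comm]
  have ha : ∀ m j, ∑ p, Γ m p * counit (R := k) (a (antipode k (E p j))) = if m = j then 1 else 0 := by
    intro m j
    have h1 := congrArg (fun z => counit (R := k) (a z)) (hE.sum_mul_antipode m j)
    simp only [map_sum, map_mul, Bialgebra.counit_mul, hΓ'] at h1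
    rw [h1]
    split_ifs <;> simp
  have hd : ∀ m j, ∑ p, Γ m p * counit (R := k) (d (antipode k (E p j))) + Ξ m j = 0 := by
    intro m j
    have h1 := congrArg (fun z => counit (R := k) (d z)) (hE.sum_mul_antipode m j)
    simp only [map_sum, h.der.skew.2, map_add, Bialgebra.counit_mul, hΓ', hΞ',
      Finset.sum_add_distrib, HopfAlgebra.counit_antipode, hE.counit_eq] at h1
    simp only [mul_ite, mul_one, mul_zero, Finset.sum_ite_eq', Finset.mem_univ, if_true] at h1
    rw [h1]
    split_ifs <;> simp [h.der.d_one]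
  rw [mem_coinv]
  constructor
  · rw [key d h.der.skew.1]
    refine Finset.sum_eq_zero fun L _ => ?_
    convert zero_smul k _
    simp only [cmat_apply, conjMatrix, h.der.skew.2, map_add, Bialgebra.counit_mul, hΞ',
      hE.counit_eq, Fintype.sum_prod_type]
    have h2 : ∀ x, ∑ p, (counit (R := k) (a (antipode k (E p L.2))) * Ξ L.1 x +
        counit (R := k) (d (antipode k (E p L.2))) * if L.1 = x then 1 else 0) * Γ x p =
        (Ξ L.1 x * if x = L.2 then 1 else 0) - (if L.1 = x then 1 else 0) * Ξ x L.2 := by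
      intro x
      rw [← ha x L.2, eq_neg_of_add_eq_zero_right (hd x L.2), mul_neg, sub_neg_eq_add,
        Finset.mul_sum, Finset.mul_sum, ← Finset.sum_add_distrib]
      exact Finset.sum_congr rfl fun p _ => by ring
    simp only [h2]
    simp
  · have h1 := key _ h.der.mem
    rw [AlgHom.toLinearMap_apply] at h1
    rw [h1]
    refine Finset.sum_congr rfl fun L _ => ?_
    congr 1
    simp only [cmat_apply, AlgHom.toLinearMap_apply, conjMatrix, map_mul, Bialgebra.counit_mul, hΓ',
      Fintype.sum_prod_type]
    have h2 : ∀ x, ∑ p, counit (R := k) (a (antipode k (E p L.2))) * Γ L.1 x * Γ x p =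
        Γ L.1 x * if x = L.2 then 1 else 0 := by
      intro x
      rw [← ha x L.2, Finset.mul_sum]
      exact Finset.sum_congr rfl fun p _ => by ring
    simp only [h2]
    simp

lemma eq_smul_idVec_of_rowStable [FiniteDimensional k H] [CharZero k] [IsAlgClosed k] [NeZero n]
    (h : IsLinked ζ x β a d) (hn : Nat.Coprime n 5) (hE : IsComatrix (k := k) E)
    (hirr : RowIrreducible (k := k) E) {c : Fin n × Fin n → k} (hc : c ≠ 0)
    (hK : RowStable (conjMatrix k E) (Submodule.span k {c})) :
    ∃ μ : k, μ ≠ 0 ∧ c = μ • idVec k n := by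
  obtain ⟨χ, hχ, hcχ⟩ := RowStable.exists_isGroupLikeElem_of_line (isComatrix_conjMatrix hE) hc hK
  obtain ⟨-, μ, hμ, hA⟩ := h.schur' (A := fun i j => c (j, i)) hn hE hirr
    (fun h0 => hc (funext fun I => congrFun (congrFun h0 I.2) I.1)) hχ (by
      intro i m
      have h1 : ∀ p, ∑ I : Fin n × Fin n, c I • (E i p * antipode k (E p I.2) * E I.1 m) =
          c (m, p) • (E i p * χ) := by
        intro p
        rw [← mul_smul_comm, ← hcχ (m, p), Finset.mul_sum]
        simp only [mul_smul_comm, conjMatrix, mul_assoc]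
      rw [← Finset.sum_congr rfl fun p _ => h1 p, Finset.sum_comm]
      simp only [← Finset.smul_sum, ← Finset.sum_mul, hE.sum_mul_antipode, Fintype.sum_prod_type,
        ite_mul, one_mul, zero_mul, smul_ite, smul_zero, Finset.sum_ite_eq, Finset.mem_univ, if_true])
  refine ⟨μ, hμ, funext fun I => ?_⟩
  have h1 := congrFun (congrFun hA I.2) I.1
  change c I = _ at h1
  rw [h1, Pi.smul_apply, Matrix.smul_apply, Matrix.one_apply, idVec]
  simp only [eq_comm]

end IsLinked

end ConjugationStable

section SmallSimple

open Coalgebra HopfAlgebra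

lemma trace_ne_zero_of_pow_five {k : Type*} [Field k] [CharZero k] {Γ : Matrix (Fin 2) (Fin 2) k}
    (hΓ : Γ ^ 5 = 1) : ∑ i, Γ i i ≠ 0 := by
  intro h0
  rw [Fin.sum_univ_two] at h0
  have h1 : Γ 1 1 = -Γ 0 0 := by linear_combination h0
  set c := Γ 0 0 * Γ 0 0 + Γ 0 1 * Γ 1 0 with hc
  have h2 : Γ * Γ = c • 1 := by
    ext i j
    fin_cases i <;> fin_cases j <;> simp [Matrix.mul_apply, h1, hc] <;> ring
  have h3 : Γ ^ 5 = (c * c) • Γ := by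
    rw [show Γ ^ 5 = (Γ * Γ) * (Γ * Γ) * Γ by simp only [pow_succ, pow_zero, one_mul, mul_assoc], h2]
    simp [smul_smul]
  rw [hΓ] at h3
  have h4 := congrFun (congrFun h3 0) 0
  have h5 := congrFun (congrFun h3 1) 1
  simp only [Matrix.one_apply_eq, Matrix.smul_apply, smul_eq_mul] at h4 h5
  have h6 : (2 : k) = 0 := by linear_combination h4 + h5 + c * c * h0
  exact two_ne_zero h6

variable {k H : Type*} [Field k] [Ring H] [HopfAlgebra k H] {n : ℕ} {E : Matrix (Fin n) (Fin n) H}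

namespace IsLinked

variable [FiniteDimensional k H] [IsAlgClosed k]
  {ζ : k} {x β : H} {a : H →ₐ[k] H} {d : Module.End k H}

lemma sum_diag_ne_zero_of_rowStable [NeZero n] (h : IsLinked ζ x β a d) (hn : Nat.Coprime n 5)
    (hE : IsComatrix (k := k) E) (hirr : RowIrreducible (k := k) E)
    (htr : ∑ i, cmat E a.toLinearMap i i ≠ 0)
    (hΓ1 : ∀ I : Fin n × Fin n, ∑ J : Fin n × Fin n,
      cmat E a.toLinearMap J.1 J.2 • conjMatrix k E I J = cmat E a.toLinearMap I.1 I.2 • (1 : H))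
    {N : Fin n × Fin n → k} (hN : N ≠ 0)
    (hK : RowStable (conjMatrix k E) (LinearMap.ker (dotProductBilin k k N))) :
    ∑ i, N (i, i) ≠ 0 := by
  obtain ⟨χ, hχ, hNχ⟩ := RowStable.exists_isGroupLikeElem_of_hyperplane (isComatrix_conjMatrix hE) hN hK
  set Γ := cmat E a.toLinearMap with hΓ
  have hdet : IsUnit Γ.det := (h.det_cmat_a_ne_zero hE).isUnit
  set φ := algebraMap k Hᵐᵒᵖ with hφ
  set X : Matrix (Fin n) (Fin n) Hᵐᵒᵖ := fun i j => MulOpposite.op (E i j) with hX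
  set S : Matrix (Fin n) (Fin n) Hᵐᵒᵖ := fun i j => MulOpposite.op (antipode k (E i j)) with hS
  set N₀ : Matrix (Fin n) (Fin n) k := fun i j => N (i, j) with hN₀
  have hXS : ∀ (M : Matrix (Fin n) (Fin n) k) (η : H) ,
      (∀ I : Fin n × Fin n, ∑ J : Fin n × Fin n, M J.1 J.2 • conjMatrix k E I J = M I.1 I.2 • η) →
      X * M.map φ * S = MulOpposite.op η • M.map φ := by
    intro M η hM
    ext i l
    have h1 := congrArg MulOpposite.op (hM (i, l))
    rw [Matrix.smul_apply, Matrix.map_apply, smul_eq_mul, ← Algebra.commutes, ← Algebra.smul_def,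
      ← MulOpposite.op_smul, ← h1]
    simp only [Matrix.mul_apply, Matrix.map_apply, Finset.sum_mul, Fintype.sum_prod_type,
      conjMatrix, MulOpposite.op_smul, MulOpposite.op_mul, Finset.op_sum]
    rw [Finset.sum_comm]
    refine Finset.sum_congr rfl fun j _ => Finset.sum_congr rfl fun m _ => ?_
    rw [hX, hS, ← Algebra.commutes, ← Algebra.smul_def, smul_mul_assoc]
  have hGG : Γ.map φ * Γ⁻¹.map φ = 1 := by
    rw [← Matrix.map_mul, Matrix.mul_nonsing_inv _ hdet, Matrix.map_one _ (map_zero _) (map_one _)]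
  have hGG' : Γ⁻¹.map φ * Γ.map φ = 1 := by
    rw [← Matrix.map_mul, Matrix.nonsing_inv_mul _ hdet, Matrix.map_one _ (map_zero _) (map_one _)]
  have h1 : X * Γ.map φ * S = Γ.map φ := by
    rw [hXS Γ 1 hΓ1, MulOpposite.op_one, one_smul]
  have h2 : X * N₀.map φ * S = MulOpposite.op χ • N₀.map φ := hXS N₀ χ hNχ
  have : IsNoetherianRing Hᵐᵒᵖ := isNoetherian_of_tower k inferInstance
  have h3 : (Γ.map φ * S * Γ⁻¹.map φ) * X = 1 := by
    rw [mul_eq_one_comm, ← mul_assoc, ← mul_assoc, h1, hGG]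
  have h4 : S * (Γ⁻¹.map φ * X * Γ.map φ) = 1 := by
    have h5 : Γ⁻¹.map φ * ((Γ.map φ * S * Γ⁻¹.map φ) * X) * Γ.map φ = 1 := by
      rw [h3, mul_one, hGG']
    simpa only [← mul_assoc, hGG', one_mul] using h5
  have h5 : X * N₀.map φ = MulOpposite.op χ • (N₀.map φ * (Γ⁻¹.map φ * X * Γ.map φ)) := by
    rw [← Matrix.smul_mul, ← h2, mul_assoc, h4, mul_one]
  have h6 : X * (N₀ * Γ⁻¹).map φ = MulOpposite.op χ • ((N₀ * Γ⁻¹).map φ * X) := by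
    rw [Matrix.map_mul, ← mul_assoc, h5, Matrix.smul_mul]
    simp only [mul_assoc, hGG, mul_one]
  have hA0 : N₀ * Γ⁻¹ ≠ 0 := by
    intro h0
    have h7 : N₀ = 0 := by
      rw [← Matrix.mul_one N₀, ← Matrix.nonsing_inv_mul _ hdet, ← mul_assoc, h0, zero_mul]
    exact hN (funext fun I => congrFun (congrFun h7 I.1) I.2)
  obtain ⟨-, μ, hμ, hA⟩ := h.schur hn hE hirr hA0 hχ (by
    intro i m
    have h7 := congrArg MulOpposite.unop (congrFun (congrFun h6 i) m)
    rw [Matrix.mul_apply, Matrix.smul_apply, Matrix.mul_apply, smul_eq_mul, MulOpposite.unop_mul,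
      Finset.unop_sum, Finset.unop_sum, Finset.sum_mul] at h7
    simp only [Matrix.map_apply, hφ, hX, ← Algebra.commutes, ← Algebra.smul_def,
      MulOpposite.unop_smul, MulOpposite.unop_op, smul_mul_assoc] at h7
    exact h7)
  have hN1 : N₀ = μ • Γ := by
    rw [← Matrix.mul_one N₀, ← Matrix.nonsing_inv_mul _ hdet, ← mul_assoc, hA, smul_mul_assoc, one_mul]
  have hN2 : ∀ i, N (i, i) = μ * Γ i i := fun i => congrFun (congrFun hN1 i) i
  simp only [hN2, ← Finset.mul_sum]
  exact mul_ne_zero hμ htr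

end IsLinked

end SmallSimple

section TwoDimensionalSimple

open Coalgebra HopfAlgebra

lemma finrank_comap_eq {k M N : Type*} [Field k] [AddCommGroup M] [Module k M] [AddCommGroup N]
    [Module k N] [FiniteDimensional k M] (f : M →ₗ[k] N) (W : Submodule k N) :
    Module.finrank k (W.comap f) =
      Module.finrank k (LinearMap.range f ⊓ W : Submodule k N) +
        Module.finrank k (LinearMap.ker f) := by
  rw [← finrank_map_add_finrank_inf_ker f (W.comap f), Submodule.map_comap_eq,
    inf_eq_right.mpr (LinearMap.ker_le_comap f)]

lemma exists_ker_dotProduct_of_finrank {k : Type*} [Field k]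
    {K : Submodule k (Fin 2 × Fin 2 → k)} (hK : Module.finrank k K = 3) :
    ∃ N : Fin 2 × Fin 2 → k, N ≠ 0 ∧ K = LinearMap.ker (dotProductBilin k k N) := by
  obtain ⟨x, hx⟩ : ∃ x, x ∉ K := by
    by_contra! h0
    rw [(Submodule.eq_top_iff'.mpr h0 : K = ⊤), finrank_top, Module.finrank_fintype_fun_eq_card] at hK
    simp at hK
  obtain ⟨f, hfx, hf⟩ := exists_dual_ne_zero_of_notMem hx
  set N : Fin 2 × Fin 2 → k := fun I => f (Pi.single I 1) with hN
  have hfN : ∀ c, dotProductBilin k k N c = f c := by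
    intro c
    change N ⬝ᵥ c = f c
    conv_rhs => rw [pi_eq_sum_univ' c]
    rw [map_sum, dotProduct]
    refine Finset.sum_congr rfl fun I _ => ?_
    rw [map_smul, smul_eq_mul, mul_comm]
  have hne : dotProductBilin k k N ≠ 0 := fun h0 => hfx (by rw [← hfN, h0, LinearMap.zero_apply])
  refine ⟨N, fun h0 => hne (by rw [h0, map_zero]), ?_⟩
  refine Submodule.eq_of_le_of_finrank_le (fun c hc => ?_) ?_
  · rw [LinearMap.mem_ker, hfN, hf c hc]
  · have h1 := (dotProductBilin k k N).finrank_range_add_finrank_ker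
    rw [Module.finrank_fintype_fun_eq_card] at h1
    have h2 : 0 < Module.finrank k (LinearMap.range (dotProductBilin k k N)) := by
      rw [Module.finrank_pos_iff, Submodule.nontrivial_iff_ne_bot]
      exact fun h0 => hne (LinearMap.range_eq_bot.mp h0)
    simp only [Fintype.card_prod, Fintype.card_fin] at h1
    omega

namespace IsLinked

variable {k H : Type*} [Field k] [Ring H] [HopfAlgebra k H] [FiniteDimensional k H]
  [CharZero k] [IsAlgClosed k] {E : Matrix (Fin 2) (Fin 2) H}
  {ζ : k} {x β : H} {a : H →ₐ[k] H} {d : Module.End k H}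

lemma idVec_mem_of_finrank_one (h : IsLinked ζ x β a d) (hE : IsComatrix (k := k) E)
    (hirr : RowIrreducible (k := k) E) {K : Submodule k (Fin 2 × Fin 2 → k)}
    (hK : RowStable (conjMatrix k E) K) (hK1 : Module.finrank k K = 1) : idVec k 2 ∈ K := by
  obtain ⟨c, hc, hc0⟩ : ∃ c ∈ K, c ≠ 0 :=
    Submodule.exists_mem_ne_zero_of_ne_bot fun h0 => by rw [h0, finrank_bot] at hK1; omega
  have hKc : K = Submodule.span k {c} := by
    refine (Submodule.eq_of_le_of_finrank_eq ?_ ?_).symm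
    · rwa [Submodule.span_singleton_le_iff_mem]
    · rw [finrank_span_singleton hc0, hK1]
  obtain ⟨μ, hμ, hcμ⟩ := h.eq_smul_idVec_of_rowStable (by norm_num) hE hirr hc0 (hKc ▸ hK)
  have h1 : idVec k 2 = μ⁻¹ • c := by rw [hcμ, smul_smul, inv_mul_cancel₀ hμ, one_smul]
  rw [h1]
  exact K.smul_mem _ hc

variable [Nontrivial H]

lemma sum_conjMatrix_eq_smul_one (h : IsLinked ζ x β a d) {V : Submodule k H}
    (hVR : V ≤ coinv a d) (hV : IsSimpleLC V) (hV2 : Module.finrank k V = 2)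
    (hE : IsComatrix (k := k) E) (hirr : RowIrreducible (k := k) E) (I : Fin 2 × Fin 2) :
    ∑ J : Fin 2 × Fin 2, cmat E a.toLinearMap J.1 J.2 • conjMatrix k E I J =
      cmat E a.toLinearMap I.1 I.2 • (1 : H) := by
  have htr := trace_ne_zero_of_pow_five (h.cmat_a_pow hE)
  set g : Fin 2 × Fin 2 → k := fun J => cmat E a.toLinearMap J.1 J.2 with hg
  set F : Fin 2 × Fin 2 → H := fun I => ∑ J, g J • conjMatrix k E I J with hFdef
  have hF : ∀ I, comul (R := k) (F I) = ∑ L, conjMatrix k E I L ⊗ₜ[k] F L := fun I =>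
    (isComatrix_conjMatrix hE).comul_sum g I
  set T := Fintype.linearCombination k F with hT
  have hT1 : T (idVec k 2) = (∑ i, g (i, i)) • (1 : H) := by
    rw [hT, Fintype.linearCombination_apply]
    exact sum_idVec_conjMatrix hE g
  have hTR : LinearMap.range T ≤ coinv a d := by
    rintro _ ⟨c, rfl⟩
    rw [hT, Fintype.linearCombination_apply]
    exact Submodule.sum_mem _ fun I _ => Submodule.smul_mem _ _ (h.sum_conjMatrix_mem_coinv hE I)
  have hLC : IsLC (LinearMap.range T) := RowStable.isLC_range hF
  have h1T : (1 : H) ∈ LinearMap.range T := by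
    have h1 := Submodule.smul_mem (LinearMap.range T) (∑ i, g (i, i))⁻¹ ⟨_, hT1⟩
    rwa [smul_smul, inv_mul_cancel₀ htr, one_smul] at h1
  have hrk := T.finrank_range_add_finrank_ker
  rw [Module.finrank_fintype_fun_eq_card, Fintype.card_prod, Fintype.card_fin] at hrk
  have hker : RowStable (conjMatrix k E) (LinearMap.ker T) := RowStable.comap hF isLC_bot
  have h1V := hV.grouplike_notMem (by omega) (IsGroupLikeElem.one (R := k) (A := H))
  have hker1 : Module.finrank k (LinearMap.ker T) ≠ 1 := by
    intro h0
    have h1 := h.idVec_mem_of_finrank_one hE hirr hker h0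
    rw [LinearMap.mem_ker, hT1] at h1
    exact htr ((smul_eq_zero.mp h1).resolve_right one_ne_zero)
  have hr2 : Module.finrank k (LinearMap.range T) ≠ 2 := fun h0 =>
    h.false_of_finrank_two hVR hV (by omega) hLC hTR h1T h0
  have hr4 : Module.finrank k (LinearMap.range T) ≠ 4 := by
    intro h0
    have hVT : V ≤ LinearMap.range T := by
      by_contra hVT
      have h2 : V ⊓ LinearMap.range T = ⊥ := by
        by_contra h3
        have h4 := hV.eq_of_le _ (hV.isLC.inf hLC) inf_le_left h3
        exact hVT (inf_eq_left.mp h4)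
      have h3 := Submodule.finrank_sup_add_finrank_inf_eq V (LinearMap.range T)
      rw [h2, finrank_bot, hV2, h0] at h3
      have h4 := Submodule.finrank_mono (sup_le hVR hTR)
      rw [h.finrank_coinv] at h4
      omega
    exact h.false_of_flag hVR hV (by omega) (isLC_one_sup hV.isLC) hLC
      (sup_le ((Submodule.span_singleton_le_iff_mem _ _).mpr h1T) hVT) hTR
      (by rw [finrank_one_sup h1V, hV2]) h0
  have hr0 : Module.finrank k (LinearMap.range T) ≠ 0 := by
    intro h0
    rw [Submodule.finrank_eq_zero] at h0
    rw [h0, Submodule.mem_bot] at h1T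
    exact one_ne_zero h1T
  have hspan : Submodule.span k {(1 : H)} = LinearMap.range T := by
    refine Submodule.eq_of_le_of_finrank_le ((Submodule.span_singleton_le_iff_mem _ _).mpr h1T) ?_
    rw [finrank_span_singleton one_ne_zero]
    omega
  have hFI : F I ∈ LinearMap.range T := ⟨Pi.single I 1, by
    rw [hT, Fintype.linearCombination_apply_single, one_smul]⟩
  rw [← hspan] at hFI
  obtain ⟨c, hc⟩ := Submodule.mem_span_singleton.mp hFI
  have h2 := congrArg (counit (R := k)) hc
  rw [map_smul, Bialgebra.counit_one, smul_eq_mul, mul_one] at h2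
  have h3 : counit (R := k) (F I) = g I := counit_sum_conjMatrix hE g I
  change F I = g I • 1
  rw [← h3, ← h2, hc]

lemma finrank_eq_of_rowStable (h : IsLinked ζ x β a d) {V : Submodule k H}
    (hVR : V ≤ coinv a d) (hV : IsSimpleLC V) (hV2 : Module.finrank k V = 2)
    (hE : IsComatrix (k := k) E) (hirr : RowIrreducible (k := k) E)
    {K : Submodule k (Fin 2 × Fin 2 → k)} (hK : RowStable (conjMatrix k E) K)
    (hK1 : idVec k 2 ∈ K) : Module.finrank k K = 1 ∨ Module.finrank k K = 4 := by
  have htr := trace_ne_zero_of_pow_five (h.cmat_a_pow hE)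
  have hg := h.sum_conjMatrix_eq_smul_one hVR hV hV2 hE hirr
  set F : Fin 2 × Fin 2 → H :=
    fun I => ∑ J : Fin 2 × Fin 2, cmat E a.toLinearMap J.1 J.2 • conjMatrix k E I J with hFdef
  have hF : ∀ I, comul (R := k) (F I) = ∑ L, conjMatrix k E I L ⊗ₜ[k] F L := fun I =>
    (isComatrix_conjMatrix hE).comul_sum (fun J => cmat E a.toLinearMap J.1 J.2) I
  set T := Fintype.linearCombination k F with hT
  have hker : RowStable (conjMatrix k E) (LinearMap.ker T) := RowStable.comap hF isLC_bot
  have hT1 : T (idVec k 2) ≠ 0 := by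
    rw [hT, Fintype.linearCombination_apply, sum_idVec_conjMatrix hE]
    exact smul_ne_zero htr one_ne_zero
  have hle : Module.finrank k K ≤ 4 := by
    refine (Submodule.finrank_le K).trans ?_
    simp
  have hne0 : Module.finrank k K ≠ 0 := by
    intro h0
    rw [Submodule.finrank_eq_zero] at h0
    rw [h0, Submodule.mem_bot] at hK1
    exact hT1 (by rw [hK1, map_zero])
  have hne3 : Module.finrank k K ≠ 3 := by
    intro h0
    obtain ⟨N, hN, hKN⟩ := exists_ker_dotProduct_of_finrank h0
    refine h.sum_diag_ne_zero_of_rowStable (by norm_num) hE hirr htr hg hN (hKN ▸ hK) ?_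
    rw [hKN, LinearMap.mem_ker] at hK1
    change N ⬝ᵥ idVec k 2 = 0 at hK1
    rw [← hK1, dotProduct, ← sum_idVec (k := k) N]
    simp [mul_comm]
  have hne2 : Module.finrank k K ≠ 2 := by
    intro h0
    have h1 := finrank_map_add_finrank_inf_ker T K
    have h2 : K.map T = Submodule.span k {(1 : H)} := by
      refine Submodule.eq_of_le_of_finrank_le ?_ ?_
      · rintro _ ⟨c, -, rfl⟩
        rw [hT, Fintype.linearCombination_apply]
        refine Submodule.sum_mem _ fun I _ => Submodule.smul_mem _ _ ?_
        rw [show F I = cmat E a.toLinearMap I.1 I.2 • (1 : H) from hg I]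
        exact Submodule.smul_mem _ _ (Submodule.mem_span_singleton_self _)
      · rw [finrank_span_singleton one_ne_zero]
        rw [Nat.one_le_iff_ne_zero, Ne, Submodule.finrank_eq_zero]
        intro h3
        have h4 := Submodule.mem_map_of_mem (f := T) hK1
        rw [h3, Submodule.mem_bot] at h4
        exact hT1 h4
    rw [h2, finrank_span_singleton one_ne_zero, h0] at h1
    have h3 := h.idVec_mem_of_finrank_one hE hirr (hK.inf hker) (by omega)
    exact hT1 h3.2
  omega

lemma false_of_finrank_simple_eq_two (h : IsLinked ζ x β a d) {V : Submodule k H}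
    (hVR : V ≤ coinv a d) (hV : IsSimpleLC V) (hV2 : Module.finrank k V = 2) : False := by
  obtain ⟨-, -, -, E, hE, -, -, hirr⟩ := hV.exists_comatrix hV2
  have hdich := fun {K} (hK : RowStable (conjMatrix k E) K) hK1 =>
    h.finrank_eq_of_rowStable hVR hV hV2 hE hirr hK hK1
  have hY := isComatrix_conjMatrix hE
  set Y := conjMatrix k E with hYdef
  set T := Fintype.linearCombination k (fun I => Y I (0, 1)) with hT
  have hT1 : T (idVec k 2) = 0 := by
    rw [hT, Fintype.linearCombination_apply, sum_idVec]
    exact (hE.sum_antipode_mul 1 0).trans (if_neg (by decide))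
  have hT0 : LinearMap.range T ≠ ⊥ := by
    intro h0
    have h1 : T (Pi.single (0, 1) 1) = 0 := by
      rw [LinearMap.range_eq_bot.mp h0, LinearMap.zero_apply]
    rw [hT, Fintype.linearCombination_apply_single, one_smul] at h1
    have h2 := hY.counit_eq (0, 1) (0, 1)
    rw [h1, map_zero, if_pos rfl] at h2
    exact zero_ne_one h2
  obtain ⟨P, hP, i, hPne, hPmem⟩ := h.exists_transport hT0
  set F : Fin 2 × Fin 2 → H := fun I => P (Y I (0, 1)) * β ^ i with hFdef
  have hβ : IsUnit (β ^ i) := h.taft.isUnit.pow i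
  obtain ⟨v, hv⟩ := hβ.exists_right_inv
  have hF : ∀ I, comul (R := k) (F I) = ∑ L, (Y I L * β ^ i) ⊗ₜ[k] F L := by
    intro I
    simp only [hFdef, Bialgebra.comul_mul, comul_RI hP, hY.comul_eq, map_sum,
      LinearMap.lTensor_tmul, Finset.sum_mul, (h.taft.gl.pow (n := i)).comul_eq_tmul_self,
      Algebra.TensorProduct.tmul_mul_tmul]
  set T' := Fintype.linearCombination k F with hT'
  have hTT' : ∀ c, T' c = P (T c) * β ^ i := by
    intro c
    simp only [hT, hT', Fintype.linearCombination_apply, hFdef, map_sum, map_smul, Finset.sum_mul,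
      smul_mul_assoc]
  have hT'1 : T' (idVec k 2) = 0 := by rw [hTT', hT1, map_zero, zero_mul]
  have hT'R : LinearMap.range T' ≤ coinv a d := by
    rintro _ ⟨c, rfl⟩
    rw [hTT']
    exact hPmem _ ⟨c, rfl⟩
  have hstab : ∀ {W : Submodule k H}, IsLC W →
      Module.finrank k (W.comap T') = 1 ∨ Module.finrank k (W.comap T') = 4 := fun {W} hW =>
    hdich ((RowStable.comap (Y := fun I J => Y I J * β ^ i) hF hW).of_mul hv)
      (by rw [Submodule.mem_comap, hT'1]; exact zero_mem _)
  have hrk := T'.finrank_range_add_finrank_ker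
  rw [Module.finrank_fintype_fun_eq_card, Fintype.card_prod, Fintype.card_fin] at hrk
  have hker : Module.finrank k (LinearMap.ker T') = 1 := by
    refine (hstab isLC_bot).resolve_right fun h0 => ?_
    change Module.finrank k (LinearMap.ker T') = 4 at h0
    apply hPne
    rw [Submodule.eq_bot_iff]
    rintro _ ⟨_, ⟨c, rfl⟩, rfl⟩
    have h1 : T' c = 0 := by
      have h2 : LinearMap.range T' = ⊥ := by
        rw [← Submodule.finrank_eq_zero (R := k)]
        omega
      rw [LinearMap.range_eq_bot.mp h2, LinearMap.zero_apply]
    rw [hTT'] at h1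
    exact (hβ.mul_left_eq_zero).mp h1
  have h1V := hV.grouplike_notMem (by omega) (IsGroupLikeElem.one (R := k) (A := H))
  set B := Submodule.span k {(1 : H)} ⊔ V with hB
  have hB3 : Module.finrank k B = 3 := by rw [hB, finrank_one_sup h1V, hV2]
  have hcap := Submodule.finrank_sup_add_finrank_inf_eq (LinearMap.range T') B
  have hsup : Module.finrank k (LinearMap.range T' ⊔ B : Submodule k H) ≤
      Module.finrank k (coinv a d) := Submodule.finrank_mono (sup_le hT'R (h.one_sup_le hVR))
  rw [h.finrank_coinv] at hsup
  have hBT : LinearMap.range T' ⊓ B = B := by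
    have h1 : Module.finrank k (B.comap T') = 1 ∨ Module.finrank k (B.comap T') = 4 :=
      hstab (isLC_one_sup hV.isLC)
    rw [finrank_comap_eq, hker] at h1
    refine Submodule.eq_of_le_of_finrank_le inf_le_right ?_
    omega
  have h1T : LinearMap.range T' ⊓ Submodule.span k {(1 : H)} = Submodule.span k {(1 : H)} :=
    inf_eq_right.mpr ((le_sup_left.trans_eq hB.symm).trans (inf_eq_right.mp hBT))
  have h2 := hstab (isLC_span_grouplike (.one : IsGroupLikeElem k (1 : H)))
  rw [finrank_comap_eq, hker, h1T, finrank_span_singleton one_ne_zero] at h2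
  omega

end IsLinked

end TwoDimensionalSimple

lemma IsTaftPair.exists_eq_pow {k H : Type*} [Field k] [Ring H] [HopfAlgebra k H]
    {ζ : k} {x β : H} (h : IsTaftPair ζ x β)
    (hc : Nat.card (GroupLike k H) = 5) {χ : H} (hχ : IsGroupLikeElem k χ) : ∃ i, χ = β ^ i := by
  have hfin : Finite (GroupLike k H) := Nat.finite_of_card_ne_zero (by omega)
  have hinj : Function.Injective fun i : Fin 5 => (⟨β ^ (i : ℕ), h.gl.pow⟩ : GroupLike k H) :=
    fun i j hij => h.linearIndependent_gl.injective (congrArg GroupLike.val hij)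
  obtain ⟨i, hi⟩ := (hinj.bijective_of_nat_card_le (by rw [hc, Nat.card_fin])).2 ⟨χ, hχ⟩
  exact ⟨i, (congrArg GroupLike.val hi).symm⟩

end HopfDim

open HopfClass in
/-- Let `H` be a Hopf algebra of dimension `125 = 5³` that is nonsemisimple, nonpointed and
non-copointed and of type `(5,5)`. Then `H` and its dual `H*` cannot both contain a
nontrivial skew-primitive element. -/
theorem dim_125_not_both_skewPrimitives
    (k : Type*) [Field k] [IsAlgClosed k] [CharZero k]
    (H : Type*) [Ring H] [HopfAlgebra k H] [FiniteDimensional k H]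
    (hdim : Module.finrank k H = 125)
    (hnss : ¬ IsSemisimpleRing H) (hnp : ¬ IsPointed k H) (hncop : ¬ IsCopointed k H)
    (hG : (grouplikes k H).ncard = 5)
    (hGdual : (dualGrouplikes k H).ncard = 5) :
    ¬ ((∃ g h y : H, g ∈ grouplikes k H ∧ h ∈ grouplikes k H ∧
        IsSkewPrimitiveWrt k (comulL k H) g h y ∧ ∀ c : k, y ≠ c • (g - h)) ∧
      (∃ f g' y' : Module.Dual k H,
        IsGrouplikeWrt k (dualComul k H) f ∧ IsGrouplikeWrt k (dualComul k H) g' ∧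
        IsSkewPrimitiveWrt k (dualComul k H) f g' y' ∧ ∀ c : k, y' ≠ c • (f - g'))) := by
  rintro ⟨⟨g, h, y, hg, hh, hy, hy'⟩, f, f', z, hf, hf', hz, hz'⟩
  obtain ⟨ζ₀, hζ₀⟩ := HasEnoughRootsOfUnity.exists_primitiveRoot k 5
  have : Nontrivial H := Module.nontrivial_of_finrank_pos (R := k) (by omega)
  have hc := HopfDim.card_groupLike hG
  obtain ⟨ζ, x, β, ht⟩ := HopfDim.exists_isTaftPair hζ₀ hc (HopfDim.isGroupLikeElem_of_wrt hg)
    (HopfDim.isGroupLikeElem_of_wrt hh) hy hy'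
  obtain ⟨a, ha, ha5, d, hd, q, hq, hcomm, hd4, hd5⟩ :=
    HopfDim.exists_skewDer hζ₀ hGdual hf hf' hz hz'
  have hder : HopfDim.IsDerPair q a d := ⟨hq, ha, ha5, hd, hcomm, hd4, hd5⟩
  obtain ⟨V, hV, hV2⟩ := HopfDim.exists_simpleLC_of_not_isPointed hnp
  by_cases hx : d x = 0
  · exact hder.false_of_d_eq_zero ht hdim hx hV hV2
  obtain ⟨x', hl⟩ := hder.isLinked ht hdim hx fun χ hχ => ht.exists_eq_pow hc hχ
  obtain ⟨W, hWR, hW, hWV⟩ := hl.exists_simple hV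
  rw [← hWV] at hV2
  have hW4 := hl.finrank_simple_le hWR hW hV2
  obtain h2 | h3 | h4 : Module.finrank k W = 2 ∨ Module.finrank k W = 3 ∨
      Module.finrank k W = 4 := by omega
  · exact hl.false_of_finrank_simple_eq_two hWR hW h2
  · exact hl.false_of_finrank_three hWR hW h3
  · exact hl.false_of_finrank_four hWR hW h4
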